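/- Let n ≥ 1 and 1 < p < ∞. There exists a constant C > 0, depending only on n and p, such that for every u ∈ C^∞(Q₁) and f ∈ C^∞(Q₁) satisfying ∂_t u − Δu = f pointwise in Q₁, one has ∫_{Q_{1/2}} (|D²u|^p + |∂_t u|^p) ≤ C (∫_{Q₁} |u|^p + ∫_{Q₁} |f|^p), where the integrals are taken in [0,∞] with respect to Lebesgue measure on ℝⁿ×ℝ. -/

import Mathlib

open MeasureTheory Metric ENNReal

/-- The parabolic cube `Q_r(x₀,t₀) = B_r(x₀) × (t₀ − r²/2, t₀ + r²/2]` in `ℝⁿ × ℝ`. -/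
noncomputable def pCube {n : ℕ} (r : ℝ) (c : EuclideanSpace ℝ (Fin n) × ℝ) :
    Set (EuclideanSpace ℝ (Fin n) × ℝ) :=
  (ball c.1 r) ×ˢ Set.Ioc (c.2 - r ^ 2 / 2) (c.2 + r ^ 2 / 2)

/-- Spatial partial derivative `∂_{x_i} u` of `u : ℝⁿ × ℝ → ℝ`. -/
noncomputable def pdx {n : ℕ} (i : Fin n) (u : EuclideanSpace ℝ (Fin n) × ℝ → ℝ) :
    EuclideanSpace ℝ (Fin n) × ℝ → ℝ :=
  fun z => fderiv ℝ u z (EuclideanSpace.single i 1, 0)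

/-- Time derivative `∂_t u` of `u : ℝⁿ × ℝ → ℝ`. -/
noncomputable def pdt {n : ℕ} (u : EuclideanSpace ℝ (Fin n) × ℝ → ℝ) :
    EuclideanSpace ℝ (Fin n) × ℝ → ℝ :=
  fun z => fderiv ℝ u z (0, 1)

/-- Entry `(i,j)` of the spatial Hessian `D²u`, i.e. `∂_{x_j} ∂_{x_i} u`. -/
noncomputable def hessEntryP {n : ℕ} (u : EuclideanSpace ℝ (Fin n) × ℝ → ℝ)
    (i j : Fin n) : EuclideanSpace ℝ (Fin n) × ℝ → ℝ :=
  pdx j (pdx i u)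

/-- Squared Frobenius norm `|D²u(z)|²` of the spatial Hessian. -/
noncomputable def hessFrobSqP {n : ℕ} (u : EuclideanSpace ℝ (Fin n) × ℝ → ℝ)
    (z : EuclideanSpace ℝ (Fin n) × ℝ) : ℝ :=
  ∑ i, ∑ j, (hessEntryP u i j z) ^ 2

/-- Spatial Laplacian `Δu = tr D²u`. -/
noncomputable def lapP {n : ℕ} (u : EuclideanSpace ℝ (Fin n) × ℝ → ℝ)
    (z : EuclideanSpace ℝ (Fin n) × ℝ) : ℝ :=
  ∑ i, hessEntryP u i i z

/-- A nested sequence of countable measurable partitions, indexed by `ℤ`, all of whose cells at a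
given level have the same finite positive measure, with bounded ratio between adjacent levels. -/
structure IsDyadicSystem {X ι : Type*} [MeasurableSpace X] (μ : Measure X) (idx : ℤ → X → ι)
    (m : ℤ → ℝ) (D : ℝ) : Prop where
  measurableSet_cell : ∀ k c, MeasurableSet (idx k ⁻¹' {c})
  nested : ∀ k z w, idx (k + 1) z = idx (k + 1) w → idx k z = idx k w
  measure_cell : ∀ k c, μ (idx k ⁻¹' {c}) = ENNReal.ofReal (m k)
  pos : ∀ k, 0 < m k
  doubling : ∀ k, m k ≤ D * m (k + 1)
  tendsto : Filter.Tendsto m Filter.atBot Filter.atTop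

namespace IsDyadicSystem

variable {X ι : Type*} [MeasurableSpace X] {μ : Measure X} {idx : ℤ → X → ι}
    {m : ℤ → ℝ} {D : ℝ}

theorem nested_of_le (h : IsDyadicSystem μ idx m D) {j k : ℤ} (hjk : j ≤ k) {z w : X}
    (hzw : idx k z = idx k w) : idx j z = idx j w := by
  obtain ⟨d, rfl⟩ := Int.le.dest hjk
  induction d with
  | zero => simpa using hzw
  | succ d ih =>
    refine ih (by omega) (h.nested _ _ _ ?_)
    have : j + (d : ℤ) + 1 = j + ((d + 1 : ℕ) : ℤ) := by push_cast; ring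
    rwa [this]

theorem ratio_pos (h : IsDyadicSystem μ idx m D) : 0 < D := by
  have h1 := h.doubling 0
  have h2 := h.pos 0
  have h3 := h.pos (0 + 1)
  by_contra hD
  nlinarith

/-- The maximal cells on which the average of `|f|` exceeds `a`. -/
theorem exists_stopping_cells (h : IsDyadicSystem μ idx m D) {f : X → ℝ} (hf : Integrable f μ)
    {a : ℝ} (ha : 0 < a) :
    ∃ S : Set (ℤ × ι), S.PairwiseDisjoint (fun q => idx q.1 ⁻¹' {q.2}) ∧
      (∀ q ∈ S, ENNReal.ofReal a * μ (idx q.1 ⁻¹' {q.2}) ≤ ∫⁻ w in idx q.1 ⁻¹' {q.2}, ‖f w‖ₑ ∂μ) ∧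
      (∀ q ∈ S, ∫⁻ w in idx q.1 ⁻¹' {q.2}, ‖f w‖ₑ ∂μ ≤
        ENNReal.ofReal (D * a) * μ (idx q.1 ⁻¹' {q.2})) ∧
      ∀ z, (∀ q ∈ S, z ∉ idx q.1 ⁻¹' {q.2}) → ∀ k,
        ∫⁻ w in idx k ⁻¹' {idx k z}, ‖f w‖ₑ ∂μ ≤ ENNReal.ofReal a * μ (idx k ⁻¹' {idx k z}) := by
  classical
  set bad : ℤ → X → Prop := fun k z =>
    ENNReal.ofReal a * μ (idx k ⁻¹' {idx k z}) < ∫⁻ w in idx k ⁻¹' {idx k z}, ‖f w‖ₑ ∂μ with hbad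
  have bad_congr : ∀ {k z w}, idx k z = idx k w → (bad k z ↔ bad k w) := by
    intro k z w hzw; simp only [hbad, hzw]
  have hD := h.ratio_pos
  obtain ⟨k₀, hk₀⟩ : ∃ k₀ : ℤ, ∀ k ≤ k₀, ∀ z, ¬ bad k z := by
    have h1 := (h.tendsto.eventually_ge_atTop ((∫⁻ w, ‖f w‖ₑ ∂μ).toReal / a))
    obtain ⟨k₀, hk₀⟩ := Filter.eventually_atBot.1 h1
    refine ⟨k₀, fun k hk z => ?_⟩
    simp only [hbad, not_lt]
    refine (setLIntegral_le_lintegral _ _).trans ?_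
    rw [h.measure_cell, ← ENNReal.ofReal_mul ha.le]
    refine ENNReal.le_ofReal_iff_toReal_le hf.2.ne (by have := h.pos k; positivity) |>.2 ?_
    have := hk₀ k hk
    rw [div_le_iff₀ ha] at this
    linarith
  refine ⟨{q | ∃ z, idx q.1 z = q.2 ∧ bad q.1 z ∧ ∀ j < q.1, ¬ bad j z}, ?_, ?_, ?_, ?_⟩
  · rintro ⟨k, c⟩ ⟨z, hz, hb, hs⟩ ⟨k', c'⟩ ⟨z', hz', hb', hs'⟩ hne
    rw [Function.onFun, Set.disjoint_left]
    rintro y hy hy'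
    simp only [Set.mem_preimage, Set.mem_singleton_iff] at *
    rcases lt_trichotomy k k' with hlt | heq | hgt
    · have : idx k z' = idx k y := h.nested_of_le hlt.le (hz'.trans hy'.symm)
      exact hs' k hlt ((bad_congr (this.trans (hy.trans hz.symm))).2 hb)
    · subst heq
      exact hne (by rw [← hy, ← hy'])
    · have : idx k' z = idx k' y := h.nested_of_le hgt.le (hz.trans hy.symm)
      exact hs k' hgt ((bad_congr (this.trans (hy'.trans hz'.symm))).2 hb')
  · rintro ⟨k, c⟩ ⟨z, hz, hb, hs⟩
    simp only at hz ⊢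
    rw [← hz]; exact hb.le
  · rintro ⟨k, c⟩ ⟨z, hz, hb, hs⟩
    simp only at hz ⊢
    rw [← hz]
    have hsub : idx k ⁻¹' {idx k z} ⊆ idx (k - 1) ⁻¹' {idx (k - 1) z} := fun w hw =>
      h.nested_of_le (by omega) hw
    have hn := hs (k - 1) (by simp)
    simp only [hbad, not_lt] at hn
    refine (lintegral_mono_set hsub).trans (hn.trans ?_)
    rw [h.measure_cell, h.measure_cell, ← ENNReal.ofReal_mul ha.le, ← ENNReal.ofReal_mul
      (by positivity)]
    apply ENNReal.ofReal_le_ofReal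
    have := h.doubling (k - 1)
    rw [sub_add_cancel] at this
    nlinarith
  · intro z hz k
    by_contra hcon
    have hcon : bad k z := not_le.1 hcon
    have hbdd : ∃ b : ℤ, ∀ j, bad j z → b ≤ j :=
      ⟨k₀, fun j hj => by by_contra hlt; exact hk₀ j (by omega) z hj⟩
    obtain ⟨j, hj, hmin⟩ := Int.exists_least_of_bdd hbdd ⟨k, hcon⟩
    refine hz (j, idx j z) ⟨z, rfl, hj, fun i hi hbi => ?_⟩ rfl
    have := hmin i hbi
    simp only at hi
    omega

/-- The **Calderón–Zygmund decomposition** `f = g + ∑ b` at height `a`. -/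
theorem exists_decomposition [Countable ι] (h : IsDyadicSystem μ idx m D)
    {f : X → ℝ} (hfm : Measurable f) (hf : Integrable f μ)
    (hdiff : ∀ z, ∀ c : ℝ≥0∞, (∀ k, ∫⁻ w in idx k ⁻¹' {idx k z}, ‖f w‖ₑ ∂μ ≤
      c * μ (idx k ⁻¹' {idx k z})) → ‖f z‖ₑ ≤ c)
    {a : ℝ} (ha : 0 < a) :
    ∃ (S : Set (ℤ × ι)) (g : X → ℝ), Measurable g ∧ Integrable g μ ∧ (∃ M, ∀ z, |g z| ≤ M) ∧
      S.PairwiseDisjoint (fun q => idx q.1 ⁻¹' {q.2}) ∧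
      (∀ z, (∀ q ∈ S, z ∉ idx q.1 ⁻¹' {q.2}) → g z = f z) ∧
      (∀ q ∈ S, ∫ w in idx q.1 ⁻¹' {q.2}, (f w - g w) ∂μ = 0) ∧
      (∀ q ∈ S, ∫⁻ w in idx q.1 ⁻¹' {q.2}, ‖f w - g w‖ₑ ∂μ ≤
        2 * ENNReal.ofReal (D * a) * μ (idx q.1 ⁻¹' {q.2})) ∧
      ∫⁻ z, ‖g z‖ₑ ^ 2 ∂μ ≤ ∫⁻ z in {z | ‖f z‖ₑ ≤ ENNReal.ofReal a}, ‖f z‖ₑ ^ 2 ∂μ +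
        ENNReal.ofReal (D * a) ^ 2 * μ (⋃ q : S, idx q.1.1 ⁻¹' {q.1.2}) ∧
      ENNReal.ofReal a * μ (⋃ q : S, idx q.1.1 ⁻¹' {q.1.2}) ≤
        2 * ∫⁻ z in {z | ENNReal.ofReal a < 2 * ‖f z‖ₑ}, ‖f z‖ₑ ∂μ := by
  classical
  obtain ⟨S, hdisj, hlow, hup, hout⟩ := h.exists_stopping_cells hf ha
  set cell : S → Set X := fun q => idx q.1.1 ⁻¹' {q.1.2} with hcell
  set Ω : Set X := ⋃ q : S, cell q with hΩ
  set α := ENNReal.ofReal a with hα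
  have hα0 : α ≠ 0 := by simpa [hα] using ha
  have hαt : α ≠ ∞ := ENNReal.ofReal_ne_top
  have hcm : ∀ q, MeasurableSet (cell q) := fun q => h.measurableSet_cell _ _
  have hΩm : MeasurableSet Ω := MeasurableSet.iUnion hcm
  have hpd : Pairwise (Function.onFun Disjoint cell) := fun q q' hne =>
    hdisj q.2 q'.2 (fun h => hne (Subtype.ext h))
  have hμ0 : ∀ q, μ (cell q) ≠ 0 := fun q => by
    rw [hcell]; simp only; rw [h.measure_cell]; simpa using h.pos _
  have hμt : ∀ q, μ (cell q) ≠ ∞ := fun q => by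
    rw [hcell]; simp only; rw [h.measure_cell]; simp
  set avg : S → ℝ := fun q => (μ.real (cell q))⁻¹ * ∫ w in cell q, f w ∂μ with havg
  have hreal : ∀ q, μ.real (cell q) ≠ 0 := fun q => by
    simp [Measure.real, ENNReal.toReal_eq_zero_iff, hμ0, hμt]
  have havg1 : ∀ q, ‖avg q‖ₑ * μ (cell q) ≤ ∫⁻ w in cell q, ‖f w‖ₑ ∂μ := by
    intro q
    have : ‖avg q‖ₑ * μ (cell q) = ‖∫ w in cell q, f w ∂μ‖ₑ := by
      rw [havg]
      simp only
      rw [enorm_mul, mul_right_comm]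
      have : ‖(μ.real (cell q))⁻¹‖ₑ * μ (cell q) = 1 := by
        rw [enorm_inv (hreal q), Real.enorm_of_nonneg measureReal_nonneg,
          ofReal_measureReal (hμt q), ENNReal.inv_mul_cancel (hμ0 q) (hμt q)]
      rw [this, one_mul]
    rw [this]
    exact enorm_integral_le_lintegral_enorm _
  have havg2 : ∀ q, ‖avg q‖ₑ ≤ ENNReal.ofReal (D * a) := by
    intro q
    have := (havg1 q).trans (hup q.1 q.2)
    exact (ENNReal.mul_le_mul_iff_left (hμ0 q) (hμt q)).1 this
  obtain ⟨g, hgm, hg⟩ := exists_measurable_piecewise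
    (fun o : Option S => o.elim Ωᶜ cell)
    (by rintro (_ | q); exacts [hΩm.compl, hcm q])
    (fun o : Option S => o.elim f (fun q _ => avg q))
    (by rintro (_ | q); exacts [hfm, measurable_const])
    (by
      rintro (_ | q) (_ | q') hne z ⟨hz, hz'⟩
      · exact absurd rfl hne
      · exact absurd (Set.mem_iUnion_of_mem q' hz') hz
      · exact absurd (Set.mem_iUnion_of_mem q hz) hz'
      · exact absurd hz' (Set.disjoint_left.1
          (hpd (fun h => hne (by rw [h]))) hz))
  have hg0 : ∀ z ∉ Ω, g z = f z := fun z hz => hg none hz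
  have hg1 : ∀ q, ∀ z ∈ cell q, g z = avg q := fun q z hz => hg (some q) hz
  have hf0 : ∀ z ∉ Ω, ‖f z‖ₑ ≤ α := fun z hz => hdiff z α (hout z (fun q hq hzq =>
    hz (Set.mem_iUnion_of_mem (⟨q, hq⟩ : S) hzq)))
  have hgcell : ∀ q, ∫⁻ w in cell q, ‖g w‖ₑ ∂μ = ‖avg q‖ₑ * μ (cell q) := by
    intro q
    rw [setLIntegral_congr_fun (hcm q) (fun w hw => by rw [hg1 q w hw]), setLIntegral_const]
  have hgint : Integrable g μ := by
    refine ⟨hgm.aestronglyMeasurable, ?_⟩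
    refine lt_of_le_of_lt ?_ hf.2
    rw [← lintegral_add_compl _ hΩm, ← lintegral_add_compl (fun z => ‖f z‖ₑ) hΩm]
    gcongr ?_ + ?_
    · rw [hΩ, lintegral_iUnion hcm hpd, lintegral_iUnion hcm hpd]
      refine ENNReal.tsum_le_tsum fun q => ?_
      rw [hgcell]; exact havg1 q
    · exact (setLIntegral_congr_fun hΩm.compl (fun w hw => by rw [hg0 w hw])).le
  refine ⟨S, g, hgm, hgint, ⟨max a (D * a), fun z => ?_⟩, hdisj, fun z hz => hg0 z ?_, ?_, ?_,
    ?_, ?_⟩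
  · by_cases hz : z ∈ Ω
    · obtain ⟨q, hq⟩ := Set.mem_iUnion.1 hz
      rw [hg1 q z hq]
      refine le_max_of_le_right ?_
      have := havg2 q
      rw [Real.enorm_eq_ofReal_abs] at this
      exact (ENNReal.ofReal_le_ofReal_iff (mul_pos h.ratio_pos ha).le).1 this
    · rw [hg0 z hz]
      refine le_max_of_le_left ?_
      have := hf0 z hz
      rw [Real.enorm_eq_ofReal_abs] at this
      exact (ENNReal.ofReal_le_ofReal_iff ha.le).1 this
  · intro hzΩ
    obtain ⟨q, hq⟩ := Set.mem_iUnion.1 hzΩ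
    exact hz q.1 q.2 hq
  · intro q hq
    rw [integral_sub hf.integrableOn hgint.integrableOn,
      setIntegral_congr_fun (hcm ⟨q, hq⟩) (fun w hw => hg1 ⟨q, hq⟩ w hw), setIntegral_const,
      havg, smul_eq_mul]
    simp only
    rw [mul_inv_cancel_left₀ (hreal ⟨q, hq⟩), sub_self]
  · intro q hq
    have h1 : ∫⁻ w in cell ⟨q, hq⟩, ‖f w - g w‖ₑ ∂μ ≤
        ∫⁻ w in cell ⟨q, hq⟩, ‖f w‖ₑ ∂μ + ∫⁻ w in cell ⟨q, hq⟩, ‖g w‖ₑ ∂μ := by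
      rw [← lintegral_add_left hfm.enorm]
      exact lintegral_mono fun w => enorm_sub_le
    refine h1.trans ?_
    rw [hgcell, mul_assoc, two_mul]
    gcongr
    · exact hup q hq
    · exact havg2 _
  · rw [← lintegral_add_compl _ hΩm, add_comm]
    gcongr ?_ + ?_
    · rw [setLIntegral_congr_fun hΩm.compl (g := fun w => ‖f w‖ₑ ^ 2)
        (fun w hw => by simp only; rw [hg0 w hw])]
      exact lintegral_mono_set fun z hz => hf0 z hz
    · rw [← setLIntegral_const]
      refine setLIntegral_mono measurable_const fun z hz => ?_
      obtain ⟨q, hq⟩ := Set.mem_iUnion.1 hz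
      rw [hg1 q z hq]
      gcongr
      exact havg2 q
  · have hle : α * μ Ω ≤ ∫⁻ z in Ω, ‖f z‖ₑ ∂μ := by
      rw [hΩ, lintegral_iUnion hcm hpd, measure_iUnion hpd hcm, ← ENNReal.tsum_mul_left]
      exact ENNReal.tsum_le_tsum fun q => hlow q.1 q.2
    have hΩt : μ Ω ≠ ∞ := by
      intro htop
      rw [htop, ENNReal.mul_top hα0] at hle
      exact absurd (hle.trans (setLIntegral_le_lintegral _ _)) (not_le.2 hf.2)
    have hAm : MeasurableSet {z | α < 2 * ‖f z‖ₑ} :=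
      measurableSet_lt measurable_const (hfm.enorm.const_mul 2)
    have h2 : 2 * ∫⁻ z in Ω, ‖f z‖ₑ ∂μ ≤
        2 * ∫⁻ z in {z | α < 2 * ‖f z‖ₑ}, ‖f z‖ₑ ∂μ + α * μ Ω := by
      rw [← lintegral_inter_add_sdiff (μ := μ) (fun z => ‖f z‖ₑ) Ω hAm, mul_add]
      gcongr ?_ + ?_
      · gcongr
        exact Set.inter_subset_right
      · rw [← lintegral_const_mul _ hfm.enorm]
        calc _ ≤ ∫⁻ z in Ω \ {z | α < 2 * ‖f z‖ₑ}, α ∂μ :=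
              setLIntegral_mono measurable_const fun z hz => not_lt.1 hz.2
          _ = α * μ (Ω \ {z | α < 2 * ‖f z‖ₑ}) := setLIntegral_const _ _
          _ ≤ _ := by gcongr; exact Set.sdiff_subset
    have h3 : α * μ Ω + α * μ Ω ≤ 2 * ∫⁻ z in {z | α < 2 * ‖f z‖ₑ}, ‖f z‖ₑ ∂μ + α * μ Ω := by
      rw [← two_mul]
      exact (mul_le_mul_right hle 2).trans h2
    exact (ENNReal.add_le_add_iff_right (ENNReal.mul_ne_top hαt hΩt)).1 h3

/-- Distributional estimate for an integral operator which is bounded on `L²` and whose kernel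
satisfies Hörmander's condition. -/
theorem meas_lt_le_of_hormander [SFinite μ] [Countable ι] (h : IsDyadicSystem μ idx m D)
    {K : X → X → ℝ} (hKm : Measurable (Function.uncurry K)) {M : ℝ} (hKb : ∀ z w, |K z w| ≤ M)
    {A B : ℝ≥0∞}
    (hL2 : ∀ g : X → ℝ, Measurable g → Integrable g μ → (∃ M, ∀ z, |g z| ≤ M) →
      ∫⁻ z, ‖∫ w, K z w * g w ∂μ‖ₑ ^ 2 ∂μ ≤ A * ∫⁻ z, ‖g z‖ₑ ^ 2 ∂μ)
    (hH : ∀ k c, ∃ Q : Set X, MeasurableSet Q ∧ μ Q ≤ B * μ (idx k ⁻¹' {c}) ∧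
      ∀ w ∈ idx k ⁻¹' {c}, ∀ w' ∈ idx k ⁻¹' {c}, ∫⁻ z in Qᶜ, ‖K z w - K z w'‖ₑ ∂μ ≤ B)
    {f : X → ℝ} (hfm : Measurable f) (hf : Integrable f μ)
    (hdiff : ∀ z, ∀ c : ℝ≥0∞, (∀ k, ∫⁻ w in idx k ⁻¹' {idx k z}, ‖f w‖ₑ ∂μ ≤
      c * μ (idx k ⁻¹' {idx k z})) → ‖f z‖ₑ ≤ c)
    {a : ℝ} (ha : 0 < a) :
    μ {z | 2 * ENNReal.ofReal a < ‖∫ w, K z w * f w ∂μ‖ₑ} ≤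
      A * (ENNReal.ofReal a)⁻¹ ^ 2 *
        ∫⁻ z in {z | ‖f z‖ₑ ≤ ENNReal.ofReal a}, ‖f z‖ₑ ^ 2 ∂μ +
      2 * (A * ENNReal.ofReal D ^ 2 + B + 2 * B * ENNReal.ofReal D) * (ENNReal.ofReal a)⁻¹ *
        ∫⁻ z in {z | ENNReal.ofReal a < 2 * ‖f z‖ₑ}, ‖f z‖ₑ ∂μ := by
  classical
  obtain ⟨S, g, hgm, hgi, hgb, hdisj, hgout, hmean, hbL1, hgL2, hΩle⟩ :=
    h.exists_decomposition hfm hf hdiff ha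
  set cell : S → Set X := fun q => idx q.1.1 ⁻¹' {q.1.2} with hcell
  set Ω : Set X := ⋃ q : S, cell q with hΩ
  set α := ENNReal.ofReal a with hα
  have hα0 : α ≠ 0 := by simpa [hα] using ha
  have hαt : α ≠ ∞ := ENNReal.ofReal_ne_top
  have hcm : ∀ q, MeasurableSet (cell q) := fun q => h.measurableSet_cell _ _
  have hpd : Pairwise (Function.onFun Disjoint cell) := fun q q' hne =>
    hdisj q.2 q'.2 (fun h => hne (Subtype.ext h))
  have hDa : ENNReal.ofReal (D * a) = ENNReal.ofReal D * α :=
    ENNReal.ofReal_mul h.ratio_pos.le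
  choose Q hQm hQμ hQK using hH
  set b : X → ℝ := fun w => f w - g w with hb
  have hbm : Measurable b := hfm.sub hgm
  have hbi : Integrable b μ := hf.sub hgi
  have hKi : ∀ {u : X → ℝ} (_ : Integrable u μ) (z : X), Integrable (fun w => K z w * u w) μ :=
    fun hu z => hu.bdd_mul (hKm.comp measurable_prodMk_left).aestronglyMeasurable
      (Filter.Eventually.of_forall fun w => by simpa using hKb z w)
  have hTm : ∀ {u : X → ℝ} (_ : Measurable u), Measurable fun z => ∫ w, K z w * u w ∂μ := by
    intro u hu
    have : StronglyMeasurable (Function.uncurry fun z w => K z w * u w) :=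
      (hKm.mul (hu.comp measurable_snd)).stronglyMeasurable
    exact this.integral_prod_right.measurable
  have hsplit : ∀ z, ∫ w, K z w * f w ∂μ = ∫ w, K z w * g w ∂μ + ∫ w, K z w * b w ∂μ := by
    intro z
    rw [← integral_add (hKi hgi z) (hKi hbi z)]
    congr 1; ext w; simp only [hb]; ring
  have hne : ∀ q : S, (cell q).Nonempty := fun q => by
    rw [Set.nonempty_iff_ne_empty]
    intro he
    have h1 := h.measure_cell q.1.1 q.1.2
    have h2 := h.pos q.1.1
    change μ (cell q) = _ at h1
    rw [he, measure_empty] at h1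
    exact absurd (ENNReal.ofReal_eq_zero.1 h1.symm) (not_le.2 h2)
  choose c hc using hne
  set F : S → X → ℝ≥0∞ := fun q z => ∫⁻ w in cell q, ‖K z w - K z (c q)‖ₑ * ‖b w‖ₑ ∂μ with hF
  have hTb : ∀ z, ‖∫ w, K z w * b w ∂μ‖ₑ ≤ ∑' q, F q z := by
    intro z
    have h0 : ∫ w, K z w * b w ∂μ = ∫ w in Ω, K z w * b w ∂μ := by
      refine (setIntegral_eq_integral_of_forall_compl_eq_zero fun w hw => ?_).symm
      have : b w = 0 := by
        rw [hb]
        simp only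
        rw [hgout w (fun q hq hwq => hw (Set.mem_iUnion_of_mem (⟨q, hq⟩ : S) hwq)), sub_self]
      rw [this, mul_zero]
    have hs := hasSum_integral_iUnion hcm hpd (hKi hbi z).integrableOn
    rw [h0, ← hs.tsum_eq]
    refine enorm_tsum_le_tsum_enorm.trans (ENNReal.tsum_le_tsum fun q => ?_)
    have h1 : ∫ w in cell q, K z w * b w ∂μ = ∫ w in cell q, (K z w - K z (c q)) * b w ∂μ := by
      simp only [sub_mul]
      rw [integral_sub (hKi hbi z).integrableOn (hbi.const_mul _).integrableOn,
        integral_const_mul, hmean q.1 q.2, mul_zero, sub_zero]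
    rw [h1]
    refine (enorm_integral_le_lintegral_enorm _).trans (le_of_eq ?_)
    simp only [hF, enorm_mul]
  set Qs : S → Set X := fun q => Q q.1.1 q.1.2 with hQs
  have hFm : ∀ q, Measurable (F q) := by
    intro q
    have h1 : Measurable (Function.uncurry fun z w => ‖K z w - K z (c q)‖ₑ * ‖b w‖ₑ) := by
      refine Measurable.mul (Measurable.enorm (hKm.sub ?_)) (hbm.comp measurable_snd).enorm
      exact hKm.comp (measurable_fst.prodMk measurable_const)
    exact h1.lintegral_prod_right'
  have hFint : ∀ q, ∫⁻ z in (Qs q)ᶜ, F q z ∂μ ≤ 2 * B * ENNReal.ofReal D * α * μ (cell q) := by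
    intro q
    have h1 : Measurable (Function.uncurry fun z w => ‖K z w - K z (c q)‖ₑ * ‖b w‖ₑ) := by
      refine Measurable.mul (Measurable.enorm (hKm.sub ?_)) (hbm.comp measurable_snd).enorm
      exact hKm.comp (measurable_fst.prodMk measurable_const)
    simp only [hF]
    rw [lintegral_lintegral_swap h1.aemeasurable]
    calc _ ≤ ∫⁻ w in cell q, B * ‖b w‖ₑ ∂μ := by
          refine setLIntegral_mono (hbm.enorm.const_mul _) fun w hw => ?_
          rw [lintegral_mul_const]
          · gcongr
            exact hQK _ _ w hw _ (hc q)
          · exact Measurable.enorm ((hKm.comp measurable_prodMk_right).sub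
              (hKm.comp measurable_prodMk_right))
      _ ≤ B * (2 * (ENNReal.ofReal D * α) * μ (cell q)) := by
          rw [lintegral_const_mul _ hbm.enorm, ← hDa]
          gcongr
          exact hbL1 q.1 q.2
      _ = _ := by ring
  set E : Set X := ⋃ q, Qs q with hE
  have hμΩ : μ Ω = ∑' q, μ (cell q) := measure_iUnion hpd hcm
  have hEμ : μ E ≤ B * μ Ω := by
    rw [hμΩ, ← ENNReal.tsum_mul_left]
    exact (measure_iUnion_le _).trans (ENNReal.tsum_le_tsum fun q => hQμ _ _)
  have hTbint : ∫⁻ z in Eᶜ, ‖∫ w, K z w * b w ∂μ‖ₑ ∂μ ≤ 2 * B * ENNReal.ofReal D * α * μ Ω := by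
    calc _ ≤ ∫⁻ z in Eᶜ, ∑' q, F q z ∂μ := lintegral_mono hTb
      _ = ∑' q, ∫⁻ z in Eᶜ, F q z ∂μ := lintegral_tsum fun q => (hFm q).aemeasurable
      _ ≤ ∑' q, ∫⁻ z in (Qs q)ᶜ, F q z ∂μ := ENNReal.tsum_le_tsum fun q =>
          lintegral_mono_set (Set.compl_subset_compl.2 (Set.subset_iUnion Qs q))
      _ ≤ ∑' q, 2 * B * ENNReal.ofReal D * α * μ (cell q) := ENNReal.tsum_le_tsum hFint
      _ = _ := by rw [ENNReal.tsum_mul_left, hμΩ]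
  have hcover : {z | 2 * α < ‖∫ w, K z w * f w ∂μ‖ₑ} ⊆
      {z | α ^ 2 ≤ ‖∫ w, K z w * g w ∂μ‖ₑ ^ 2} ∪ E ∪
        ({z | α ≤ ‖∫ w, K z w * b w ∂μ‖ₑ} ∩ Eᶜ) := by
    intro z hz
    by_contra hcon
    simp only [Set.mem_union, Set.mem_inter_iff, Set.mem_ofPred_eq, Set.mem_compl_iff, not_or,
      not_and, not_le] at hcon
    obtain ⟨⟨h1, h2⟩, h3⟩ := hcon
    have h3 : ‖∫ w, K z w * b w ∂μ‖ₑ < α := by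
      by_contra h4; exact h3 (not_lt.1 h4) h2
    have h1 : ‖∫ w, K z w * g w ∂μ‖ₑ < α := not_le.1 fun h4 => not_le.2 h1 (by gcongr)
    have hz : 2 * α < ‖∫ w, K z w * f w ∂μ‖ₑ := hz
    rw [hsplit, two_mul] at hz
    exact absurd (hz.trans_le (enorm_add_le _ _)) (not_lt.2 (add_le_add h1.le h3.le))
  have hα2 : α ^ 2 ≠ 0 := pow_ne_zero _ hα0
  have hg1 : μ {z | α ^ 2 ≤ ‖∫ w, K z w * g w ∂μ‖ₑ ^ 2} ≤ α⁻¹ ^ 2 * (A * ∫⁻ z, ‖g z‖ₑ ^ 2 ∂μ) := by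
    refine (meas_ge_le_lintegral_div ((hTm hgm).enorm.pow_const 2).aemeasurable hα2
      (ENNReal.pow_ne_top hαt)).trans ?_
    rw [ENNReal.div_eq_inv_mul, ENNReal.inv_pow]
    gcongr
    exact hL2 g hgm hgi hgb
  have hb1 : μ ({z | α ≤ ‖∫ w, K z w * b w ∂μ‖ₑ} ∩ Eᶜ) ≤
      α⁻¹ * (2 * B * ENNReal.ofReal D * α * μ Ω) := by
    have hEm : MeasurableSet E := MeasurableSet.iUnion fun q => hQm _ _
    rw [← Measure.restrict_apply (measurableSet_le measurable_const (hTm hbm).enorm)]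
    refine (meas_ge_le_lintegral_div (hTm hbm).enorm.aemeasurable hα0 hαt).trans ?_
    rw [ENNReal.div_eq_inv_mul]
    gcongr
  have hcancel : α⁻¹ * α = 1 := ENNReal.inv_mul_cancel hα0 hαt
  have hΩle' : μ Ω ≤ α⁻¹ * (2 * ∫⁻ z in {z | α < 2 * ‖f z‖ₑ}, ‖f z‖ₑ ∂μ) := by
    calc μ Ω = α⁻¹ * (α * μ Ω) := by rw [← mul_assoc, hcancel, one_mul]
      _ ≤ _ := by gcongr
  calc _ ≤ _ := measure_mono hcover
    _ ≤ μ {z | α ^ 2 ≤ ‖∫ w, K z w * g w ∂μ‖ₑ ^ 2} + μ E +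
        μ ({z | α ≤ ‖∫ w, K z w * b w ∂μ‖ₑ} ∩ Eᶜ) :=
      (measure_union_le _ _).trans (by gcongr; exact measure_union_le _ _)
    _ ≤ α⁻¹ ^ 2 * (A * (∫⁻ z in {z | ‖f z‖ₑ ≤ α}, ‖f z‖ₑ ^ 2 ∂μ +
          (ENNReal.ofReal D * α) ^ 2 * μ Ω)) + B * μ Ω +
        α⁻¹ * (2 * B * ENNReal.ofReal D * α * μ Ω) := by
      rw [← hDa]
      gcongr
      exact hg1.trans (by gcongr)
    _ = A * α⁻¹ ^ 2 * ∫⁻ z in {z | ‖f z‖ₑ ≤ α}, ‖f z‖ₑ ^ 2 ∂μ +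
        (A * ENNReal.ofReal D ^ 2 * (α⁻¹ * α) ^ 2 + B + 2 * B * ENNReal.ofReal D * (α⁻¹ * α)) *
          μ Ω := by ring
    _ ≤ _ := by
      rw [hcancel, one_pow, mul_one, mul_one]
      refine add_le_add le_rfl ?_
      calc _ ≤ _ := mul_le_mul_right hΩle' _
        _ = _ := by ring

end IsDyadicSystem

theorem lintegral_Ioi_ofReal_rpow {c r : ℝ} (hc : 0 < c) (hr : r < -1) :
    ∫⁻ t in Set.Ioi c, ENNReal.ofReal (t ^ r) = ENNReal.ofReal (c ^ (r + 1) / -(r + 1)) := by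
  rw [← ofReal_integral_eq_lintegral_ofReal (integrableOn_Ioi_rpow_of_lt hr hc)
    (ae_restrict_of_forall_mem measurableSet_Ioi fun t ht =>
      Real.rpow_nonneg (hc.trans ht).le _), integral_Ioi_rpow_of_lt hr hc]
  rw [neg_div, div_neg]

theorem lintegral_Ioc_ofReal_rpow {c r : ℝ} (hc : 0 ≤ c) (hr : -1 < r) :
    ∫⁻ t in Set.Ioc 0 c, ENNReal.ofReal (t ^ r) = ENNReal.ofReal (c ^ (r + 1) / (r + 1)) := by
  have h1 := (intervalIntegrable_iff_integrableOn_Ioc_of_le hc).1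
    (intervalIntegral.intervalIntegrable_rpow' (a := 0) (b := c) hr)
  rw [← ofReal_integral_eq_lintegral_ofReal h1
    (ae_restrict_of_forall_mem measurableSet_Ioc fun t ht => Real.rpow_nonneg ht.1.le _),
    ← intervalIntegral.integral_of_le hc, integral_rpow (Or.inl hr),
    Real.zero_rpow (by linarith), sub_zero]

/-- A Marcinkiewicz type interpolation: passing from a distributional estimate to a strong type
estimate for `1 < p < 2`. -/
theorem lintegral_rpow_le_of_meas_lt_le {X : Type*} [MeasurableSpace X] {μ : Measure X} [SFinite μ]
    {p : ℝ} (hp1 : 1 < p) (hp2 : p < 2) {P R : ℝ≥0∞} {f T : X → ℝ} (hf : Measurable f)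
    (hT : Measurable T)
    (h : ∀ a : ℝ, 0 < a → μ {z | 2 * ENNReal.ofReal a < ‖T z‖ₑ} ≤
      P * (ENNReal.ofReal a)⁻¹ ^ 2 *
        ∫⁻ z in {z | ‖f z‖ₑ ≤ ENNReal.ofReal a}, ‖f z‖ₑ ^ 2 ∂μ +
      R * (ENNReal.ofReal a)⁻¹ * ∫⁻ z in {z | ENNReal.ofReal a < 2 * ‖f z‖ₑ}, ‖f z‖ₑ ∂μ) :
    ∫⁻ z, ‖T z‖ₑ ^ p ∂μ ≤ ENNReal.ofReal (2 ^ p) * (ENNReal.ofReal p *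
      (P * ENNReal.ofReal (2 - p)⁻¹ + R * ENNReal.ofReal (2 ^ (p - 1) * (p - 1)⁻¹))) *
        ∫⁻ z, ‖f z‖ₑ ^ p ∂μ := by
  have h2T : ∀ z, ‖T z‖ₑ ^ p = ENNReal.ofReal (2 ^ p) * ENNReal.ofReal ((|T z| / 2) ^ p) := by
    intro z
    rw [← ENNReal.ofReal_mul (by positivity), ← Real.mul_rpow (by norm_num) (by positivity),
      mul_div_cancel₀ _ (by norm_num : (2:ℝ) ≠ 0), Real.enorm_eq_ofReal_abs,
      ENNReal.ofReal_rpow_of_nonneg (abs_nonneg _) (by linarith)]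
  simp only [h2T]
  rw [lintegral_const_mul _ (by fun_prop), mul_assoc]
  refine mul_le_mul_right ?_ _
  rw [lintegral_rpow_eq_lintegral_meas_lt_mul μ (Filter.Eventually.of_forall fun z => by
    positivity) (by fun_prop) (by linarith), mul_assoc]
  refine mul_le_mul_right ?_ _
  have hset1 : MeasurableSet {q : ℝ × X | |f q.2| ≤ q.1} :=
    measurableSet_le (hf.comp measurable_snd).abs measurable_fst
  have hset2 : MeasurableSet {q : ℝ × X | q.1 < 2 * |f q.2|} :=
    measurableSet_lt measurable_fst ((hf.comp measurable_snd).abs.const_mul 2)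
  set G₁ : ℝ × X → ℝ≥0∞ := fun q => {q : ℝ × X | |f q.2| ≤ q.1}.indicator
    (fun q => ENNReal.ofReal (q.1 ^ (p - 3)) * ENNReal.ofReal (|f q.2| ^ (2:ℝ))) q with hG₁
  set G₂ : ℝ × X → ℝ≥0∞ := fun q => {q : ℝ × X | q.1 < 2 * |f q.2|}.indicator
    (fun q => ENNReal.ofReal (q.1 ^ (p - 2)) * ENNReal.ofReal |f q.2|) q with hG₂
  have hG₁m : Measurable G₁ := Measurable.indicator (by fun_prop) hset1
  have hG₂m : Measurable G₂ := Measurable.indicator (by fun_prop) hset2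
  have hpt : ∀ t ∈ Set.Ioi (0:ℝ), μ {z | t < |T z| / 2} * ENNReal.ofReal (t ^ (p - 1)) ≤
      P * ∫⁻ z, G₁ (t, z) ∂μ + R * ∫⁻ z, G₂ (t, z) ∂μ := by
    intro t ht
    have ht : 0 < t := ht
    have hset : {z | t < |T z| / 2} = {z | 2 * ENNReal.ofReal t < ‖T z‖ₑ} := by
      ext z
      have h2 : (2:ℝ≥0∞) = ENNReal.ofReal 2 := by simp
      rw [Set.mem_ofPred_eq, Set.mem_ofPred_eq, Real.enorm_eq_ofReal_abs, h2,
        ← ENNReal.ofReal_mul (by norm_num), ENNReal.ofReal_lt_ofReal_iff_of_nonneg (by positivity),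
        lt_div_iff₀ (by norm_num), mul_comm]
    rw [hset]
    refine (mul_le_mul_left (h t ht) _).trans (le_of_eq ?_)
    rw [add_mul]
    congr 1
    · have : ∫⁻ z, G₁ (t, z) ∂μ = ENNReal.ofReal (t ^ (p - 3)) *
          ∫⁻ z in {z | ‖f z‖ₑ ≤ ENNReal.ofReal t}, ‖f z‖ₑ ^ 2 ∂μ := by
        rw [← lintegral_const_mul _ (by fun_prop), ← lintegral_indicator
          (measurableSet_le (by fun_prop) measurable_const)]
        refine lintegral_congr fun z => ?_
        simp only [hG₁, Set.indicator_apply, Set.mem_ofPred_eq, Real.enorm_eq_ofReal_abs,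
          ENNReal.ofReal_le_ofReal_iff ht.le]
        congr 2
        rw [← ENNReal.ofReal_pow (abs_nonneg _)]; norm_cast
      rw [this, ← ENNReal.ofReal_inv_of_pos ht, ← ENNReal.ofReal_pow (by positivity)]
      have e : t ^ (p - 3) = t⁻¹ ^ 2 * t ^ (p - 1) := by
        rw [inv_pow, ← Real.rpow_natCast, ← Real.rpow_neg ht.le, ← Real.rpow_add ht]
        congr 1; push_cast; ring
      rw [e, ENNReal.ofReal_mul (by positivity)]
      ring
    · have : ∫⁻ z, G₂ (t, z) ∂μ = ENNReal.ofReal (t ^ (p - 2)) *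
          ∫⁻ z in {z | ENNReal.ofReal t < 2 * ‖f z‖ₑ}, ‖f z‖ₑ ∂μ := by
        rw [← lintegral_const_mul _ (by fun_prop), ← lintegral_indicator
          (measurableSet_lt measurable_const (by fun_prop))]
        refine lintegral_congr fun z => ?_
        have h2 : (2:ℝ≥0∞) = ENNReal.ofReal 2 := by simp
        simp only [hG₂, Set.indicator_apply, Set.mem_ofPred_eq, Real.enorm_eq_ofReal_abs, h2,
          ← ENNReal.ofReal_mul (zero_le_two : (0:ℝ) ≤ 2),
          ENNReal.ofReal_lt_ofReal_iff_of_nonneg ht.le]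
      rw [this, ← ENNReal.ofReal_inv_of_pos ht]
      have e : t ^ (p - 2) = t⁻¹ * t ^ (p - 1) := by
        rw [← Real.rpow_neg_one, ← Real.rpow_add ht]
        congr 1; ring
      rw [e, ENNReal.ofReal_mul (by positivity)]
      ring
  refine (setLIntegral_mono (by
    exact (hG₁m.lintegral_prod_right'.const_mul _).add
      (hG₂m.lintegral_prod_right'.const_mul _)) hpt).trans ?_
  rw [lintegral_add_left (hG₁m.lintegral_prod_right'.const_mul _),
    lintegral_const_mul _ hG₁m.lintegral_prod_right',
    lintegral_const_mul _ hG₂m.lintegral_prod_right',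
    lintegral_lintegral_swap (f := fun t z => G₁ (t, z)) hG₁m.aemeasurable,
    lintegral_lintegral_swap (f := fun t z => G₂ (t, z)) hG₂m.aemeasurable, add_mul]
  have e1 : ∀ z, ∫⁻ t in Set.Ioi (0:ℝ), G₁ (t, z) ≤ ENNReal.ofReal (2 - p)⁻¹ * ‖f z‖ₑ ^ p := by
    intro z
    rcases eq_or_ne (f z) 0 with h0 | h0
    · simp [hG₁, Set.indicator_apply, h0]
    · have hpos : 0 < |f z| := abs_pos.2 h0
      refine le_of_eq ?_
      calc _ = ∫⁻ t in Set.Ici |f z|, ENNReal.ofReal (t ^ (p - 3)) *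
              ENNReal.ofReal (|f z| ^ (2:ℝ)) := by
            rw [← lintegral_indicator measurableSet_Ioi, ← lintegral_indicator measurableSet_Ici]
            refine lintegral_congr fun t => ?_
            simp only [hG₁, Set.indicator_apply, Set.mem_ofPred_eq, Set.mem_Ioi, Set.mem_Ici]
            by_cases ht : |f z| ≤ t
            · simp [ht, hpos.trans_le ht]
            · simp [ht]
        _ = ENNReal.ofReal (2 - p)⁻¹ * ‖f z‖ₑ ^ p := by
            rw [lintegral_mul_const _ (by fun_prop), setLIntegral_congr Ioi_ae_eq_Ici.symm,
              lintegral_Ioi_ofReal_rpow hpos (by linarith), ← ENNReal.ofReal_mul (by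
                have : 0 < -(p - 3 + 1) := by linarith
                positivity), Real.enorm_eq_ofReal_abs,
              ENNReal.ofReal_rpow_of_nonneg hpos.le (by linarith), ← ENNReal.ofReal_mul (by
                have : 0 < 2 - p := by linarith
                positivity)]
            congr 1
            rw [div_mul_eq_mul_div, ← Real.rpow_add hpos, div_eq_inv_mul]
            congr 2 <;> ring
  have e2 : ∀ z, ∫⁻ t in Set.Ioi (0:ℝ), G₂ (t, z) ≤
      ENNReal.ofReal (2 ^ (p - 1) * (p - 1)⁻¹) * ‖f z‖ₑ ^ p := by
    intro z
    rcases eq_or_ne (f z) 0 with h0 | h0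
    · simp [hG₂, Set.indicator_apply, h0]
    · have hpos : 0 < |f z| := abs_pos.2 h0
      have hp0 : 0 < p - 1 := by linarith
      calc _ ≤ ∫⁻ t in Set.Ioc 0 (2 * |f z|), ENNReal.ofReal (t ^ (p - 2)) *
              ENNReal.ofReal |f z| := by
            rw [← lintegral_indicator measurableSet_Ioi, ← lintegral_indicator measurableSet_Ioc]
            refine lintegral_mono fun t => ?_
            simp only [hG₂, Set.indicator_apply, Set.mem_ofPred_eq, Set.mem_Ioi, Set.mem_Ioc]
            by_cases ht : t < 2 * |f z|
            · simp [ht, ht.le]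
            · simp [ht]
        _ = ENNReal.ofReal (2 ^ (p - 1) * (p - 1)⁻¹) * ‖f z‖ₑ ^ p := by
            rw [lintegral_mul_const _ (by fun_prop),
              lintegral_Ioc_ofReal_rpow (by positivity) (by linarith),
              show p - 2 + 1 = p - 1 by ring,
              ← ENNReal.ofReal_mul (by positivity), Real.enorm_eq_ofReal_abs,
              ENNReal.ofReal_rpow_of_nonneg hpos.le (by linarith),
              ← ENNReal.ofReal_mul (by positivity)]
            congr 1
            rw [Real.mul_rpow (by norm_num) hpos.le,
              show |f z| ^ p = |f z| ^ (p - 1) * |f z| by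
                rw [← Real.rpow_add_one hpos.ne']; congr 1; ring]
            ring
  rw [mul_assoc P, mul_assoc R]
  gcongr
  · rw [← lintegral_const_mul _ (by fun_prop)]
    exact lintegral_mono e1
  · rw [← lintegral_const_mul _ (by fun_prop)]
    exact lintegral_mono e2

section parabolic_dyadic

variable {n : ℕ}

/-- Label of the parabolic dyadic cell of generation `k` containing a point. -/
noncomputable def dyadicIndex (n : ℕ) (k : ℤ) (z : EuclideanSpace ℝ (Fin n) × ℝ) :
    (Fin n → ℤ) × ℤ :=
  (fun i => ⌊z.1 i * 2 ^ k⌋, ⌊z.2 * 4 ^ k⌋)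

theorem floor_mul_eq_iff {a b : ℝ} (hb : 0 < b) (c : ℤ) :
    ⌊a * b⌋ = c ↔ a ∈ Set.Ico (c * b⁻¹) ((c + 1) * b⁻¹) := by
  rw [Int.floor_eq_iff, Set.mem_Ico, mul_inv_le_iff₀ hb, lt_mul_inv_iff₀ hb]

theorem dyadicIndex_preimage (k : ℤ) (c : (Fin n → ℤ) × ℤ) :
    dyadicIndex n k ⁻¹' {c} =
      ((WithLp.ofLp : EuclideanSpace ℝ (Fin n) → Fin n → ℝ) ⁻¹' Set.pi Set.univ fun i =>
        Set.Ico (c.1 i * ((2:ℝ) ^ k)⁻¹) ((c.1 i + 1) * ((2:ℝ) ^ k)⁻¹)) ×ˢ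
      Set.Ico (c.2 * ((4:ℝ) ^ k)⁻¹) ((c.2 + 1) * ((4:ℝ) ^ k)⁻¹) := by
  ext z
  simp only [dyadicIndex, Set.mem_preimage, Set.mem_singleton_iff, Prod.ext_iff, funext_iff,
    Set.mem_prod, Set.mem_pi, Set.mem_univ, true_imp_iff]
  rw [floor_mul_eq_iff (by positivity)]
  simp only [floor_mul_eq_iff (show (0:ℝ) < 2 ^ k by positivity)]

theorem floor_mul_zpow_congr {b : ℕ} (hb : 1 ≤ b) {k : ℤ} {x y : ℝ}
    (h : ⌊x * (b:ℝ) ^ (k + 1)⌋ = ⌊y * (b:ℝ) ^ (k + 1)⌋) : ⌊x * (b:ℝ) ^ k⌋ = ⌊y * (b:ℝ) ^ k⌋ := by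
  have hb' : (b:ℝ) ≠ 0 := by positivity
  have key : ∀ x : ℝ, ⌊x * (b:ℝ) ^ k⌋ = ⌊x * (b:ℝ) ^ (k + 1)⌋ / (b:ℤ) := by
    intro x
    rw [← Int.floor_div_natCast, zpow_add_one₀ hb', ← mul_assoc, mul_div_cancel_right₀ _ hb']
  rw [key, key, h]

theorem isDyadicSystem_dyadicIndex (n : ℕ) :
    IsDyadicSystem (volume : Measure (EuclideanSpace ℝ (Fin n) × ℝ)) (dyadicIndex n)
      (fun k => (((2:ℝ) ^ k)⁻¹) ^ n * ((4:ℝ) ^ k)⁻¹) (2 ^ n * 4) where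
  measurableSet_cell k c := by
    rw [dyadicIndex_preimage]
    refine MeasurableSet.prod ?_ measurableSet_Ico
    exact (PiLp.continuous_ofLp 2 _).measurable
      (MeasurableSet.univ_pi fun i => measurableSet_Ico)
  nested k z w h := by
    simp only [dyadicIndex, Prod.mk.injEq, funext_iff] at h ⊢
    refine ⟨fun i => ?_, ?_⟩
    · have := @floor_mul_zpow_congr 2 (by norm_num) k (z.1 i) (w.1 i)
      push_cast at this
      exact this (h.1 i)
    · have := @floor_mul_zpow_congr 4 (by norm_num) k z.2 w.2
      push_cast at this
      exact this h.2
  measure_cell k c := by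
    rw [dyadicIndex_preimage, Measure.volume_eq_prod, Measure.prod_prod,
      (PiLp.volume_preserving_ofLp (Fin n)).measure_preimage
        (MeasurableSet.univ_pi fun i => measurableSet_Ico).nullMeasurableSet,
      Real.volume_pi_Ico, Real.volume_Ico, ENNReal.ofReal_mul (by positivity)]
    simp only [add_mul, one_mul, add_sub_cancel_left, Finset.prod_const, Finset.card_univ,
      Fintype.card_fin]
    rw [ENNReal.ofReal_pow (by positivity)]
  pos k := by positivity
  doubling k := by
    rw [zpow_add_one₀ (by norm_num), zpow_add_one₀ (by norm_num), mul_inv, mul_inv, mul_pow,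
      inv_pow 2 n]
    apply le_of_eq
    field_simp
  tendsto := by
    have h4 : Filter.Tendsto (fun k : ℤ => ((4:ℝ) ^ k)⁻¹) Filter.atBot Filter.atTop := by
      refine Filter.tendsto_atTop_mono' _ ?_
        ((tendsto_intCast_atTop_atTop (R := ℝ)).comp Filter.tendsto_neg_atBot_atTop)
      filter_upwards [Filter.eventually_le_atBot (0:ℤ)] with k hk
      obtain ⟨m, rfl⟩ : ∃ m : ℕ, k = -(m : ℤ) := ⟨k.natAbs, by omega⟩
      simp only [Function.comp_apply, neg_neg, Int.cast_natCast, zpow_neg, zpow_natCast, inv_inv]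
      exact_mod_cast (Nat.lt_pow_self (by norm_num : 1 < 4)).le
    refine Filter.tendsto_atTop_mono' _ ?_ h4
    filter_upwards [Filter.eventually_le_atBot (0:ℤ)] with k hk
    have : 1 ≤ ((2:ℝ) ^ k)⁻¹ := by
      rw [← zpow_neg]
      exact one_le_zpow₀ (by norm_num) (by omega)
    exact le_mul_of_one_le_left (by positivity) (one_le_pow₀ this)

theorem dyadicIndex_close {k : ℤ} {z w : EuclideanSpace ℝ (Fin n) × ℝ}
    (h : dyadicIndex n k z = dyadicIndex n k w) :
    ‖z.1 - w.1‖ ≤ (n + 1) * ((2:ℝ) ^ k)⁻¹ ∧ |z.2 - w.2| ≤ ((n + 1) * ((2:ℝ) ^ k)⁻¹) ^ 2 := by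
  simp only [dyadicIndex, Prod.mk.injEq, funext_iff] at h
  have key : ∀ {x y b : ℝ}, 0 < b → ⌊x * b⌋ = ⌊y * b⌋ → |x - y| ≤ b⁻¹ := by
    intro x y b hb hxy
    have := (Int.abs_sub_lt_one_of_floor_eq_floor hxy).le
    rwa [← sub_mul, abs_mul, abs_of_pos hb, ← le_div_iff₀ hb, one_div] at this
  constructor
  · rw [EuclideanSpace.norm_eq]
    apply Real.sqrt_le_iff.2
    refine ⟨by positivity, ?_⟩
    calc ∑ i, ‖(z.1 - w.1) i‖ ^ 2 ≤ ∑ i : Fin n, (((2:ℝ) ^ k)⁻¹) ^ 2 := by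
          refine Finset.sum_le_sum fun i _ => ?_
          have := key (by positivity) (h.1 i)
          simp only [PiLp.sub_apply, Real.norm_eq_abs]
          gcongr
      _ = n * (((2:ℝ) ^ k)⁻¹) ^ 2 := by simp
      _ ≤ _ := by
          rw [mul_pow]
          gcongr
          nlinarith [(Nat.cast_nonneg n : (0:ℝ) ≤ n)]
  · refine (key (by positivity) h.2).trans ?_
    have : ((4:ℝ) ^ k)⁻¹ = (((2:ℝ) ^ k)⁻¹) ^ 2 := by
      rw [inv_pow, sq, ← mul_zpow]; norm_num
    rw [this, mul_pow]
    refine le_mul_of_one_le_left (by positivity) ?_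
    exact one_le_pow₀ (by simp)

theorem enorm_le_of_forall_dyadic_average_le {f : EuclideanSpace ℝ (Fin n) × ℝ → ℝ}
    (hf : Continuous f) (z : EuclideanSpace ℝ (Fin n) × ℝ) (c : ℝ≥0∞)
    (h : ∀ k, ∫⁻ w in dyadicIndex n k ⁻¹' {dyadicIndex n k z}, ‖f w‖ₑ ≤
      c * volume (dyadicIndex n k ⁻¹' {dyadicIndex n k z})) : ‖f z‖ₑ ≤ c := by
  by_contra! hlt
  obtain ⟨c', hc, hc'⟩ := exists_between hlt
  have hU : {w | c' < ‖f w‖ₑ} ∈ nhds z := (hf.enorm.isOpen_preimage _ isOpen_Ioi).mem_nhds hc'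
  obtain ⟨ε, hε, hball⟩ := Metric.mem_nhds_iff.1 hU
  have hD := isDyadicSystem_dyadicIndex n
  have ht : Filter.Tendsto (fun k : ℕ => (n + 1) * ((2:ℝ) ^ (k:ℤ))⁻¹) Filter.atTop (nhds 0) := by
    have := (tendsto_pow_atTop_nhds_zero_of_lt_one (r := (2:ℝ)⁻¹) (by norm_num)
      (by norm_num)).const_mul ((n:ℝ) + 1)
    simpa using this
  have ht2 := ht.pow 2
  rw [zero_pow two_ne_zero] at ht2
  obtain ⟨k, hk1, hk2⟩ := ((ht.eventually_lt_const hε).and (ht2.eventually_lt_const hε)).exists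
  have hsub : dyadicIndex n k ⁻¹' {dyadicIndex n k z} ⊆ {w | c' < ‖f w‖ₑ} := fun w hw => by
    apply hball
    have := dyadicIndex_close (k := k) (z := w) (w := z) hw
    rw [mem_ball, Prod.dist_eq, max_lt_iff, dist_eq_norm, Real.dist_eq]
    exact ⟨this.1.trans_lt hk1, this.2.trans_lt hk2⟩
  set Q := dyadicIndex n k ⁻¹' {dyadicIndex n k z} with hQ
  have h1 : c' * volume Q ≤ c * volume Q := by
    refine le_trans ?_ (h k)
    rw [← setLIntegral_const]
    exact setLIntegral_mono hf.measurable.enorm fun w hw => (hsub hw).le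
  have hμ := hD.measure_cell k (dyadicIndex n k z)
  have h2 := (ENNReal.mul_le_mul_iff_left (by simp [hQ, hμ])
    (by rw [hQ, hμ]; simp)).1 h1
  exact absurd hc (not_lt.2 h2)

end parabolic_dyadic

section convolution

variable {n : ℕ}

instance isAddHaarMeasure_volume_spaceTime :
    (volume : Measure (EuclideanSpace ℝ (Fin n) × ℝ)).IsAddHaarMeasure :=
  inferInstanceAs ((volume : Measure (EuclideanSpace ℝ (Fin n))).prod
    (volume : Measure ℝ)).IsAddHaarMeasure

/-- Hörmander's regularity condition for convolution kernels in the parabolic geometry. -/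
def ParabolicHormander (k : EuclideanSpace ℝ (Fin n) × ℝ → ℝ) (B : ℝ≥0∞) : Prop :=
  ∀ l : ℝ, 0 < l → ∀ w : EuclideanSpace ℝ (Fin n) × ℝ, ‖w.1‖ ≤ l → |w.2| ≤ l ^ 2 →
    ∫⁻ z in (ball (0 : EuclideanSpace ℝ (Fin n)) (2 * l) ×ˢ ball (0 : ℝ) (8 * l ^ 2))ᶜ,
      ‖k (z - w) - k z‖ₑ ≤ B

theorem measurable_integral_sub_mul {k f : EuclideanSpace ℝ (Fin n) × ℝ → ℝ} (hk : Measurable k)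
    (hf : Measurable f) : Measurable fun z => ∫ w, k (z - w) * f w := by
  have : Measurable (Function.uncurry fun z w : EuclideanSpace ℝ (Fin n) × ℝ =>
      k (z - w) * f w) := by
    simp only [Function.uncurry_def]
    fun_prop
  exact this.stronglyMeasurable.integral_prod_right.measurable

theorem ParabolicHormander.dyadic {k : EuclideanSpace ℝ (Fin n) × ℝ → ℝ} (hk : Measurable k)
    {B : ℝ≥0∞} (hB : ParabolicHormander k B) (j : ℤ) (c : (Fin n → ℤ) × ℤ) :
    ∃ Q : Set (EuclideanSpace ℝ (Fin n) × ℝ), MeasurableSet Q ∧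
      volume Q ≤ (2 * B + ENNReal.ofReal ((2 * (n + 1)) ^ n * (16 * (n + 1) ^ 2)) *
        volume (ball (0 : EuclideanSpace ℝ (Fin n)) 1)) * volume (dyadicIndex n j ⁻¹' {c}) ∧
      ∀ w ∈ dyadicIndex n j ⁻¹' {c}, ∀ w' ∈ dyadicIndex n j ⁻¹' {c},
        ∫⁻ z in Qᶜ, ‖k (z - w) - k (z - w')‖ₑ ≤
          2 * B + ENNReal.ofReal ((2 * (n + 1)) ^ n * (16 * (n + 1) ^ 2)) *
            volume (ball (0 : EuclideanSpace ℝ (Fin n)) 1) := by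
  have hD := isDyadicSystem_dyadicIndex n
  set l : ℝ := (n + 1) * ((2:ℝ) ^ j)⁻¹ with hl
  have hl0 : 0 < l := by positivity
  obtain ⟨v, hv⟩ : (dyadicIndex n j ⁻¹' {c}).Nonempty := by
    apply nonempty_of_measure_ne_zero (μ := volume)
    rw [hD.measure_cell]
    simpa using hD.pos j
  refine ⟨ball v.1 (2 * l) ×ˢ ball v.2 (8 * l ^ 2), measurableSet_ball.prod measurableSet_ball,
    ?_, ?_⟩
  · refine le_trans (le_of_eq ?_) (mul_le_mul_left le_add_self _)
    rw [hD.measure_cell, Measure.volume_eq_prod, Measure.prod_prod, Real.volume_ball,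
      Measure.addHaar_ball_of_pos _ _ (by positivity), finrank_euclideanSpace_fin, mul_right_comm,
      mul_right_comm _ (volume _), ← ENNReal.ofReal_mul (by positivity),
      ← ENNReal.ofReal_mul (by positivity)]
    congr 2
    have h4 : ((4:ℝ) ^ j)⁻¹ = ((2:ℝ) ^ j)⁻¹ ^ 2 := by
      rw [← inv_zpow, ← inv_zpow, ← zpow_natCast, ← zpow_mul, mul_comm j, zpow_mul]
      norm_num
    rw [h4, hl, ← mul_assoc (2:ℝ) (n + 1), mul_pow _ _ n]
    ring
  · have key : ∀ w ∈ dyadicIndex n j ⁻¹' {c},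
        ∫⁻ z in (ball v.1 (2 * l) ×ˢ ball v.2 (8 * l ^ 2))ᶜ, ‖k (z - w) - k (z - v)‖ₑ ≤ B := by
      intro w hw
      have hwv : dyadicIndex n j w = dyadicIndex n j v := by
        simp only [Set.mem_preimage, Set.mem_singleton_iff] at hw hv
        rw [hw, hv]
      have h := dyadicIndex_close hwv
      refine le_trans (le_of_eq ?_) (hB l hl0 (w - v) h.1 h.2)
      rw [← (measurePreserving_add_right volume v).setLIntegral_comp_preimage
        (measurableSet_ball.prod measurableSet_ball).compl (by fun_prop)]
      congr 1
      · congr 1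
        ext z
        simp [dist_eq_norm]
      · ext z
        rw [add_sub_cancel_right, sub_sub_eq_add_sub]
    intro w hw w' hw'
    calc _ ≤ ∫⁻ z in (ball v.1 (2 * l) ×ˢ ball v.2 (8 * l ^ 2))ᶜ,
          (‖k (z - w) - k (z - v)‖ₑ + ‖k (z - w') - k (z - v)‖ₑ) := by
          refine lintegral_mono fun z => ?_
          rw [← sub_sub_sub_cancel_right _ _ (k (z - v))]
          exact enorm_sub_le
      _ ≤ B + B := by
          rw [lintegral_add_left (by fun_prop)]
          exact add_le_add (key w hw) (key w' hw')
      _ ≤ _ := by rw [two_mul]; exact le_self_add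

theorem exists_lintegral_rpow_le_of_lt_two (n : ℕ) {p : ℝ} (hp1 : 1 < p) (hp2 : p < 2)
    {A B : ℝ≥0∞} (hA : A ≠ ∞) (hB : B ≠ ∞) :
    ∃ C : ℝ≥0∞, C ≠ ∞ ∧ ∀ k : EuclideanSpace ℝ (Fin n) × ℝ → ℝ, Measurable k →
      (∃ M, ∀ z, |k z| ≤ M) → ParabolicHormander k B →
      (∀ g : EuclideanSpace ℝ (Fin n) × ℝ → ℝ, Measurable g → Integrable g →
        (∃ M, ∀ z, |g z| ≤ M) →
        ∫⁻ z, ‖∫ w, k (z - w) * g w‖ₑ ^ 2 ≤ A * ∫⁻ z, ‖g z‖ₑ ^ 2) →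
      ∀ f : EuclideanSpace ℝ (Fin n) × ℝ → ℝ, Continuous f → Integrable f →
        ∫⁻ z, ‖∫ w, k (z - w) * f w‖ₑ ^ p ≤ C * ∫⁻ z, ‖f z‖ₑ ^ p := by
  have hω : volume (ball (0 : EuclideanSpace ℝ (Fin n)) 1) ≠ ∞ := measure_ball_lt_top.ne
  refine ⟨_, ?_, fun k hk ⟨M, hM⟩ hH hL2 f hf hfi =>
    lintegral_rpow_le_of_meas_lt_le hp1 hp2 hf.measurable
      (measurable_integral_sub_mul hk hf.measurable) fun a ha =>
        (isDyadicSystem_dyadicIndex n).meas_lt_le_of_hormander (K := fun z w => k (z - w))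
          (by simp only [Function.uncurry_def]; fun_prop) (fun z w => hM _) hL2 (hH.dyadic hk)
          hf.measurable hfi (fun z c h => enorm_le_of_forall_dyadic_average_le hf z c h) ha⟩
  finiteness

theorem integral_sub_mul_eq {k f : EuclideanSpace ℝ (Fin n) × ℝ → ℝ}
    (z : EuclideanSpace ℝ (Fin n) × ℝ) : ∫ w, k (z - w) * f w = ∫ w, k w * f (z - w) := by
  rw [← integral_sub_left_eq_self _ volume z]
  simp

theorem integrable_convolution_integrand {k f : EuclideanSpace ℝ (Fin n) × ℝ → ℝ}
    (hk : Integrable k) (hf : Integrable f) :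
    Integrable (Function.uncurry fun z w => k (z - w) * f w) (volume.prod volume) := by
  have := hf.convolution_integrand (ContinuousLinearMap.mul ℝ ℝ) hk (μ := volume)
  simpa [Function.uncurry_def, mul_comm] using this

theorem integrable_integral_sub_mul {k f : EuclideanSpace ℝ (Fin n) × ℝ → ℝ}
    (hk : Integrable k) (hf : Integrable f) : Integrable fun z => ∫ w, k (z - w) * f w :=
  (integrable_convolution_integrand hk hf).integral_prod_left

theorem abs_integral_sub_mul_le {k f : EuclideanSpace ℝ (Fin n) × ℝ → ℝ}
    (hk : Integrable k) {M : ℝ} (hM : ∀ z, |f z| ≤ M) (z : EuclideanSpace ℝ (Fin n) × ℝ) :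
    |∫ w, k (z - w) * f w| ≤ M * ∫ w, |k w| := by
  rw [integral_sub_mul_eq, ← integral_const_mul]
  refine norm_integral_le_of_norm_le (f := fun w => k w * f (z - w)) (hk.abs.const_mul M)
    (ae_of_all _ fun w => ?_)
  rw [norm_mul, mul_comm, Real.norm_eq_abs, Real.norm_eq_abs]
  exact mul_le_mul_of_nonneg_right (hM _) (abs_nonneg _)

theorem continuous_integral_sub_mul {k f : EuclideanSpace ℝ (Fin n) × ℝ → ℝ}
    (hk : Integrable k) (hf : Continuous f) {M : ℝ} (hM : ∀ z, |f z| ≤ M) :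
    Continuous fun z => ∫ w, k (z - w) * f w := by
  simp only [integral_sub_mul_eq]
  refine continuous_of_dominated (bound := fun w => M * |k w|)
    (fun z => hk.aestronglyMeasurable.mul (by fun_prop)) (fun z => ae_of_all _ fun w => ?_)
    (hk.abs.const_mul M) (ae_of_all _ fun w => by fun_prop)
  rw [norm_mul, mul_comm, Real.norm_eq_abs, Real.norm_eq_abs]
  exact mul_le_mul_of_nonneg_right (hM _) (abs_nonneg _)

theorem integral_integral_sub_mul_mul {k f h : EuclideanSpace ℝ (Fin n) × ℝ → ℝ}
    (hk : Integrable k) (hf : Integrable f) (hh : Continuous h) {M : ℝ} (hM : ∀ z, |h z| ≤ M) :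
    ∫ z, (∫ w, k (z - w) * f w) * h z = ∫ w, f w * ∫ z, k (z - w) * h z := by
  simp only [← integral_mul_const, ← integral_const_mul]
  rw [integral_integral_swap]
  · congr! 4
    ring
  · have := (integrable_convolution_integrand hk hf).mul_bdd (c := M)
      (g := fun q : (EuclideanSpace ℝ (Fin n) × ℝ) × (EuclideanSpace ℝ (Fin n) × ℝ) => h q.1)
      (by fun_prop) (ae_of_all _ fun q => hM q.1)
    exact this

/-- Passage from `L^q` to the dual exponent. -/
theorem lintegral_rpow_le_of_dual {p q : ℝ} (hpq : p.HolderConjugate q) (hp : 2 ≤ p) {C : ℝ≥0∞}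
    {k : EuclideanSpace ℝ (Fin n) × ℝ → ℝ} (hkm : Measurable k) (hk : Integrable k)
    (hq : ∀ f : EuclideanSpace ℝ (Fin n) × ℝ → ℝ, Continuous f → Integrable f →
      ∫⁻ z, ‖∫ w, k (z - w) * f w‖ₑ ^ q ≤ C * ∫⁻ z, ‖f z‖ₑ ^ q)
    {f : EuclideanSpace ℝ (Fin n) × ℝ → ℝ} (hf : Continuous f) (hfi : Integrable f) {M : ℝ}
    (hM : ∀ z, |f z| ≤ M) :
    ∫⁻ z, ‖∫ w, k (z - w) * f w‖ₑ ^ p ≤ C ^ (p - 1) * ∫⁻ z, ‖f z‖ₑ ^ p := by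
  have hp0 : 0 < p := by linarith
  have hq0 : 0 < q := hpq.symm.pos
  set F : EuclideanSpace ℝ (Fin n) × ℝ → ℝ := fun z => ∫ w, k (z - w) * f w with hF
  have hFc : Continuous F := continuous_integral_sub_mul hk hf hM
  have hFi : Integrable F := integrable_integral_sub_mul hk hfi
  obtain ⟨N, hN⟩ : ∃ N, ∀ z, |F z| ≤ N := ⟨_, abs_integral_sub_mul_le hk hM⟩
  set h : EuclideanSpace ℝ (Fin n) × ℝ → ℝ := fun z => |F z| ^ (p - 2) * F z with hh
  have hhc : Continuous h := by
    have := hFc.abs.rpow_const (p := p - 2) fun z => Or.inr (by linarith)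
    exact this.mul hFc
  have hFN : ∀ z, |F z| ^ (p - 2) ≤ N ^ (p - 2) := fun z =>
    Real.rpow_le_rpow (abs_nonneg _) (hN z) (by linarith)
  have habs : ∀ z, |h z| = |F z| ^ (p - 2) * |F z| := fun z => by
    rw [hh, abs_mul, abs_of_nonneg (by positivity : 0 ≤ |F z| ^ (p - 2))]
  have hhb : ∀ z, |h z| ≤ N ^ (p - 2) * |F z| := fun z => by
    rw [habs]
    exact mul_le_mul_of_nonneg_right (hFN z) (abs_nonneg _)
  have hhi : Integrable h := (hFi.abs.const_mul (N ^ (p - 2))).mono' hhc.aestronglyMeasurable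
    (ae_of_all _ hhb)
  have hhN : ∀ z, |h z| ≤ N ^ (p - 2) * N := fun z => (hhb z).trans
    (mul_le_mul_of_nonneg_left (hN z)
      (Real.rpow_nonneg ((abs_nonneg _).trans (hN z)) _))
  have hpow : ∀ z, |F z| ^ p = |h z| * |F z| := fun z => by
    rcases (abs_nonneg (F z)).eq_or_lt with h0 | h0
    · rw [← h0, Real.zero_rpow hp0.ne', mul_zero]
    · rw [habs, mul_assoc, ← pow_two, ← Real.rpow_natCast, ← Real.rpow_add h0]
      norm_num
  have hFh : ∀ z, |F z| ^ p = F z * h z := fun z => by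
    rw [hpow, habs, hh, mul_assoc, ← pow_two, sq_abs]
    ring
  have hhq : ∀ z, ‖h z‖ₑ ^ q = ‖F z‖ₑ ^ p := fun z => by
    rw [Real.enorm_eq_ofReal_abs, Real.enorm_eq_ofReal_abs,
      ENNReal.ofReal_rpow_of_nonneg (abs_nonneg _) hq0.le,
      ENNReal.ofReal_rpow_of_nonneg (abs_nonneg _) hp0.le]
    congr 1
    rcases (abs_nonneg (F z)).eq_or_lt with h0 | h0
    · rw [habs, ← h0, mul_zero, Real.zero_rpow hp0.ne', Real.zero_rpow hq0.ne']
    · rw [habs, ← Real.rpow_add_one h0.ne', ← Real.rpow_mul h0.le]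
      congr 1
      have := hpq.sub_one_mul_conj
      linarith
  have hFpi : Integrable fun z => |F z| ^ p := by
    simp only [hFh]
    exact hFi.mul_bdd hhc.aestronglyMeasurable (ae_of_all _ hhN)
  set I := ∫⁻ z, ‖F z‖ₑ ^ p with hI
  set J := ∫⁻ z, ‖f z‖ₑ ^ p with hJ
  have hIeq : I = ENNReal.ofReal (∫ z, |F z| ^ p) := by
    rw [ofReal_integral_eq_lintegral_ofReal hFpi (ae_of_all _ fun z => by positivity)]
    simp only [hI, Real.enorm_eq_ofReal_abs, ENNReal.ofReal_rpow_of_nonneg (abs_nonneg _) hp0.le]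
  have hItop : I ≠ ∞ := hIeq ▸ ENNReal.ofReal_ne_top
  have hdual : ∫⁻ w, ‖∫ z, k (z - w) * h z‖ₑ ^ q ≤ C * I := by
    have h1 := hq (fun z => h (-z)) (by fun_prop) hhi.comp_neg
    rw [lintegral_neg_eq_self (fun z => ‖h z‖ₑ ^ q), ← lintegral_neg_eq_self] at h1
    refine le_trans (le_of_eq ?_) (h1.trans_eq ?_)
    · congr! 3 with w
      rw [← integral_neg_eq_self (fun z => k (z - w) * h z)]
      refine congrArg _ (integral_congr_ae (ae_of_all _ fun z => ?_))
      simp only [neg_sub_comm z w]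
    · simp only [hhq, hI]
  have hle : I ≤ J ^ (1 / p) * (C * I) ^ (1 / q) := by
    calc I = ENNReal.ofReal (∫ w, f w * ∫ z, k (z - w) * h z) := by
          rw [hIeq, ← integral_integral_sub_mul_mul hk hfi hhc hhN]
          simp only [hFh]
          rfl
      _ ≤ ∫⁻ w, ‖f w * ∫ z, k (z - w) * h z‖ₑ := by
          refine le_trans ?_ (enorm_integral_le_lintegral_enorm _)
          rw [Real.enorm_eq_ofReal_abs]
          exact ENNReal.ofReal_le_ofReal (le_abs_self _)
      _ = ∫⁻ w, ‖f w‖ₑ * ‖∫ z, k (z - w) * h z‖ₑ := by simp only [enorm_mul]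
      _ ≤ J ^ (1 / p) * (∫⁻ w, ‖∫ z, k (z - w) * h z‖ₑ ^ q) ^ (1 / q) := by
          refine ENNReal.lintegral_mul_le_Lp_mul_Lq _ hpq (by fun_prop) ?_
          have : Measurable
              (Function.uncurry fun w z : EuclideanSpace ℝ (Fin n) × ℝ => k (z - w) * h z) := by
            simp only [Function.uncurry_def]
            fun_prop
          exact this.stronglyMeasurable.integral_prod_right.measurable.enorm.aemeasurable
      _ ≤ _ := by gcongr
  rcases eq_or_ne I 0 with h0 | h0
  · rw [h0]; exact zero_le
  have h1 : I ^ (1 / p) ≤ J ^ (1 / p) * C ^ (1 / q) := by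
    have hsplit : I = I ^ (1 / p) * I ^ (1 / q) := by
      rw [← ENNReal.rpow_add _ _ h0 hItop, one_div, one_div, hpq.inv_add_inv_eq_one,
        ENNReal.rpow_one]
    rw [ENNReal.mul_rpow_of_nonneg _ _ (by positivity), ← mul_assoc] at hle
    nth_rewrite 1 [hsplit] at hle
    refine (ENNReal.mul_le_mul_iff_left ?_ ?_).1 hle
    · exact (ENNReal.rpow_pos (pos_iff_ne_zero.2 h0) hItop).ne'
    · exact ENNReal.rpow_ne_top_of_nonneg (by positivity) hItop
  have h2 := ENNReal.rpow_le_rpow h1 hp0.le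
  rw [ENNReal.mul_rpow_of_nonneg _ _ hp0.le, ← ENNReal.rpow_mul, ← ENNReal.rpow_mul,
    ← ENNReal.rpow_mul, one_div_mul_cancel hp0.ne', ENNReal.rpow_one, ENNReal.rpow_one, mul_comm,
    one_div_mul_eq_div, hpq.div_conj_eq_sub_one] at h2
  exact h2

end convolution

/-- `L^p` boundedness of convolution operators with a parabolic Calderón–Zygmund kernel. -/
theorem exists_lintegral_rpow_le (n : ℕ) {p : ℝ} (hp : 1 < p) {A B : ℝ≥0∞} (hA : A ≠ ∞)
    (hB : B ≠ ∞) :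
    ∃ C : ℝ≥0∞, C ≠ ∞ ∧ ∀ k : EuclideanSpace ℝ (Fin n) × ℝ → ℝ, Measurable k →
      (∃ M, ∀ z, |k z| ≤ M) → Integrable k → ParabolicHormander k B →
      (∀ g : EuclideanSpace ℝ (Fin n) × ℝ → ℝ, Measurable g → Integrable g →
        (∃ M, ∀ z, |g z| ≤ M) →
        ∫⁻ z, ‖∫ w, k (z - w) * g w‖ₑ ^ 2 ≤ A * ∫⁻ z, ‖g z‖ₑ ^ 2) →
      ∀ f : EuclideanSpace ℝ (Fin n) × ℝ → ℝ, Continuous f → Integrable f →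
        (∃ M, ∀ z, |f z| ≤ M) →
        ∫⁻ z, ‖∫ w, k (z - w) * f w‖ₑ ^ p ≤ C * ∫⁻ z, ‖f z‖ₑ ^ p := by
  rcases lt_trichotomy p 2 with h2 | rfl | h2
  · obtain ⟨C, hC, h⟩ := exists_lintegral_rpow_le_of_lt_two n hp h2 hA hB
    exact ⟨C, hC, fun k hkm hkb _ hH hL f hf hfi _ => h k hkm hkb hH hL f hf hfi⟩
  · refine ⟨A, hA, fun k hkm hkb _ hH hL f hf hfi hfb => ?_⟩
    simpa only [ENNReal.rpow_ofNat] using hL f hf.measurable hfi hfb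
  · have hpq := Real.HolderConjugate.conjExponent hp
    have hq2 : p.conjExponent < 2 := by
      rw [Real.conjExponent, div_lt_iff₀ (by linarith)]
      linarith
    obtain ⟨C, hC, h⟩ := exists_lintegral_rpow_le_of_lt_two n hpq.symm.lt hq2 hA hB
    refine ⟨C ^ (p - 1), ENNReal.rpow_ne_top_of_nonneg (by linarith) hC,
      fun k hkm hkb hki hH hL f hf hfi ⟨M, hM⟩ => ?_⟩
    exact lintegral_rpow_le_of_dual hpq h2.le hkm hki
      (fun f hf hfi => h k hkm hkb hH hL f hf hfi) hf hfi hM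

section heat_kernel

variable {n : ℕ}

/-- The unnormalised Gaussian `s^{-n/2} exp(-a|x|²/s)`. -/
noncomputable def gaussian (a : ℝ) (x : EuclideanSpace ℝ (Fin n)) (s : ℝ) : ℝ :=
  s ^ (-(n / 2 : ℝ)) * Real.exp (-(a * ‖x‖ ^ 2 / s))

/-- The heat kernel `(4πs)^{-n/2} exp(-|x|²/(4s))`. -/
noncomputable def heatKernel (x : EuclideanSpace ℝ (Fin n)) (s : ℝ) : ℝ :=
  (4 * Real.pi) ^ (-(n / 2 : ℝ)) * gaussian (1 / 4) x s

/-- Logarithmic derivative of the heat kernel in the direction `(y, r)`. -/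
noncomputable def heatLogDeriv (x : EuclideanSpace ℝ (Fin n)) (s : ℝ)
    (y : EuclideanSpace ℝ (Fin n)) (r : ℝ) : ℝ :=
  -(inner ℝ x y / (2 * s)) + r * (‖x‖ ^ 2 / (4 * s ^ 2) - n / (2 * s))

/-- Polynomial factor of the second spatial derivatives of the heat kernel. -/
noncomputable def heatHessFactor (i j : Fin n) (x : EuclideanSpace ℝ (Fin n)) (s : ℝ) : ℝ :=
  x i * x j / (4 * s ^ 2) - (if i = j then 1 else 0) / (2 * s)

/-- The second spatial derivative `∂ᵢ∂ⱼ` of the heat kernel. -/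
noncomputable def heatHess (i j : Fin n) (x : EuclideanSpace ℝ (Fin n)) (s : ℝ) : ℝ :=
  heatHessFactor i j x s * heatKernel x s

/-- Derivative of `heatHessFactor` in the direction `(y, r)`. -/
noncomputable def heatHessFactorDeriv (i j : Fin n) (x : EuclideanSpace ℝ (Fin n)) (s : ℝ)
    (y : EuclideanSpace ℝ (Fin n)) (r : ℝ) : ℝ :=
  (y i * x j + x i * y j) / (4 * s ^ 2) - r * (x i * x j / (2 * s ^ 3)) +
    r * ((if i = j then 1 else 0) / (2 * s ^ 2))

/-- Derivative of `heatHess` in the direction `(y, r)`. -/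
noncomputable def heatHessDeriv (i j : Fin n) (x : EuclideanSpace ℝ (Fin n)) (s : ℝ)
    (y : EuclideanSpace ℝ (Fin n)) (r : ℝ) : ℝ :=
  (heatHessFactorDeriv i j x s y r + heatHessFactor i j x s * heatLogDeriv x s y r) *
    heatKernel x s

theorem hasDerivAt_heatKernel (x y : EuclideanSpace ℝ (Fin n)) {s r θ : ℝ} (h : 0 < s + θ * r) :
    HasDerivAt (fun θ : ℝ => heatKernel (x + θ • y) (s + θ * r))
      (heatLogDeriv (x + θ • y) (s + θ * r) y r * heatKernel (x + θ • y) (s + θ * r)) θ := by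
  have hS : HasDerivAt (fun θ : ℝ => s + θ * r) r θ := by
    simpa using ((hasDerivAt_id θ).mul_const r).const_add s
  have hX : HasDerivAt (fun θ : ℝ => x + θ • y) y θ := by
    simpa using ((hasDerivAt_id θ).smul_const y).const_add x
  have hN := (((hX.norm_sq).const_mul (1 / 4 : ℝ)).div hS h.ne').neg.exp
  have hP := hS.rpow_const (p := -(n / 2 : ℝ)) (Or.inl h.ne')
  refine ((hP.mul hN).const_mul ((4 * Real.pi) ^ (-(n / 2 : ℝ)))).congr_deriv ?_
  rw [heatKernel, gaussian, heatLogDeriv, Real.rpow_sub_one h.ne']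
  simp only [Pi.neg_apply, Pi.div_apply]
  field_simp
  ring

theorem hasDerivAt_heatHess (i j : Fin n) (x y : EuclideanSpace ℝ (Fin n)) {s r θ : ℝ}
    (h : 0 < s + θ * r) :
    HasDerivAt (fun θ : ℝ => heatHess i j (x + θ • y) (s + θ * r))
      (heatHessDeriv i j (x + θ • y) (s + θ * r) y r) θ := by
  have hS : HasDerivAt (fun θ : ℝ => s + θ * r) r θ := by
    simpa using ((hasDerivAt_id θ).mul_const r).const_add s
  have hX : ∀ i, HasDerivAt (fun θ : ℝ => (x + θ • y) i) (y i) θ := fun i => by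
    simpa using ((hasDerivAt_id θ).mul_const (y i)).const_add (x i)
  have h1 := ((hX i).mul (hX j)).div ((hS.pow 2).const_mul 4)
    (mul_ne_zero four_ne_zero (pow_ne_zero 2 h.ne'))
  have h2 := (hasDerivAt_const θ (if i = j then (1:ℝ) else 0)).div (hS.const_mul 2) (by positivity)
  refine ((h1.sub h2).mul (hasDerivAt_heatKernel x y h)).congr_deriv ?_
  rw [heatHessDeriv, heatHessFactorDeriv, heatHessFactor]
  simp only [Pi.sub_apply, Pi.div_apply, Pi.mul_apply, Pi.pow_apply]
  field_simp
  ring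

theorem gaussian_nonneg (a : ℝ) (x : EuclideanSpace ℝ (Fin n)) {s : ℝ} (hs : 0 ≤ s) :
    0 ≤ gaussian a x s := by
  unfold gaussian; positivity

theorem heatKernel_nonneg (x : EuclideanSpace ℝ (Fin n)) {s : ℝ} (hs : 0 ≤ s) :
    0 ≤ heatKernel x s :=
  mul_nonneg (by positivity) (gaussian_nonneg _ _ hs)

theorem heatKernel_le_gaussian (x : EuclideanSpace ℝ (Fin n)) {s : ℝ} (hs : 0 ≤ s) :
    heatKernel x s ≤ gaussian (1 / 4) x s := by
  refine mul_le_of_le_one_left (gaussian_nonneg _ _ hs)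
    (Real.rpow_le_one_of_one_le_of_nonpos ?_ (by simp; positivity))
  nlinarith [Real.pi_gt_three]

/-- Polynomial factors are absorbed by widening the Gaussian. -/
theorem mul_gaussian_le (x : EuclideanSpace ℝ (Fin n)) {s : ℝ} (hs : 0 < s) :
    (1 + ‖x‖ ^ 2 / s) ^ 2 * gaussian (1 / 4) x s ≤ 256 * gaussian (1 / 8) x s := by
  set q := ‖x‖ ^ 2 / s with hq
  have hq0 : 0 ≤ q := by positivity
  have h1 : (1 + q) ^ 2 ≤ 256 * Real.exp (q / 8) := by
    have : 1 + q ≤ 16 * Real.exp (q / 16) := by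
      have := Real.add_one_le_exp (q / 16)
      linarith
    calc (1 + q) ^ 2 ≤ (16 * Real.exp (q / 16)) ^ 2 := by gcongr
      _ = _ := by
        rw [mul_pow, ← Real.exp_nat_mul]
        norm_num
        ring_nf
  have h2 : Real.exp (-(1 / 8 * ‖x‖ ^ 2 / s)) =
      Real.exp (q / 8) * Real.exp (-(1 / 4 * ‖x‖ ^ 2 / s)) := by
    rw [← Real.exp_add]
    congr 1
    rw [hq]
    ring
  rw [gaussian, gaussian, h2, mul_left_comm, mul_left_comm 256, ← mul_assoc 256]
  gcongr

theorem abs_heatHessFactor_le (i j : Fin n) (x : EuclideanSpace ℝ (Fin n)) {s : ℝ} (hs : 0 < s) :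
    |heatHessFactor i j x s| ≤ (‖x‖ ^ 2 / s / 4 + 1 / 2) / s := by
  have hi : |x i| ≤ ‖x‖ := PiLp.norm_apply_le x i
  have hj : |x j| ≤ ‖x‖ := PiLp.norm_apply_le x j
  calc |heatHessFactor i j x s| ≤ |x i * x j / (4 * s ^ 2)| +
      |(if i = j then 1 else 0) / (2 * s)| :=
        abs_sub _ _
    _ ≤ ‖x‖ * ‖x‖ / (4 * s ^ 2) + 1 / (2 * s) := by
        rw [abs_div, abs_div, abs_mul, abs_of_pos (show 0 < 4 * s ^ 2 by positivity),
          abs_of_pos (show 0 < 2 * s by positivity)]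
        gcongr
        split_ifs <;> simp
    _ = _ := by field_simp

theorem abs_heatLogDeriv_le (x y : EuclideanSpace ℝ (Fin n)) {s : ℝ} (hs : 0 < s) (r : ℝ) :
    |heatLogDeriv x s y r| ≤
      ‖x‖ * ‖y‖ / (2 * s) + |r| * (‖x‖ ^ 2 / (4 * s ^ 2) + n / (2 * s)) := by
  refine (abs_add_le _ _).trans ?_
  rw [abs_neg, abs_mul, abs_div, abs_of_pos (show 0 < 2 * s by positivity)]
  gcongr
  · exact abs_real_inner_le_norm x y
  · refine (abs_sub _ _).trans_eq ?_
    rw [abs_of_nonneg (by positivity), abs_of_nonneg (by positivity)]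

theorem abs_heatHessFactorDeriv_le (i j : Fin n) (x y : EuclideanSpace ℝ (Fin n)) {s : ℝ}
    (hs : 0 < s) (r : ℝ) :
    |heatHessFactorDeriv i j x s y r| ≤ 2 * ‖y‖ * ‖x‖ / (4 * s ^ 2) +
      |r| * (‖x‖ ^ 2 / (2 * s ^ 3)) + |r| * (1 / (2 * s ^ 2)) := by
  have hxi : |x i| ≤ ‖x‖ := PiLp.norm_apply_le x i
  have hxj : |x j| ≤ ‖x‖ := PiLp.norm_apply_le x j
  have hyi : |y i| ≤ ‖y‖ := PiLp.norm_apply_le y i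
  have hyj : |y j| ≤ ‖y‖ := PiLp.norm_apply_le y j
  refine (abs_add_le _ _).trans (add_le_add ((abs_sub _ _).trans (add_le_add ?_ ?_)) ?_)
  · rw [abs_div, abs_of_pos (show 0 < 4 * s ^ 2 by positivity)]
    gcongr
    calc |y i * x j + x i * y j| ≤ |y i| * |x j| + |x i| * |y j| := by
          rw [← abs_mul, ← abs_mul]; exact abs_add_le _ _
      _ ≤ ‖y‖ * ‖x‖ + ‖x‖ * ‖y‖ := by gcongr
      _ = _ := by ring
  · rw [abs_mul, abs_div, abs_mul, abs_of_pos (show 0 < 2 * s ^ 3 by positivity), pow_two]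
    gcongr
  · rw [abs_mul, abs_div, abs_of_pos (show 0 < 2 * s ^ 2 by positivity)]
    gcongr
    split_ifs <;> simp

theorem abs_heatHess_le (i j : Fin n) (x : EuclideanSpace ℝ (Fin n)) {s : ℝ} (hs : 0 < s) :
    |heatHess i j x s| ≤ 256 / s * gaussian (1 / 8) x s := by
  rw [heatHess, abs_mul, abs_of_nonneg (heatKernel_nonneg x hs.le)]
  set q := ‖x‖ ^ 2 / s with hq
  have hq0 : 0 ≤ q := by positivity
  calc _ ≤ (q / 4 + 1 / 2) / s * gaussian (1 / 4) x s := by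
        gcongr
        · exact heatKernel_nonneg x hs.le
        · exact abs_heatHessFactor_le i j x hs
        · exact heatKernel_le_gaussian x hs.le
    _ ≤ (1 + q) ^ 2 / s * gaussian (1 / 4) x s := by
        gcongr
        · exact gaussian_nonneg _ _ hs.le
        · nlinarith
    _ = (1 + q) ^ 2 * gaussian (1 / 4) x s / s := by ring
    _ ≤ 256 * gaussian (1 / 8) x s / s := by
        gcongr ?_ / s
        exact mul_gaussian_le x hs
    _ = _ := by ring

theorem abs_heatHessDeriv_le (i j : Fin n) (x y : EuclideanSpace ℝ (Fin n)) {σ : ℝ} (hσ : 0 < σ)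
    (r : ℝ) :
    |heatHessDeriv i j x (σ ^ 2) y r| ≤
      256 * (n + 1) * (‖y‖ / σ ^ 3 + |r| / σ ^ 4) * gaussian (1 / 8) x (σ ^ 2) := by
  have hs : 0 < σ ^ 2 := by positivity
  obtain ⟨ρ, hρ⟩ : ∃ ρ, ρ = ‖x‖ / σ := ⟨_, rfl⟩
  obtain ⟨Y, hY⟩ : ∃ Y, Y = ‖y‖ / σ ^ 3 := ⟨_, rfl⟩
  obtain ⟨R, hR⟩ : ∃ R, R = |r| / σ ^ 4 := ⟨_, rfl⟩
  have hρ0 : 0 ≤ ρ := by rw [hρ]; positivity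
  have hY0 : 0 ≤ Y := by rw [hY]; positivity
  have hR0 : 0 ≤ R := by rw [hR]; positivity
  have hx : ‖x‖ = ρ * σ := by rw [hρ]; field_simp
  have hy : ‖y‖ = Y * σ ^ 3 := by rw [hY]; field_simp
  have hr : |r| = R * σ ^ 4 := by rw [hR]; field_simp
  have h1 := abs_heatHessFactor_le i j x hs
  have h2 := abs_heatLogDeriv_le x y hs r
  have h3 := abs_heatHessFactorDeriv_le i j x y hs r
  have e1 : (‖x‖ ^ 2 / σ ^ 2 / 4 + 1 / 2) / σ ^ 2 = (ρ ^ 2 / 4 + 1 / 2) / σ ^ 2 := by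
    rw [hx]; field_simp
  have e2 : ‖x‖ * ‖y‖ / (2 * σ ^ 2) + |r| * (‖x‖ ^ 2 / (4 * (σ ^ 2) ^ 2) + n / (2 * σ ^ 2)) =
      (Y * ρ / 2 + R * (ρ ^ 2 / 4 + n / 2)) * σ ^ 2 := by
    rw [hx, hy, hr]; field_simp
  have e3 : 2 * ‖y‖ * ‖x‖ / (4 * (σ ^ 2) ^ 2) + |r| * (‖x‖ ^ 2 / (2 * (σ ^ 2) ^ 3)) +
      |r| * (1 / (2 * (σ ^ 2) ^ 2)) = Y * ρ / 2 + R * (ρ ^ 2 + 1) / 2 := by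
    rw [hx, hy, hr]; field_simp; ring
  rw [e1] at h1
  rw [e2] at h2
  rw [e3] at h3
  have hF : |heatHessFactorDeriv i j x (σ ^ 2) y r +
      heatHessFactor i j x (σ ^ 2) * heatLogDeriv x (σ ^ 2) y r| ≤
      (n + 1) * (Y + R) * (1 + ‖x‖ ^ 2 / σ ^ 2) ^ 2 := by
    calc _ ≤ (Y * ρ / 2 + R * (ρ ^ 2 + 1) / 2) + (ρ ^ 2 / 4 + 1 / 2) / σ ^ 2 *
          ((Y * ρ / 2 + R * (ρ ^ 2 / 4 + n / 2)) * σ ^ 2) := by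
          refine (abs_add_le _ _).trans (add_le_add h3 ?_)
          rw [abs_mul]
          gcongr
      _ = Y * (ρ / 2 + (ρ ^ 2 / 4 + 1 / 2) * (ρ / 2)) +
          R * ((ρ ^ 2 + 1) / 2 + (ρ ^ 2 / 4 + 1 / 2) * (ρ ^ 2 / 4 + n / 2)) := by
          field_simp
          ring
      _ ≤ Y * ((n + 1) * (1 + ρ ^ 2) ^ 2) + R * ((n + 1) * (1 + ρ ^ 2) ^ 2) := by
          have hn : (0:ℝ) ≤ n := by positivity
          have h4 : 0 ≤ n * ρ ^ 2 := by positivity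
          have h5 : 0 ≤ n * ρ ^ 4 := by positivity
          have h6 : 0 ≤ ρ ^ 4 := by positivity
          have h7 := sq_nonneg (ρ - 1)
          have h8 := mul_nonneg (sq_nonneg ρ) h7
          gcongr
          · nlinarith
          · nlinarith
      _ = _ := by
          rw [hx]
          field_simp
  rw [heatHessDeriv, abs_mul, abs_of_nonneg (heatKernel_nonneg x hs.le), ← hY, ← hR]
  calc _ ≤ (n + 1) * (Y + R) * (1 + ‖x‖ ^ 2 / σ ^ 2) ^ 2 * gaussian (1 / 4) x (σ ^ 2) := by
        gcongr
        · exact heatKernel_nonneg x hs.le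
        · exact heatKernel_le_gaussian x hs.le
    _ = (n + 1) * (Y + R) * ((1 + ‖x‖ ^ 2 / σ ^ 2) ^ 2 * gaussian (1 / 4) x (σ ^ 2)) := by ring
    _ ≤ (n + 1) * (Y + R) * (256 * gaussian (1 / 8) x (σ ^ 2)) := by
        gcongr (n + 1) * (Y + R) * ?_
        exact mul_gaussian_le x hs
    _ = _ := by ring

end heat_kernel

section heat_kernel_integrals

variable {n : ℕ}

theorem measurable_gaussian (a : ℝ) :
    Measurable fun z : EuclideanSpace ℝ (Fin n) × ℝ => gaussian a z.1 z.2 := by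
  unfold gaussian
  fun_prop

theorem measurable_heatHess (i j : Fin n) :
    Measurable fun z : EuclideanSpace ℝ (Fin n) × ℝ => heatHess i j z.1 z.2 := by
  unfold heatHess heatHessFactor heatKernel
  have := measurable_gaussian (n := n) (1 / 4)
  fun_prop

theorem integral_heat_gaussian {a s : ℝ} (ha : 0 < a) (hs : 0 < s) :
    ∫ x : EuclideanSpace ℝ (Fin n), gaussian a x s = (Real.pi / a) ^ (n / 2 : ℝ) := by
  have := GaussianFourier.integral_rexp_neg_mul_sq_norm (V := EuclideanSpace ℝ (Fin n))
    (div_pos ha hs)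
  simp only [finrank_euclideanSpace_fin] at this
  unfold gaussian
  rw [integral_const_mul]
  have e : ∀ x : EuclideanSpace ℝ (Fin n), -(a * ‖x‖ ^ 2 / s) = -(a / s) * ‖x‖ ^ 2 := fun x => by
    ring
  simp only [e]
  rw [this, div_div_eq_mul_div, mul_div_right_comm, Real.mul_rpow (by positivity) hs.le,
    mul_left_comm, ← Real.rpow_add hs]
  simp

theorem integrable_gaussian {a s : ℝ} (ha : 0 < a) (hs : 0 < s) :
    Integrable fun x : EuclideanSpace ℝ (Fin n) => gaussian a x s := by
  refine not_imp_comm.1 integral_undef ?_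
  rw [integral_heat_gaussian ha hs]
  positivity

theorem lintegral_gaussian {a s : ℝ} (ha : 0 < a) (hs : 0 < s) :
    ∫⁻ x : EuclideanSpace ℝ (Fin n), ENNReal.ofReal (gaussian a x s) =
      ENNReal.ofReal ((Real.pi / a) ^ (n / 2 : ℝ)) := by
  rw [← integral_heat_gaussian ha hs,
    ofReal_integral_eq_lintegral_ofReal (integrable_gaussian ha hs)
    (ae_of_all _ fun x => gaussian_nonneg _ _ hs.le)]

theorem integral_heatKernel {s : ℝ} (hs : 0 < s) :
    ∫ x : EuclideanSpace ℝ (Fin n), heatKernel x s = 1 := by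
  unfold heatKernel
  rw [integral_const_mul, integral_heat_gaussian (by norm_num) hs, div_div_eq_mul_div, div_one,
    mul_comm Real.pi, ← Real.rpow_add (by positivity)]
  simp

theorem integrable_heatKernel {s : ℝ} (hs : 0 < s) :
    Integrable fun x : EuclideanSpace ℝ (Fin n) => heatKernel x s :=
  (integrable_gaussian (by norm_num) hs).const_mul _

theorem lintegral_enorm_heatHess_le (i j : Fin n) {s : ℝ} (hs : 0 < s) :
    ∫⁻ x, ‖heatHess i j x s‖ₑ ≤ ENNReal.ofReal (256 * (8 * Real.pi) ^ (n / 2 : ℝ) / s) := by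
  calc ∫⁻ x, ‖heatHess i j x s‖ₑ
      ≤ ∫⁻ x : EuclideanSpace ℝ (Fin n),
          ENNReal.ofReal (256 / s) * ENNReal.ofReal (gaussian (1 / 8) x s) := by
        refine lintegral_mono fun x => ?_
        rw [← ENNReal.ofReal_mul (by positivity), Real.enorm_eq_ofReal_abs]
        exact ENNReal.ofReal_le_ofReal (abs_heatHess_le i j x hs)
    _ = _ := by
        rw [lintegral_const_mul' _ _ ENNReal.ofReal_ne_top, lintegral_gaussian (by norm_num) hs,
          ← ENNReal.ofReal_mul (by positivity)]
        congr 1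
        rw [div_div_eq_mul_div, div_one, mul_comm Real.pi]
        ring

theorem mul_gaussian_le_sixteenth (x : EuclideanSpace ℝ (Fin n)) {s : ℝ} (hs : 0 < s) :
    ‖x‖ ^ 2 / s * gaussian (1 / 8) x s ≤ 16 * gaussian (1 / 16) x s := by
  set q := ‖x‖ ^ 2 / s with hq
  have h1 : q ≤ 16 * Real.exp (q / 16) := by
    have := Real.add_one_le_exp (q / 16)
    linarith
  have h2 : Real.exp (-(1 / 16 * ‖x‖ ^ 2 / s)) =
      Real.exp (q / 16) * Real.exp (-(1 / 8 * ‖x‖ ^ 2 / s)) := by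
    rw [← Real.exp_add]
    congr 1
    rw [hq]
    ring
  rw [gaussian, gaussian, h2, mul_left_comm, mul_left_comm 16, ← mul_assoc 16]
  gcongr

theorem lintegral_enorm_heatHess_compl_ball_le (i j : Fin n) {s l : ℝ} (hs : 0 < s) (hl : 0 < l) :
    ∫⁻ x in {x | l ≤ ‖x‖}, ‖heatHess i j x s‖ₑ ≤
      ENNReal.ofReal (4096 * (16 * Real.pi) ^ (n / 2 : ℝ) / l ^ 2) := by
  calc ∫⁻ x in {x | l ≤ ‖x‖}, ‖heatHess i j x s‖ₑ
      ≤ ∫⁻ x in {x : EuclideanSpace ℝ (Fin n) | l ≤ ‖x‖},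
          ENNReal.ofReal (4096 / l ^ 2) * ENNReal.ofReal (gaussian (1 / 16) x s) := by
        refine setLIntegral_mono' (measurableSet_le measurable_const measurable_norm)
          fun x (hx : l ≤ ‖x‖) => ?_
        rw [← ENNReal.ofReal_mul (by positivity), Real.enorm_eq_ofReal_abs]
        refine ENNReal.ofReal_le_ofReal ((abs_heatHess_le i j x hs).trans ?_)
        have h1 := mul_gaussian_le_sixteenth x hs
        have h0 := gaussian_nonneg (1 / 8) x hs.le
        calc 256 / s * gaussian (1 / 8) x s
            ≤ 256 / s * (‖x‖ ^ 2 / l ^ 2) * gaussian (1 / 8) x s := by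
              gcongr
              refine le_mul_of_one_le_right (by positivity) ?_
              rw [one_le_div (by positivity)]
              gcongr
          _ = 256 / l ^ 2 * (‖x‖ ^ 2 / s * gaussian (1 / 8) x s) := by ring
          _ ≤ 256 / l ^ 2 * (16 * gaussian (1 / 16) x s) := by gcongr
          _ = _ := by ring
    _ ≤ ∫⁻ x : EuclideanSpace ℝ (Fin n),
          ENNReal.ofReal (4096 / l ^ 2) * ENNReal.ofReal (gaussian (1 / 16) x s) :=
        setLIntegral_le_lintegral _ _
    _ = _ := by
        rw [lintegral_const_mul' _ _ ENNReal.ofReal_ne_top, lintegral_gaussian (by norm_num) hs,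
          ← ENNReal.ofReal_mul (by positivity)]
        congr 1
        rw [div_div_eq_mul_div, div_one, mul_comm Real.pi]
        ring

/-- The second derivatives of the heat kernel, truncated to times in `(ε, N]`. -/
noncomputable def truncHess (i j : Fin n) (ε N : ℝ) (z : EuclideanSpace ℝ (Fin n) × ℝ) : ℝ :=
  (Set.Ioc ε N).indicator (fun _ => 1) z.2 * heatHess i j z.1 z.2

theorem measurable_truncHess (i j : Fin n) (ε N : ℝ) : Measurable (truncHess i j ε N) := by
  unfold truncHess
  have := measurable_heatHess i j
  have h : Measurable ((Set.Ioc ε N).indicator fun _ => (1:ℝ)) :=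
    measurable_const.indicator measurableSet_Ioc
  fun_prop

theorem truncHess_of_mem {i j : Fin n} {ε N : ℝ} {x : EuclideanSpace ℝ (Fin n)} {s : ℝ}
    (h : s ∈ Set.Ioc ε N) : truncHess i j ε N (x, s) = heatHess i j x s := by
  simp [truncHess, h]

theorem truncHess_of_notMem {i j : Fin n} {ε N : ℝ} {x : EuclideanSpace ℝ (Fin n)} {s : ℝ}
    (h : s ∉ Set.Ioc ε N) : truncHess i j ε N (x, s) = 0 := by
  simp [truncHess, h]

theorem exists_abs_truncHess_le (i j : Fin n) {ε : ℝ} (hε : 0 < ε) (N : ℝ) :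
    ∃ M, ∀ z, |truncHess i j ε N z| ≤ M := by
  refine ⟨256 / ε * ε ^ (-(n / 2 : ℝ)), fun ⟨x, s⟩ => ?_⟩
  by_cases h : s ∈ Set.Ioc ε N
  · have hs : 0 < s := hε.trans h.1
    rw [truncHess_of_mem h]
    refine (abs_heatHess_le i j x hs).trans ?_
    have h1 : gaussian (1 / 8) x s ≤ ε ^ (-(n / 2 : ℝ)) := by
      refine (mul_le_of_le_one_right (by positivity) (Real.exp_le_one_iff.2 ?_)).trans ?_
      · rw [neg_nonpos]; positivity
      · exact Real.rpow_le_rpow_of_nonpos hε h.1.le (by simp; positivity)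
    have := h.1.le
    gcongr
    exact gaussian_nonneg _ _ hs.le
  · rw [truncHess_of_notMem h, abs_zero]
    positivity

theorem integrable_truncHess (i j : Fin n) {ε : ℝ} (hε : 0 < ε) (N : ℝ) :
    Integrable (truncHess i j ε N) := by
  refine ⟨(measurable_truncHess i j ε N).aestronglyMeasurable, ?_⟩
  rw [HasFiniteIntegral, Measure.volume_eq_prod,
    lintegral_prod_symm _ (measurable_truncHess i j ε N).enorm.aemeasurable]
  calc ∫⁻ s, ∫⁻ x, ‖truncHess i j ε N (x, s)‖ₑ
      ≤ ∫⁻ s, (Set.Ioc ε N).indicator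
          (fun _ => ENNReal.ofReal (256 * (8 * Real.pi) ^ (n / 2 : ℝ) / ε)) s := by
        refine lintegral_mono fun s => ?_
        by_cases h : s ∈ Set.Ioc ε N
        · simp only [truncHess_of_mem h, Set.indicator_of_mem h]
          refine (lintegral_enorm_heatHess_le i j (hε.trans h.1)).trans
            (ENNReal.ofReal_le_ofReal ?_)
          have := h.1.le
          gcongr
        · simp [truncHess_of_notMem h]
    _ < ∞ := by
        rw [lintegral_indicator_const measurableSet_Ioc]
        simp [ENNReal.mul_lt_top_iff]

end heat_kernel_integrals

section hormander

variable {n : ℕ}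

theorem gaussian_sub_le (x : EuclideanSpace ℝ (Fin n)) {y : EuclideanSpace ℝ (Fin n)} {s r l : ℝ}
    (hl : 0 < l) (hs : 8 * l ^ 2 ≤ s) (hy : ‖y‖ ≤ l) (hr : |r| ≤ l ^ 2) :
    gaussian (1 / 8) (x - y) (s - r) ≤ 3 * 4 ^ (n / 2 : ℝ) * gaussian (1 / 32) x s := by
  have hl2 : 0 < l ^ 2 := by positivity
  have hs0 : 0 < s := by linarith
  have hr' := abs_le.1 hr
  have hσ : 0 < s - r := by linarith
  have h1 : (s - r) ^ (-(n / 2 : ℝ)) ≤ 4 ^ (n / 2 : ℝ) * s ^ (-(n / 2 : ℝ)) := by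
    have : (s / 4) ^ (-(n / 2 : ℝ)) = 4 ^ (n / 2 : ℝ) * s ^ (-(n / 2 : ℝ)) := by
      rw [Real.div_rpow hs0.le (by norm_num), Real.rpow_neg (by norm_num : (0:ℝ) ≤ 4),
        div_inv_eq_mul,
        mul_comm]
    rw [← this]
    exact Real.rpow_le_rpow_of_nonpos (by linarith) (by linarith) (by simp; positivity)
  have hx : ‖x‖ ^ 2 ≤ 2 * ‖x - y‖ ^ 2 + 2 * l ^ 2 := by
    have h2 : ‖x‖ ≤ ‖x - y‖ + l := by
      calc ‖x‖ = ‖x - y + y‖ := by simp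
        _ ≤ _ := (norm_add_le _ _).trans (by gcongr)
    nlinarith [norm_nonneg x, sq_nonneg (‖x - y‖ - l), norm_nonneg (x - y)]
  have h2 : Real.exp (-(1 / 8 * ‖x - y‖ ^ 2 / (s - r))) ≤
      3 * Real.exp (-(1 / 32 * ‖x‖ ^ 2 / s)) := by
    have h3 : -(1 / 8 * ‖x - y‖ ^ 2 / (s - r)) ≤ 1 + -(1 / 32 * ‖x‖ ^ 2 / s) := by
      have h4 : 1 / 32 * ‖x‖ ^ 2 / s ≤ 1 / 16 * ‖x - y‖ ^ 2 / s + 1 := by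
        rw [div_add' _ _ _ hs0.ne']
        gcongr
        linarith
      have h5 : 1 / 16 * ‖x - y‖ ^ 2 / s ≤ 1 / 8 * ‖x - y‖ ^ 2 / (s - r) := by
        rw [div_le_div_iff₀ hs0 hσ]
        nlinarith [sq_nonneg ‖x - y‖]
      linarith
    refine (Real.exp_le_exp.2 h3).trans ?_
    rw [Real.exp_add]
    gcongr
    linarith [Real.exp_one_lt_d9]
  calc gaussian (1 / 8) (x - y) (s - r)
      ≤ (4 ^ (n / 2 : ℝ) * s ^ (-(n / 2 : ℝ))) * (3 * Real.exp (-(1 / 32 * ‖x‖ ^ 2 / s))) := by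
        unfold gaussian
        gcongr
    _ = _ := by
        unfold gaussian
        ring

theorem abs_heatHess_sub_sub_le (i j : Fin n) (x : EuclideanSpace ℝ (Fin n))
    {y : EuclideanSpace ℝ (Fin n)} {s r l : ℝ}
    (hl : 0 < l) (hs : 8 * l ^ 2 ≤ s) (hy : ‖y‖ ≤ l) (hr : |r| ≤ l ^ 2) :
    |heatHess i j (x - y) (s - r) - heatHess i j x s| ≤
      12288 * (n + 1) * 4 ^ (n / 2 : ℝ) * (l * s ^ (-3 / 2 : ℝ)) * gaussian (1 / 32) x s := by
  have hl2 : 0 < l ^ 2 := by positivity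
  have hs0 : 0 < s := by linarith
  have hpos : ∀ θ ∈ Set.Icc (0:ℝ) 1, 7 / 8 * s ≤ s + θ * (-r) := fun θ hθ => by
    nlinarith [abs_le.1 hr, hθ.1, hθ.2, abs_nonneg r, neg_abs_le r, le_abs_self r]
  set ρ := Real.sqrt s with hρ
  have hρ0 : 0 < ρ := Real.sqrt_pos.2 hs0
  have hρs : ρ ^ 2 = s := Real.sq_sqrt hs0.le
  have hρ3 : s ^ (-3 / 2 : ℝ) = 1 / ρ ^ 3 := by
    rw [hρ, Real.sqrt_eq_rpow, ← Real.rpow_natCast, ← Real.rpow_mul hs0.le, one_div,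
      ← Real.rpow_neg hs0.le]
    norm_num
  have hlρ : 2 * l ≤ ρ := by
    refine le_of_sq_le_sq ?_ hρ0.le
    nlinarith
  have key := norm_image_sub_le_of_norm_deriv_le_segment_01'
    (f := fun θ : ℝ => heatHess i j (x + θ • (-y)) (s + θ * (-r)))
    (f' := fun θ => heatHessDeriv i j (x + θ • (-y)) (s + θ * (-r)) (-y) (-r))
    (C := 12288 * (n + 1) * 4 ^ (n / 2 : ℝ) * (l * s ^ (-3 / 2 : ℝ)) * gaussian (1 / 32) x s)
    (fun θ hθ => (hasDerivAt_heatHess i j x (-y)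
      (by linarith [hpos θ hθ])).hasDerivWithinAt) ?_
  · simpa [← sub_eq_add_neg] using key
  intro θ hθ
  have hτ := hpos θ ⟨hθ.1, hθ.2.le⟩
  have hτ0 : 0 < s + θ * (-r) := by linarith
  set σ := Real.sqrt (s + θ * (-r)) with hσ
  have hσ0 : 0 < σ := Real.sqrt_pos.2 hτ0
  have hσs : σ ^ 2 = s + θ * (-r) := Real.sq_sqrt hτ0.le
  have hσρ : ρ / 2 ≤ σ := by
    refine le_of_sq_le_sq ?_ hσ0.le
    nlinarith
  have h1 := abs_heatHessDeriv_le i j (x + θ • (-y)) (-y) hσ0 (-r)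
  rw [hσs] at h1
  have h2 : gaussian (1 / 8) (x + θ • (-y)) (s + θ * (-r)) ≤
      3 * 4 ^ (n / 2 : ℝ) * gaussian (1 / 32) x s := by
    have := gaussian_sub_le x (y := θ • y) (r := θ * r) hl hs ?_ ?_
    · simpa [← sub_eq_add_neg] using this
    · rw [norm_smul, Real.norm_of_nonneg hθ.1]
      exact (mul_le_of_le_one_left (norm_nonneg _) hθ.2.le).trans hy
    · rw [abs_mul, abs_of_nonneg hθ.1]
      exact (mul_le_of_le_one_left (abs_nonneg _) hθ.2.le).trans hr
  have h3 : ‖-y‖ / σ ^ 3 + |-r| / σ ^ 4 ≤ 16 * (l * (1 / ρ ^ 3)) := by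
    rw [norm_neg, abs_neg]
    calc ‖y‖ / σ ^ 3 + |r| / σ ^ 4 ≤ l / (ρ / 2) ^ 3 + l ^ 2 / (ρ / 2) ^ 4 := by gcongr
      _ ≤ l / (ρ / 2) ^ 3 + l * (ρ / 2) / (ρ / 2) ^ 4 := by
        have : l ^ 2 ≤ l * (ρ / 2) := by nlinarith
        gcongr
      _ = _ := by field_simp; ring
  have h0 := gaussian_nonneg (1 / 32) x hs0.le
  have h0' := gaussian_nonneg (1 / 8) (x + θ • (-y)) hτ0.le
  rw [hρ3, Real.norm_eq_abs]
  calc _ ≤ _ := h1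
    _ ≤ 256 * (n + 1) * (16 * (l * (1 / ρ ^ 3))) *
        (3 * 4 ^ (n / 2 : ℝ) * gaussian (1 / 32) x s) := by
      gcongr
    _ = _ := by ring

theorem lintegral_enorm_heatHess_sub_sub_le (i j : Fin n)
    {y : EuclideanSpace ℝ (Fin n)} {s r l : ℝ}
    (hl : 0 < l) (hs : 8 * l ^ 2 ≤ s) (hy : ‖y‖ ≤ l) (hr : |r| ≤ l ^ 2) :
    ∫⁻ x, ‖heatHess i j (x - y) (s - r) - heatHess i j x s‖ₑ ≤
      ENNReal.ofReal (12288 * (n + 1) * 4 ^ (n / 2 : ℝ) * (32 * Real.pi) ^ (n / 2 : ℝ) * l) *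
        ENNReal.ofReal (s ^ (-3 / 2 : ℝ)) := by
  have hs0 : 0 < s := by nlinarith
  calc ∫⁻ x, ‖heatHess i j (x - y) (s - r) - heatHess i j x s‖ₑ
      ≤ ∫⁻ x : EuclideanSpace ℝ (Fin n),
          ENNReal.ofReal (12288 * (n + 1) * 4 ^ (n / 2 : ℝ) * (l * s ^ (-3 / 2 : ℝ))) *
            ENNReal.ofReal (gaussian (1 / 32) x s) := by
        refine lintegral_mono fun x => ?_
        rw [← ENNReal.ofReal_mul (by positivity), Real.enorm_eq_ofReal_abs]
        exact ENNReal.ofReal_le_ofReal (abs_heatHess_sub_sub_le i j x hl hs hy hr)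
    _ = _ := by
        rw [lintegral_const_mul' _ _ ENNReal.ofReal_ne_top, lintegral_gaussian (by norm_num) hs0,
          ← ENNReal.ofReal_mul (by positivity), ← ENNReal.ofReal_mul (by positivity)]
        congr 1
        rw [div_div_eq_mul_div, div_one, mul_comm Real.pi]
        ring

theorem lintegral_enorm_truncHess_compl_ball_le (i j : Fin n) {ε : ℝ} (hε : 0 < ε) (N s : ℝ) {l : ℝ}
    (hl : 0 < l) :
    ∫⁻ x in {x | l ≤ ‖x‖}, ‖truncHess i j ε N (x, s)‖ₑ ≤
      ENNReal.ofReal (4096 * (16 * Real.pi) ^ (n / 2 : ℝ) / l ^ 2) := by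
  by_cases h : s ∈ Set.Ioc ε N
  · simp only [truncHess_of_mem h]
    exact lintegral_enorm_heatHess_compl_ball_le i j (hε.trans h.1) hl
  · simp [truncHess_of_notMem h]

theorem lintegral_enorm_truncHess_sub_compl_ball_le (i j : Fin n) {ε : ℝ} (hε : 0 < ε) (N s r : ℝ)
    {y : EuclideanSpace ℝ (Fin n)} {l : ℝ} (hl : 0 < l) (hy : ‖y‖ ≤ l) :
    ∫⁻ x in {x | 2 * l ≤ ‖x‖}, ‖truncHess i j ε N (x - y, s - r) - truncHess i j ε N (x, s)‖ₑ ≤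
      2 * ENNReal.ofReal (4096 * (16 * Real.pi) ^ (n / 2 : ℝ) / l ^ 2) := by
  have hm : ∀ l : ℝ, MeasurableSet {x : EuclideanSpace ℝ (Fin n) | l ≤ ‖x‖} := fun l =>
    measurableSet_le measurable_const measurable_norm
  have hk := measurable_truncHess i j ε N
  calc ∫⁻ x in {x | 2 * l ≤ ‖x‖}, ‖truncHess i j ε N (x - y, s - r) - truncHess i j ε N (x, s)‖ₑ
      ≤ ∫⁻ x in {x | 2 * l ≤ ‖x‖},
          (‖truncHess i j ε N (x - y, s - r)‖ₑ + ‖truncHess i j ε N (x, s)‖ₑ) :=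
        lintegral_mono fun x => enorm_sub_le
    _ = (∫⁻ x in {x | 2 * l ≤ ‖x‖}, ‖truncHess i j ε N (x - y, s - r)‖ₑ) +
          ∫⁻ x in {x | 2 * l ≤ ‖x‖}, ‖truncHess i j ε N (x, s)‖ₑ :=
        lintegral_add_left (by fun_prop) _
    _ ≤ (∫⁻ x in {x | l ≤ ‖x‖}, ‖truncHess i j ε N (x, s - r)‖ₑ) +
          ∫⁻ x in {x | l ≤ ‖x‖}, ‖truncHess i j ε N (x, s)‖ₑ := by
        gcongr ?_ + ?_
        · rw [← lintegral_indicator (hm _), ← lintegral_indicator (hm _)]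
          refine le_of_le_of_eq (lintegral_mono fun x => ?_) (lintegral_sub_right_eq_self _ y)
          by_cases hx : 2 * l ≤ ‖x‖
          · have hx' : l ≤ ‖x - y‖ := by linarith [norm_sub_norm_le x y]
            simp [hx, hx']
          · simp [hx]
        · exact lintegral_mono_set fun x (hx : 2 * l ≤ ‖x‖) => show l ≤ ‖x‖ by linarith
    _ ≤ _ := by
        rw [two_mul]
        gcongr <;> exact lintegral_enorm_truncHess_compl_ball_le i j hε N _ hl

theorem lintegral_enorm_truncHess_sub_le (i j : Fin n) (ε N : ℝ)
    {y : EuclideanSpace ℝ (Fin n)} {s r l : ℝ}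
    (hl : 0 < l) (hs : 8 * l ^ 2 ≤ s) (hy : ‖y‖ ≤ l) (hr : |r| ≤ l ^ 2) :
    ∫⁻ x, ‖truncHess i j ε N (x - y, s - r) - truncHess i j ε N (x, s)‖ₑ ≤
      ENNReal.ofReal (12288 * (n + 1) * 4 ^ (n / 2 : ℝ) * (32 * Real.pi) ^ (n / 2 : ℝ) * l) *
        ENNReal.ofReal (s ^ (-3 / 2 : ℝ)) +
      (Set.Icc (ε - l ^ 2) (ε + l ^ 2) ∪ Set.Icc (N - l ^ 2) (N + l ^ 2)).indicator
        (fun _ => ENNReal.ofReal (256 * (8 * Real.pi) ^ (n / 2 : ℝ) / l ^ 2)) s := by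
  have hs0 : 0 < s := by nlinarith
  have hr' := abs_le.1 hr
  have hH := lintegral_enorm_heatHess_sub_sub_le i j hl hs hy hr
  have hone : ∀ {t t' : ℝ}, |t - t'| ≤ l ^ 2 → t ∈ Set.Ioc ε N → t' ∉ Set.Ioc ε N →
      t' ∈ Set.Icc (ε - l ^ 2) (ε + l ^ 2) ∪ Set.Icc (N - l ^ 2) (N + l ^ 2) ∧
      t ∈ Set.Icc (ε - l ^ 2) (ε + l ^ 2) ∪ Set.Icc (N - l ^ 2) (N + l ^ 2) := by
    intro t t' h h1 h2
    simp only [Set.mem_Ioc, not_and_or, not_lt, not_le, Set.mem_union, Set.mem_Icc] at *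
    have := abs_le.1 h
    rcases h2 with h2 | h2
    · exact ⟨Or.inl ⟨by linarith, by linarith⟩, Or.inl ⟨by linarith, by linarith⟩⟩
    · exact ⟨Or.inr ⟨by linarith, by linarith⟩, Or.inr ⟨by linarith, by linarith⟩⟩
  have hss : ∀ t, 7 * l ^ 2 ≤ t → ENNReal.ofReal (256 * (8 * Real.pi) ^ (n / 2 : ℝ) / t) ≤
      ENNReal.ofReal (256 * (8 * Real.pi) ^ (n / 2 : ℝ) / l ^ 2) := fun t ht => by
    have : l ^ 2 ≤ t := by nlinarith
    gcongr
  by_cases h1 : s - r ∈ Set.Ioc ε N <;> by_cases h2 : s ∈ Set.Ioc ε N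
  · simp only [truncHess_of_mem h1, truncHess_of_mem h2]
    exact hH.trans le_self_add
  · rw [Set.indicator_of_mem (hone (by simpa using hr) h1 h2).1]
    simp only [truncHess_of_mem h1, truncHess_of_notMem h2, sub_zero]
    refine le_trans ?_ le_add_self
    rw [lintegral_sub_right_eq_self (fun x => ‖heatHess i j x (s - r)‖ₑ) y]
    exact (lintegral_enorm_heatHess_le i j (by nlinarith)).trans (hss _ (by linarith))
  · rw [Set.indicator_of_mem (hone (by simpa using hr) h2 h1).2]
    simp only [truncHess_of_notMem h1, truncHess_of_mem h2, zero_sub, enorm_neg]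
    refine le_trans ?_ le_add_self
    exact (lintegral_enorm_heatHess_le i j hs0).trans (hss _ (by nlinarith))
  · simp [truncHess_of_notMem h1, truncHess_of_notMem h2]

theorem parabolicHormander_truncHess (i j : Fin n) {ε : ℝ} (hε : 0 < ε) (N : ℝ) :
    ParabolicHormander (truncHess i j ε N)
      (ENNReal.ofReal (32 * (4096 * (16 * Real.pi) ^ (n / 2 : ℝ))) +
        ENNReal.ofReal (12288 * (n + 1) * 4 ^ (n / 2 : ℝ) * (32 * Real.pi) ^ (n / 2 : ℝ)) +
        ENNReal.ofReal (4 * (256 * (8 * Real.pi) ^ (n / 2 : ℝ)))) := by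
  rintro l hl ⟨y, r⟩ hy hr
  simp only at hy hr
  have hl2 : 0 < l ^ 2 := by positivity
  have hr' := abs_le.1 hr
  have hk := measurable_truncHess i j ε N
  set C₁ := 4096 * (16 * Real.pi) ^ (n / 2 : ℝ)
  set C₂ := 12288 * (n + 1) * 4 ^ (n / 2 : ℝ) * (32 * Real.pi) ^ (n / 2 : ℝ)
  set C₃ := 256 * (8 * Real.pi) ^ (n / 2 : ℝ)
  have hC₁ : 0 ≤ C₁ := by positivity
  have hC₂ : 0 ≤ C₂ := by positivity
  have hC₃ : 0 ≤ C₃ := by positivity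
  set M := Set.Icc (ε - l ^ 2) (ε + l ^ 2) ∪ Set.Icc (N - l ^ 2) (N + l ^ 2) with hM
  have hMm : MeasurableSet M := measurableSet_Icc.union measurableSet_Icc
  have hS : MeasurableSet
      (ball (0 : EuclideanSpace ℝ (Fin n)) (2 * l) ×ˢ ball (0 : ℝ) (8 * l ^ 2))ᶜ :=
    (measurableSet_ball.prod measurableSet_ball).compl
  rw [← lintegral_indicator hS, Measure.volume_eq_prod,
    lintegral_prod_symm _ (Measurable.aemeasurable (by
      refine Measurable.indicator ?_ hS
      fun_prop))]
  have hslice : ∀ s : ℝ, ∫⁻ x, (ball (0 : EuclideanSpace ℝ (Fin n)) (2 * l) ×ˢ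
        ball (0 : ℝ) (8 * l ^ 2))ᶜ.indicator
        (fun z => ‖truncHess i j ε N (z - (y, r)) - truncHess i j ε N z‖ₑ) (x, s) ≤
      (ball (0:ℝ) (8 * l ^ 2)).indicator (fun _ => 2 * ENNReal.ofReal (C₁ / l ^ 2)) s +
      (Set.Ioi (4 * l ^ 2)).indicator
        (fun s => ENNReal.ofReal (C₂ * l) * ENNReal.ofReal (s ^ (-3 / 2 : ℝ))) s +
      M.indicator (fun _ => ENNReal.ofReal (C₃ / l ^ 2)) s := by
    intro s
    by_cases hs : s ∈ ball (0:ℝ) (8 * l ^ 2)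
    · rw [Set.indicator_of_mem hs, add_assoc]
      refine le_trans ?_ le_self_add
      refine le_trans ?_ (lintegral_enorm_truncHess_sub_compl_ball_le i j hε N s r hl hy)
      rw [← lintegral_indicator (measurableSet_le measurable_const measurable_norm)]
      refine lintegral_mono fun x => ?_
      by_cases hx : 2 * l ≤ ‖x‖
      · rw [Set.indicator_of_mem (s := {x : EuclideanSpace ℝ (Fin n) | 2 * l ≤ ‖x‖}) hx]
        exact Set.indicator_le_self _ _ _
      · rw [Set.indicator_of_notMem]
        · exact zero_le
        · have hx' : x ∈ ball (0 : EuclideanSpace ℝ (Fin n)) (2 * l) :=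
            mem_ball_zero_iff.2 (not_le.1 hx)
          exact fun h => h ⟨hx', hs⟩
    · rw [mem_ball_zero_iff, Real.norm_eq_abs, not_lt] at hs
      refine (lintegral_mono fun x => Set.indicator_le_self _ _ _).trans ?_
      rcases le_abs.1 hs with hs | hs
      · rw [add_assoc]
        refine le_trans ?_ le_add_self
        rw [Set.indicator_of_mem (s := Set.Ioi (4 * l ^ 2)) (show 4 * l ^ 2 < s by linarith)]
        exact lintegral_enorm_truncHess_sub_le i j ε N hl hs hy hr
      · have h1 : s - r ∉ Set.Ioc ε N := fun h => by linarith [h.1]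
        have h2 : s ∉ Set.Ioc ε N := fun h => by linarith [h.1]
        simp [truncHess_of_notMem h1, truncHess_of_notMem h2]
  refine (lintegral_mono hslice).trans ?_
  rw [lintegral_add_right _ (measurable_const.indicator hMm),
    lintegral_add_left (measurable_const.indicator measurableSet_ball),
    lintegral_indicator_const measurableSet_ball, lintegral_indicator_const hMm,
    lintegral_indicator measurableSet_Ioi, lintegral_const_mul' _ _ ENNReal.ofReal_ne_top,
    lintegral_Ioi_ofReal_rpow (by positivity) (by norm_num)]
  gcongr ?_ + ?_ + ?_
  · rw [Real.volume_ball, ← ENNReal.ofReal_ofNat 2, ← ENNReal.ofReal_mul (by positivity),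
      ← ENNReal.ofReal_mul (by positivity)]
    refine ENNReal.ofReal_le_ofReal (le_of_eq ?_)
    field_simp
    ring
  · rw [← ENNReal.ofReal_mul (by positivity)]
    refine ENNReal.ofReal_le_ofReal (le_of_eq ?_)
    have : (4 * l ^ 2) ^ (-3 / 2 + 1 : ℝ) = 1 / (2 * l) := by
      rw [show (4 : ℝ) * l ^ 2 = (2 * l) ^ (2:ℝ) by norm_cast; ring,
        ← Real.rpow_mul (by positivity)]
      norm_num [Real.rpow_neg_one]
    rw [this]
    field_simp
    norm_num
  · have hv : volume M ≤ ENNReal.ofReal (4 * l ^ 2) := by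
      refine (measure_union_le _ _).trans ?_
      rw [Real.volume_Icc, Real.volume_Icc, ← ENNReal.ofReal_add (by linarith) (by linarith)]
      exact ENNReal.ofReal_le_ofReal (by linarith)
    refine (mul_le_mul_right hv _).trans ?_
    rw [← ENNReal.ofReal_mul (by positivity)]
    refine ENNReal.ofReal_le_ofReal (le_of_eq ?_)
    field_simp

end hormander

section plancherel

open scoped FourierTransform SchwartzMap

variable {V : Type*} [NormedAddCommGroup V] [InnerProductSpace ℝ V] [FiniteDimensional ℝ V]
  [MeasurableSpace V] [BorelSpace V]

theorem continuous_fourier_of_integrable {f : V → ℂ} (hf : Integrable f) : Continuous (𝓕 f) :=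
  VectorFourier.fourierIntegral_continuous Real.continuous_fourierChar continuous_inner hf

/-- Plancherel's theorem for the Fourier integral of functions in `L¹ ∩ L²`. -/
theorem lintegral_enorm_fourier_sq {f : V → ℂ} (hf : Integrable f) (hf2 : MemLp f 2) :
    ∫⁻ ξ, ‖𝓕 f ξ‖ₑ ^ 2 = ∫⁻ x, ‖f x‖ₑ ^ 2 := by
  set F : Lp ℂ 2 (volume : Measure V) := hf2.toLp f
  have hF : ∀ᵐ x, F x = f x := hf2.coeFn_toLp
  have hae : ∀ᵐ ξ, 𝓕 f ξ = (𝓕 F : Lp ℂ 2 (volume : Measure V)) ξ := by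
    refine ae_eq_of_integral_contDiff_smul_eq
      (continuous_fourier_of_integrable hf).locallyIntegrable
      ((Lp.memLp (𝓕 F)).locallyIntegrable (by norm_num)) fun g hg hgs => ?_
    have hs1 : HasCompactSupport (Complex.ofRealCLM ∘ g) := hgs.comp_left rfl
    have hs2 : ContDiff ℝ (⊤ : ℕ∞) (Complex.ofRealCLM ∘ g) := by fun_prop
    set ψ : 𝓢(V, ℂ) := hs1.toSchwartzMap hs2
    have h1 := DFunLike.congr_fun (Lp.fourier_toTemperedDistribution_eq F) ψ
    rw [TemperedDistribution.fourier_apply, Lp.toTemperedDistribution_apply,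
      Lp.toTemperedDistribution_apply] at h1
    have h2 := VectorFourier.integral_fourierIntegral_smul_eq_flip (L := innerₗ V)
      Real.continuous_fourierChar continuous_inner (ψ.integrable (μ := volume)) hf
    have h3 : ∀ h : V → ℂ, ∫ x, g x • h x = ∫ x, ψ x • h x := fun h =>
      integral_congr_ae (ae_of_all _ fun x => by simp [ψ])
    rw [h3, h3, ← h1]
    have h4 : ∫ x, (𝓕 ψ) x • F x = ∫ x, (𝓕 ψ) x • f x :=
      integral_congr_ae (by filter_upwards [hF] with x hx; rw [hx])
    rw [h4]
    have hflip : (innerₗ V).flip = innerₗ V := by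
      ext x y
      exact real_inner_comm _ _
    rw [hflip] at h2
    exact h2.symm
  have h5 : ∀ G : Lp ℂ 2 (volume : Measure V), ∫⁻ x, ‖G x‖ₑ ^ 2 = ‖G‖ₑ ^ 2 := fun G => by
    have := eLpNorm_nnreal_pow_eq_lintegral (f := G) (μ := volume) (p := 2) two_ne_zero
    rw [Lp.enorm_def]
    norm_cast at this
    simpa using this.symm
  calc ∫⁻ ξ, ‖𝓕 f ξ‖ₑ ^ 2 = ∫⁻ ξ, ‖(𝓕 F : Lp ℂ 2 (volume : Measure V)) ξ‖ₑ ^ 2 :=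
        lintegral_congr_ae (by filter_upwards [hae] with x hx; rw [hx])
    _ = ∫⁻ ξ, ‖F ξ‖ₑ ^ 2 := by
        rw [h5, h5, ← ofReal_norm, ← ofReal_norm, Lp.norm_fourier_eq]
    _ = _ := lintegral_congr_ae (by filter_upwards [hF] with x hx; rw [hx])

end plancherel

section heat_kernel_fourier

open scoped FourierTransform

/-- The Fourier transform turns line derivatives into multiplication. -/
theorem fourier_hasLineDerivAt {V : Type*} [NormedAddCommGroup V] [InnerProductSpace ℝ V]
    [FiniteDimensional ℝ V] [MeasurableSpace V] [BorelSpace V] {f f' : V → ℂ} {v : V}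
    (hf : Integrable f) (hf' : Integrable f') (h : ∀ x, HasLineDerivAt ℝ f (f' x) x v) (ξ : V) :
    𝓕 f' ξ = (2 * Real.pi * inner ℝ v ξ : ℝ) * Complex.I * 𝓕 f ξ := by
  set e : V → ℂ := fun x => Complex.exp (↑(-2 * Real.pi * inner ℝ x ξ) * Complex.I) with he
  have hec : Continuous e := by fun_prop
  have he1 : ∀ x, ‖e x‖ ≤ 1 := fun x => (Complex.norm_exp_ofReal_mul_I _).le
  have hed : ∀ x, HasLineDerivAt ℝ e (e x * (↑(-2 * Real.pi * inner ℝ v ξ) * Complex.I)) x v := by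
    intro x
    have h1 : HasDerivAt (fun t : ℝ => -2 * Real.pi * inner ℝ (x + t • v) ξ)
        (-2 * Real.pi * inner ℝ v ξ) 0 := by
      simp only [inner_add_left, inner_smul_left]
      simpa using (((hasDerivAt_id (0:ℝ)).mul_const (inner ℝ v ξ)).const_add
        (inner ℝ x ξ)).const_mul (-2 * Real.pi)
    have h2 := (h1.ofReal_comp.mul_const Complex.I).cexp
    simpa [HasLineDerivAt, he] using h2
  have hInt : ∀ {g : V → ℂ}, Integrable g → Integrable fun x => g x * e x := fun hg =>
    hg.mul_bdd (c := 1) hec.aestronglyMeasurable (ae_of_all _ he1)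
  have key := integral_bilinear_hasLineDerivAt_right_eq_neg_left_of_integrable (μ := volume)
    (B := ContinuousLinearMap.mul ℝ ℂ) (f := f) (f' := f') (g := e) (v := v)
    (hInt hf') (by
      simp only [ContinuousLinearMap.mul_apply', ← mul_assoc]
      exact ((hInt hf).mul_const _).mul_const _) (hInt hf) (fun x _ => h x) (fun x _ => hed x)
  simp only [ContinuousLinearMap.mul_apply', ← mul_assoc] at key
  rw [integral_mul_const, integral_mul_const] at key
  have hF : ∀ g : V → ℂ, 𝓕 g ξ = ∫ x, g x * e x := fun g => by
    rw [Real.fourier_eq']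
    simp [he, mul_comm]
  rw [hF, hF, ← neg_eq_iff_eq_neg.2 key]
  push_cast
  ring

variable {n : ℕ}

/-- The first spatial derivative `∂ᵢ` of the heat kernel. -/
noncomputable def heatGrad (i : Fin n) (x : EuclideanSpace ℝ (Fin n)) (s : ℝ) : ℝ :=
  -(x i / (2 * s)) * heatKernel x s

theorem hasLineDerivAt_heatKernel (i : Fin n) (x : EuclideanSpace ℝ (Fin n)) {s : ℝ} (hs : 0 < s) :
    HasLineDerivAt ℝ (fun x => heatKernel x s) (heatGrad i x s) x (EuclideanSpace.single i 1) := by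
  have := hasDerivAt_heatKernel x (EuclideanSpace.single i 1) (s := s) (r := 0) (θ := 0) (by simpa)
  simpa [HasLineDerivAt, heatLogDeriv, heatGrad, EuclideanSpace.inner_single_right] using this

theorem hasLineDerivAt_heatGrad (i j : Fin n) (x : EuclideanSpace ℝ (Fin n)) {s : ℝ} (hs : 0 < s) :
    HasLineDerivAt ℝ (fun x => heatGrad i x s) (heatHess i j x s) x
      (EuclideanSpace.single j 1) := by
  have h1 : HasDerivAt (fun θ : ℝ => -((x + θ • EuclideanSpace.single j (1:ℝ)) i / (2 * s)))
      (-((if i = j then 1 else 0) / (2 * s))) 0 := by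
    have := ((((hasDerivAt_id (0:ℝ)).mul_const ((EuclideanSpace.single j (1:ℝ)) i)).const_add
      (x i)).div_const (2 * s)).fun_neg
    simpa [Pi.single_apply] using this
  have h2 := h1.mul (hasLineDerivAt_heatKernel j x hs)
  refine h2.congr_deriv ?_
  simp only [heatHess, heatHessFactor, heatGrad, zero_smul, add_zero]
  field_simp
  ring

theorem measurable_heatKernel :
    Measurable fun z : EuclideanSpace ℝ (Fin n) × ℝ => heatKernel z.1 z.2 :=
  (measurable_gaussian _).const_mul _

theorem measurable_heatGrad (i : Fin n) :
    Measurable fun z : EuclideanSpace ℝ (Fin n) × ℝ => heatGrad i z.1 z.2 := by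
  unfold heatGrad
  have := measurable_heatKernel (n := n)
  fun_prop

theorem integrable_heatHess (i j : Fin n) {s : ℝ} (hs : 0 < s) :
    Integrable fun x => heatHess i j x s :=
  ⟨((measurable_heatHess i j).comp measurable_prodMk_right).aestronglyMeasurable,
    (lintegral_enorm_heatHess_le i j hs).trans_lt ENNReal.ofReal_lt_top⟩

theorem integrable_heatGrad (i : Fin n) {s : ℝ} (hs : 0 < s) :
    Integrable fun x => heatGrad i x s := by
  refine ((integrable_gaussian (n := n) (a := 1 / 8) (by norm_num) hs).const_mul
    ((s + 1) / (4 * s) * 256)).mono'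
    ((measurable_heatGrad i).comp measurable_prodMk_right).aestronglyMeasurable
    (ae_of_all _ fun x => ?_)
  have hi : |x i| ≤ ‖x‖ := PiLp.norm_apply_le x i
  have h1 : 2 * ‖x‖ ≤ (s + 1) * (1 + ‖x‖ ^ 2 / s) := by
    have : 2 * ‖x‖ ≤ s + ‖x‖ ^ 2 / s := by
      rw [← sub_nonneg]
      have : s + ‖x‖ ^ 2 / s - 2 * ‖x‖ = (s - ‖x‖) ^ 2 / s := by field_simp; ring
      rw [this]
      positivity
    have h0 : 0 ≤ s * (‖x‖ ^ 2 / s) := by positivity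
    nlinarith
  have h2 : 0 ≤ ‖x‖ ^ 2 / s := by positivity
  rw [heatGrad, Real.norm_eq_abs, abs_mul, abs_neg, abs_div,
    abs_of_nonneg (heatKernel_nonneg x hs.le),
    abs_of_pos (by positivity : 0 < 2 * s)]
  calc |x i| / (2 * s) * heatKernel x s
      ≤ ((s + 1) * (1 + ‖x‖ ^ 2 / s) ^ 2) / (4 * s) * gaussian (1 / 4) x s := by
        have h3 : |x i| / (2 * s) ≤ ((s + 1) * (1 + ‖x‖ ^ 2 / s) ^ 2) / (4 * s) := by
          rw [div_le_div_iff₀ (by positivity) (by positivity)]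
          have : (s + 1) * (1 + ‖x‖ ^ 2 / s) ≤ (s + 1) * (1 + ‖x‖ ^ 2 / s) ^ 2 := by
            gcongr
            nlinarith
          nlinarith
        have := heatKernel_le_gaussian x hs.le
        have := heatKernel_nonneg x hs.le
        have := gaussian_nonneg (1 / 4) x hs.le
        gcongr
    _ = (s + 1) / (4 * s) * ((1 + ‖x‖ ^ 2 / s) ^ 2 * gaussian (1 / 4) x s) := by ring
    _ ≤ (s + 1) / (4 * s) * (256 * gaussian (1 / 8) x s) := by
        gcongr ?_ * ?_
        exact mul_gaussian_le x hs
    _ = _ := by ring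

theorem fourier_heatKernel {s : ℝ} (hs : 0 < s) (ξ : EuclideanSpace ℝ (Fin n)) :
    𝓕 (fun x : EuclideanSpace ℝ (Fin n) => (heatKernel x s : ℂ)) ξ =
      (Real.exp (-(4 * Real.pi ^ 2 * s * ‖ξ‖ ^ 2)) : ℝ) := by
  have hb : 0 < (1 / (4 * s) : ℝ) := by positivity
  have h1 := fourier_gaussian_innerProductSpace (b := ((1 / (4 * s) : ℝ) : ℂ)) (by simpa using hb) ξ
  have h2 : (fun x : EuclideanSpace ℝ (Fin n) => (heatKernel x s : ℂ)) =
      fun x => (((4 * Real.pi) ^ (-(n / 2 : ℝ)) * s ^ (-(n / 2 : ℝ)) : ℝ) : ℂ) *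
        Complex.exp (-((1 / (4 * s) : ℝ) : ℂ) * ‖x‖ ^ 2) := by
    ext x
    rw [heatKernel, gaussian, ← mul_assoc, Complex.ofReal_mul, Complex.ofReal_exp]
    congr 2
    push_cast
    field_simp
  have h3 : ∀ (c : ℂ) (f : EuclideanSpace ℝ (Fin n) → ℂ), 𝓕 (fun x => c * f x) ξ = c * 𝓕 f ξ := by
    intro c f
    simp only [Real.fourier_eq', smul_eq_mul]
    rw [← integral_const_mul]
    congr 1
    ext x
    ring
  rw [h2, h3, h1, finrank_euclideanSpace_fin]
  have h4 : ((Real.pi : ℂ) / ((1 / (4 * s) : ℝ) : ℂ)) ^ (n / 2 : ℂ) =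
      (((4 * Real.pi * s) ^ (n / 2 : ℝ) : ℝ) : ℂ) := by
    rw [Complex.ofReal_cpow (by positivity)]
    push_cast
    congr 1
    field_simp
  rw [h4, ← mul_assoc, ← Complex.ofReal_mul, ← Real.mul_rpow (by positivity) hs.le,
    ← Real.rpow_add (by positivity), neg_add_cancel, Real.rpow_zero, Complex.ofReal_one, one_mul,
    Complex.ofReal_exp]
  congr 1
  push_cast
  field_simp

theorem fourier_heatHess (i j : Fin n) {s : ℝ} (hs : 0 < s) (ξ : EuclideanSpace ℝ (Fin n)) :
    𝓕 (fun x => (heatHess i j x s : ℂ)) ξ =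
      (-(4 * Real.pi ^ 2 * (ξ i * ξ j)) * Real.exp (-(4 * Real.pi ^ 2 * s * ‖ξ‖ ^ 2)) : ℝ) := by
  have h1 := fourier_hasLineDerivAt (f := fun x => (heatGrad i x s : ℂ))
    (f' := fun x => (heatHess i j x s : ℂ)) (integrable_heatGrad i hs).ofReal
    (integrable_heatHess i j hs).ofReal
    (fun x => HasDerivAt.ofReal_comp (hasLineDerivAt_heatGrad i j x hs)) ξ
  have h2 := fourier_hasLineDerivAt (f := fun x => (heatKernel x s : ℂ))
    (f' := fun x => (heatGrad i x s : ℂ)) (integrable_heatKernel hs).ofReal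
    (integrable_heatGrad i hs).ofReal
    (fun x => HasDerivAt.ofReal_comp (hasLineDerivAt_heatKernel i x hs)) ξ
  rw [h1, h2, fourier_heatKernel hs]
  simp only [EuclideanSpace.inner_single_left]
  push_cast
  ring_nf
  simp

theorem enorm_fourier_heatHess_le (i j : Fin n) {s : ℝ} (hs : 0 < s)
    (ξ : EuclideanSpace ℝ (Fin n)) :
    ‖𝓕 (fun x => (heatHess i j x s : ℂ)) ξ‖ₑ ≤ ENNReal.ofReal
      (4 * Real.pi ^ 2 * ‖ξ‖ ^ 2 * Real.exp (-(4 * Real.pi ^ 2 * ‖ξ‖ ^ 2 * s))) := by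
  have hi : |ξ i| ≤ ‖ξ‖ := PiLp.norm_apply_le ξ i
  have hj : |ξ j| ≤ ‖ξ‖ := PiLp.norm_apply_le ξ j
  rw [fourier_heatHess i j hs, ← ofReal_norm, Complex.norm_real, Real.norm_eq_abs, abs_mul,
    Real.abs_exp, abs_neg, abs_mul, abs_mul (ξ i),
    abs_of_nonneg (by positivity : 0 ≤ 4 * Real.pi ^ 2)]
  refine ENNReal.ofReal_le_ofReal ?_
  rw [show 4 * Real.pi ^ 2 * s * ‖ξ‖ ^ 2 = 4 * Real.pi ^ 2 * ‖ξ‖ ^ 2 * s by ring, sq ‖ξ‖]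
  gcongr

theorem lintegral_mul_exp_le {a : ℝ} (ha : 0 ≤ a) :
    ∫⁻ s in Set.Ioi (0:ℝ), ENNReal.ofReal (a * Real.exp (-(a * s))) ≤ 1 := by
  rcases ha.eq_or_lt with rfl | ha
  · simp
  have h := integral_exp_mul_Ioi (neg_lt_zero.2 ha) 0
  have hi := integrableOn_exp_mul_Ioi (neg_lt_zero.2 ha) 0
  simp only [ENNReal.ofReal_mul ha.le]
  rw [lintegral_const_mul' _ _ ENNReal.ofReal_ne_top,
    ← ofReal_integral_eq_lintegral_ofReal (by simpa [neg_mul, IntegrableOn] using hi)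
      (ae_of_all _ fun _ => (Real.exp_pos _).le)]
  simp only [neg_mul] at h
  rw [h, ← ENNReal.ofReal_mul ha.le]
  simp [ha.ne']

end heat_kernel_fourier

section heat_l2

open scoped FourierTransform

theorem memLp_two_of_integrable_of_bounded {α : Type*} [MeasurableSpace α] {μ : Measure α}
    {f : α → ℂ} (hf : Integrable f μ) {M : ℝ} (hM : ∀ x, ‖f x‖ ≤ M) : MemLp f 2 μ := by
  rw [memLp_two_iff_integrable_sq_norm hf.aestronglyMeasurable]
  simp only [sq]
  exact hf.norm.mul_bdd (c := M) hf.norm.aestronglyMeasurable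
    (ae_of_all _ fun x => by simpa using hM x)

/-- Jensen's inequality for the square and a measure with density of mass at most one. -/
theorem lintegral_mul_sq_le {α : Type*} [MeasurableSpace α] {μ : Measure α} {m h : α → ℝ≥0∞}
    (hm : AEMeasurable m μ) (hh : AEMeasurable h μ) (h1 : ∫⁻ a, m a ∂μ ≤ 1) :
    (∫⁻ a, m a * h a ∂μ) ^ 2 ≤ ∫⁻ a, m a * h a ^ 2 ∂μ := by
  have hsq : ∀ c : ℝ≥0∞, (c ^ (1 / 2 : ℝ)) ^ (2 : ℝ) = c := fun c => by
    rw [← ENNReal.rpow_mul]; simp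
  have key := ENNReal.lintegral_mul_le_Lp_mul_Lq μ Real.HolderConjugate.two_two
    (hm.pow_const (1 / 2 : ℝ)) ((hm.pow_const (1 / 2 : ℝ)).mul hh)
  simp only [Pi.mul_apply, ← mul_assoc, ENNReal.mul_rpow_of_nonneg _ _ (by norm_num : (0:ℝ) ≤ 2),
    hsq] at key
  have e : ∀ a, m a ^ (1 / 2 : ℝ) * m a ^ (1 / 2 : ℝ) = m a := fun a => by
    rw [← ENNReal.rpow_add_of_nonneg _ _ (by norm_num) (by norm_num)]; norm_num
  simp only [e] at key
  calc (∫⁻ a, m a * h a ∂μ) ^ 2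
      ≤ ((∫⁻ a, m a ∂μ) ^ (1 / 2 : ℝ) * (∫⁻ a, m a * h a ^ (2:ℝ) ∂μ) ^ (1 / 2 : ℝ)) ^ 2 := by
        gcongr
    _ = (∫⁻ a, m a ∂μ) * ∫⁻ a, m a * h a ^ (2:ℝ) ∂μ := by
        rw [← ENNReal.rpow_natCast, ENNReal.mul_rpow_of_nonneg _ _ (by norm_num), Nat.cast_ofNat,
          hsq, hsq]
    _ ≤ 1 * ∫⁻ a, m a * h a ^ (2:ℝ) ∂μ := by gcongr
    _ = _ := by simp

variable {n : ℕ} {k g : EuclideanSpace ℝ (Fin n) × ℝ → ℝ}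

theorem integrable_slice_convolution_integrand (hk : Measurable k) {C : ℝ≥0∞} (hC : C ≠ ∞)
    (hkC : ∀ s, ∫⁻ x, ‖k (x, s)‖ₑ ≤ C) (hg : Integrable g) (hgm : Measurable g) (t : ℝ) :
    Integrable (Function.uncurry fun (x : EuclideanSpace ℝ (Fin n))
      (w : EuclideanSpace ℝ (Fin n) × ℝ) => k ((x, t) - w) * g w) (volume.prod volume) := by
  have hm : Measurable (Function.uncurry fun (x : EuclideanSpace ℝ (Fin n))
      (w : EuclideanSpace ℝ (Fin n) × ℝ) => k ((x, t) - w) * g w) := by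
    unfold Function.uncurry
    exact (hk.comp ((measurable_fst.prodMk measurable_const).sub measurable_snd)).mul
      (hgm.comp measurable_snd)
  refine ⟨hm.aestronglyMeasurable, ?_⟩
  rw [HasFiniteIntegral, lintegral_prod_symm _ hm.enorm.aemeasurable]
  calc ∫⁻ w, ∫⁻ x, ‖k ((x, t) - w) * g w‖ₑ
      ≤ ∫⁻ w, C * ‖g w‖ₑ := by
        refine lintegral_mono fun w => ?_
        simp only [enorm_mul]
        rw [lintegral_mul_const' _ _ enorm_ne_top]
        gcongr
        refine le_of_eq_of_le ?_ (hkC (t - w.2))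
        exact lintegral_sub_right_eq_self (fun x => ‖k (x, t - w.2)‖ₑ) w.1
    _ < ∞ := by
        rw [lintegral_const_mul' _ _ hC]
        exact ENNReal.mul_lt_top hC.lt_top hg.2

theorem enorm_fourier_slice_convolution_le (hk : Measurable k) {C : ℝ≥0∞} (hC : C ≠ ∞)
    (hkC : ∀ s, ∫⁻ x, ‖k (x, s)‖ₑ ≤ C) (hg : Integrable g) (hgm : Measurable g) (t : ℝ)
    (ξ : EuclideanSpace ℝ (Fin n)) :
    ‖𝓕 (fun x : EuclideanSpace ℝ (Fin n) => ((∫ w, k ((x, t) - w) * g w : ℝ) : ℂ)) ξ‖ₑ ≤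
      ∫⁻ s, ‖𝓕 (fun x => (k (x, t - s) : ℂ)) ξ‖ₑ * ‖𝓕 (fun x => (g (x, s) : ℂ)) ξ‖ₑ := by
  set e : EuclideanSpace ℝ (Fin n) → ℂ :=
    fun x => Complex.exp (↑(-2 * Real.pi * inner ℝ x ξ) * Complex.I) with he
  have hec : Continuous e := by fun_prop
  have he1 : ∀ x, ‖e x‖ ≤ 1 := fun x => (Complex.norm_exp_ofReal_mul_I _).le
  have hF : ∀ h : EuclideanSpace ℝ (Fin n) → ℂ, 𝓕 h ξ = ∫ x, e x * h x := fun h => by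
    rw [Real.fourier_eq']
    simp [he]
  have headd : ∀ x y, e (x + y) = e y * e x := fun x y => by
    simp only [he]
    rw [← Complex.exp_add, inner_add_left]
    congr 1
    push_cast
    ring
  clear_value e
  have hInt : Integrable (Function.uncurry fun (x : EuclideanSpace ℝ (Fin n))
      (w : EuclideanSpace ℝ (Fin n) × ℝ) => e x * ((k ((x, t) - w) : ℂ) * (g w : ℂ)))
      (volume.prod volume) := by
    have h1 := (integrable_slice_convolution_integrand hk hC hkC hg hgm t).ofReal (𝕜 := ℂ)
    have h2 : AEStronglyMeasurable
        (fun p : EuclideanSpace ℝ (Fin n) × (EuclideanSpace ℝ (Fin n) × ℝ) => e p.1)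
        (volume.prod volume) := (hec.measurable.comp measurable_fst).aestronglyMeasurable
    refine (h1.bdd_mul (c := 1) h2 (ae_of_all _ fun p => he1 p.1)).congr (ae_of_all _ fun p => ?_)
    simp [Function.uncurry]
  have hw : ∀ w : EuclideanSpace ℝ (Fin n) × ℝ, ∫ x, e x * ((k ((x, t) - w) : ℂ) * (g w : ℂ)) =
      𝓕 (fun x => (k (x, t - w.2) : ℂ)) ξ * (e w.1 * (g w : ℂ)) := fun w => by
    rw [hF, ← integral_mul_const]
    refine Eq.trans ?_ (integral_sub_right_eq_self
      (fun x => e x * (k (x, t - w.2) : ℂ) * (e w.1 * (g w : ℂ))) w.1)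
    congr 1
    ext x
    have h1 : e x = e w.1 * e (x - w.1) := by rw [← headd, sub_add_cancel]
    have h2 : (x, t) - w = (x - w.1, t - w.2) := rfl
    rw [h1, h2]
    ring
  have h1 : 𝓕 (fun x : EuclideanSpace ℝ (Fin n) => ((∫ w, k ((x, t) - w) * g w : ℝ) : ℂ)) ξ =
      ∫ w : EuclideanSpace ℝ (Fin n) × ℝ,
        𝓕 (fun x => (k (x, t - w.2) : ℂ)) ξ * (e w.1 * (g w : ℂ)) := by
    rw [hF]
    calc _ = ∫ x, ∫ w, e x * ((k ((x, t) - w) : ℂ) * (g w : ℂ)) := by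
          congr 1
          ext x
          rw [integral_const_mul, ← integral_complex_ofReal]
          simp
      _ = ∫ w, ∫ x, e x * ((k ((x, t) - w) : ℂ) * (g w : ℂ)) := integral_integral_swap hInt
      _ = _ := by simp only [hw]
  have hInt₂ : Integrable (fun w : EuclideanSpace ℝ (Fin n) × ℝ =>
      𝓕 (fun x => (k (x, t - w.2) : ℂ)) ξ * (e w.1 * (g w : ℂ))) :=
    hInt.integral_prod_right.congr (ae_of_all _ fun w => hw w)
  rw [h1, Measure.volume_eq_prod, integral_prod_symm _ hInt₂]
  refine (enorm_integral_le_lintegral_enorm _).trans (lintegral_mono fun s => ?_)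
  simp only
  rw [integral_const_mul, ← hF (fun x => (g (x, s) : ℂ)), enorm_mul]

theorem measurable_fourier_slice {g : EuclideanSpace ℝ (Fin n) × ℝ → ℝ} (hg : Measurable g) :
    Measurable fun p : EuclideanSpace ℝ (Fin n) × ℝ => 𝓕 (fun x => (g (x, p.2) : ℂ)) p.1 := by
  simp only [Real.fourier_eq']
  refine (StronglyMeasurable.integral_prod_right'
    (f := fun q : (EuclideanSpace ℝ (Fin n) × ℝ) × EuclideanSpace ℝ (Fin n) =>
      Complex.exp (↑(-2 * Real.pi * inner ℝ q.2 q.1.1) * Complex.I) • (g (q.2, q.1.2) : ℂ))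
    (Measurable.stronglyMeasurable ?_)).measurable
  have h1 : Measurable fun q : (EuclideanSpace ℝ (Fin n) × ℝ) × EuclideanSpace ℝ (Fin n) =>
      (g (q.2, q.1.2) : ℂ) := by fun_prop
  have h2 : Measurable fun q : (EuclideanSpace ℝ (Fin n) × ℝ) × EuclideanSpace ℝ (Fin n) =>
      Complex.exp (↑(-2 * Real.pi * inner ℝ q.2 q.1.1) * Complex.I) := by
    refine Continuous.measurable ?_
    fun_prop
  exact h2.smul h1

theorem lintegral_enorm_truncHess_conv_sq_le (i j : Fin n) {ε : ℝ} (hε : 0 < ε) (N : ℝ)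
    (hg : Integrable g) (hgm : Measurable g) {M : ℝ} (hM : ∀ z, |g z| ≤ M) :
    ∫⁻ z, ‖∫ w, truncHess i j ε N (z - w) * g w‖ₑ ^ 2 ≤ ∫⁻ z, ‖g z‖ₑ ^ 2 := by
  set k := truncHess i j ε N with hk_def
  have hk := measurable_truncHess i j ε N
  have hki := integrable_truncHess i j hε N
  set C := ENNReal.ofReal (256 * (8 * Real.pi) ^ (n / 2 : ℝ) / ε)
  have hkC : ∀ s, ∫⁻ x, ‖k (x, s)‖ₑ ≤ C := fun s => by
    by_cases h : s ∈ Set.Ioc ε N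
    · simp only [hk_def, truncHess_of_mem h]
      refine (lintegral_enorm_heatHess_le i j (hε.trans h.1)).trans (ENNReal.ofReal_le_ofReal ?_)
      have := h.1.le
      gcongr
    · simp [hk_def, truncHess_of_notMem h]
  have hC : C ≠ ∞ := ENNReal.ofReal_ne_top
  set T : EuclideanSpace ℝ (Fin n) × ℝ → ℝ := fun z => ∫ w, k (z - w) * g w with hT
  have hTm : Measurable T := measurable_integral_sub_mul hk hgm
  set m : EuclideanSpace ℝ (Fin n) → ℝ → ℝ≥0∞ := fun ξ => (Set.Ioi (0:ℝ)).indicator fun s =>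
    ENNReal.ofReal (4 * Real.pi ^ 2 * ‖ξ‖ ^ 2 * Real.exp (-(4 * Real.pi ^ 2 * ‖ξ‖ ^ 2 * s)))
    with hm_def
  have hmm : Measurable (Function.uncurry m) := by
    have : Function.uncurry m = (Set.univ ×ˢ Set.Ioi (0:ℝ)).indicator fun p =>
        ENNReal.ofReal (4 * Real.pi ^ 2 * ‖p.1‖ ^ 2 *
          Real.exp (-(4 * Real.pi ^ 2 * ‖p.1‖ ^ 2 * p.2))) := by
      ext ⟨ξ, s⟩
      simp [Function.uncurry, hm_def, Set.indicator]
    rw [this]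
    refine Measurable.indicator ?_ (MeasurableSet.univ.prod measurableSet_Ioi)
    fun_prop
  have hm1 : ∀ ξ, ∫⁻ s, m ξ s ≤ 1 := fun ξ => by
    rw [lintegral_indicator measurableSet_Ioi]
    exact lintegral_mul_exp_le (by positivity)
  have hmξ : ∀ ξ, Measurable (m ξ) := fun ξ => hmm.comp measurable_prodMk_left
  have hkm : ∀ ξ s, ‖𝓕 (fun x => (k (x, s) : ℂ)) ξ‖ₑ ≤ m ξ s := fun ξ s => by
    by_cases h : s ∈ Set.Ioc ε N
    · have hs : 0 < s := hε.trans h.1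
      simp only [hk_def, truncHess_of_mem h, hm_def, Set.indicator_of_mem (Set.mem_Ioi.2 hs)]
      exact enorm_fourier_heatHess_le i j hs ξ
    · simp [hk_def, truncHess_of_notMem h, Real.fourier_eq']
  set h : EuclideanSpace ℝ (Fin n) × ℝ → ℝ≥0∞ :=
    fun p => ‖𝓕 (fun x => (g (x, p.2) : ℂ)) p.1‖ₑ with h_def
  have hhm : Measurable h := (measurable_fourier_slice hgm).enorm
  have hslice : ∀ t, ∫⁻ x, ‖T (x, t)‖ₑ ^ 2 ≤ ∫⁻ ξ, ∫⁻ s, m ξ (t - s) * h (ξ, s) ^ 2 := fun t => by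
    have hi : Integrable fun x => (T (x, t) : ℂ) :=
      (integrable_slice_convolution_integrand hk hC hkC hg hgm t).integral_prod_left.ofReal
    have hb : ∃ M', ∀ x, ‖(T (x, t) : ℂ)‖ ≤ M' :=
      ⟨_, fun x => by simpa using abs_integral_sub_mul_le hki hM (x, t)⟩
    obtain ⟨M', hM'⟩ := hb
    have h1 := lintegral_enorm_fourier_sq hi (memLp_two_of_integrable_of_bounded hi hM')
    have h2 : ∀ x, ‖(T (x, t) : ℂ)‖ₑ = ‖T (x, t)‖ₑ := fun x => by
      rw [← ofReal_norm, ← ofReal_norm, Complex.norm_real]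
    simp only [h2] at h1
    rw [← h1]
    refine lintegral_mono fun ξ => ?_
    refine le_trans ?_ (lintegral_mul_sq_le (m := fun s => m ξ (t - s)) (h := fun s => h (ξ, s))
      ((hmξ ξ).comp (measurable_const.sub measurable_id)).aemeasurable
      (hhm.comp measurable_prodMk_left).aemeasurable ?_)
    · gcongr
      refine (enorm_fourier_slice_convolution_le hk hC hkC hg hgm t ξ).trans
        (lintegral_mono fun s => ?_)
      exact mul_le_mul_left (hkm ξ (t - s)) _
    · rw [lintegral_sub_left_eq_self (fun s => m ξ s) t]
      exact hm1 ξ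
  have hPm : Measurable fun q : (ℝ × EuclideanSpace ℝ (Fin n)) × ℝ =>
      m q.1.2 (q.1.1 - q.2) * h (q.1.2, q.2) ^ 2 := by
    have a : Measurable fun q : (ℝ × EuclideanSpace ℝ (Fin n)) × ℝ => m q.1.2 (q.1.1 - q.2) :=
      hmm.comp (g := Function.uncurry m) (f := fun q : (ℝ × EuclideanSpace ℝ (Fin n)) × ℝ =>
        (q.1.2, q.1.1 - q.2)) (by fun_prop)
    fun_prop
  have hmt : ∀ s ξ, ∫⁻ t, m ξ (t - s) ≤ 1 := fun s ξ => by
    rw [lintegral_sub_right_eq_self (fun t => m ξ t) s]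
    exact hm1 ξ
  calc ∫⁻ z, ‖T z‖ₑ ^ 2 = ∫⁻ t, ∫⁻ x, ‖T (x, t)‖ₑ ^ 2 := by
        rw [Measure.volume_eq_prod, lintegral_prod_symm _ (by fun_prop)]
    _ ≤ ∫⁻ t, ∫⁻ ξ, ∫⁻ s, m ξ (t - s) * h (ξ, s) ^ 2 := lintegral_mono hslice
    _ = ∫⁻ ξ, ∫⁻ t, ∫⁻ s, m ξ (t - s) * h (ξ, s) ^ 2 :=
        lintegral_lintegral_swap (Measurable.lintegral_prod_right' hPm).aemeasurable
    _ ≤ ∫⁻ ξ, ∫⁻ s, h (ξ, s) ^ 2 := by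
        refine lintegral_mono fun ξ => ?_
        rw [lintegral_lintegral_swap (Measurable.aemeasurable ?_)]
        · refine lintegral_mono fun s => ?_
          rw [lintegral_mul_const _ (by have := hmξ ξ; fun_prop)]
          exact mul_le_of_le_one_left zero_le (hmt s ξ)
        · exact hPm.comp (f := fun p : ℝ × ℝ => ((p.1, ξ), p.2)) (by fun_prop)
    _ = ∫⁻ s, ∫⁻ ξ, h (ξ, s) ^ 2 :=
        lintegral_lintegral_swap (f := fun ξ s => h (ξ, s) ^ 2) (hhm.pow_const 2).aemeasurable
    _ = ∫⁻ s, ∫⁻ x, ‖g (x, s)‖ₑ ^ 2 := by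
        have hg' : Integrable g (volume.prod volume) := hg
        refine lintegral_congr_ae ?_
        filter_upwards [hg'.prod_left_ae] with s hs
        have h1 := lintegral_enorm_fourier_sq hs.ofReal
          (memLp_two_of_integrable_of_bounded (M := M) hs.ofReal fun x => by simpa using hM (x, s))
        have h2 : ∀ x, ‖(g (x, s) : ℂ)‖ₑ = ‖g (x, s)‖ₑ := fun x => by
          rw [← ofReal_norm, ← ofReal_norm, Complex.norm_real]
        rw [← lintegral_congr fun x => congrArg (· ^ 2) (h2 x)]
        exact h1
    _ = ∫⁻ z, ‖g z‖ₑ ^ 2 := by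
        rw [Measure.volume_eq_prod, lintegral_prod_symm _ (by fun_prop)]

end heat_l2

/-- The truncated heat Hessian convolutions are bounded on `L^p`, uniformly in the truncation. -/
theorem exists_lintegral_truncHess_conv_rpow_le (n : ℕ) {p : ℝ} (hp : 1 < p) :
    ∃ C : ℝ≥0∞, C ≠ ∞ ∧ ∀ (i j : Fin n) (ε N : ℝ), 0 < ε →
      ∀ f : EuclideanSpace ℝ (Fin n) × ℝ → ℝ, Continuous f → HasCompactSupport f →
        ∫⁻ z, ‖∫ w, truncHess i j ε N (z - w) * f w‖ₑ ^ p ≤ C * ∫⁻ z, ‖f z‖ₑ ^ p := by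
  obtain ⟨C, hC, h⟩ := exists_lintegral_rpow_le n hp (A := 1)
    (B := ENNReal.ofReal (32 * (4096 * (16 * Real.pi) ^ (n / 2 : ℝ))) +
      ENNReal.ofReal (12288 * (n + 1) * 4 ^ (n / 2 : ℝ) * (32 * Real.pi) ^ (n / 2 : ℝ)) +
      ENNReal.ofReal (4 * (256 * (8 * Real.pi) ^ (n / 2 : ℝ)))) one_ne_top (by finiteness)
  refine ⟨C, hC, fun i j ε N hε f hf hfc => h _ (measurable_truncHess i j ε N)
    (exists_abs_truncHess_le i j hε N) (integrable_truncHess i j hε N)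
    (parabolicHormander_truncHess i j hε N) (fun g hg hgi ⟨M, hM⟩ => ?_) f hf
    (hf.integrable_of_hasCompactSupport hfc) (hfc.exists_bound_of_continuous hf)⟩
  rw [one_mul]
  exact lintegral_enorm_truncHess_conv_sq_le i j hε N hgi hg hM

section partial_derivatives

open scoped ContDiff

variable {n : ℕ} {g h : EuclideanSpace ℝ (Fin n) × ℝ → ℝ}

theorem ContDiff.pdx (hg : ContDiff ℝ ∞ g) (i : Fin n) : ContDiff ℝ ∞ (pdx i g) :=
  (hg.fderiv_right (m := ∞) (by simp)).clm_apply contDiff_const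

theorem ContDiff.pdt (hg : ContDiff ℝ ∞ g) : ContDiff ℝ ∞ (pdt g) :=
  (hg.fderiv_right (m := ∞) (by simp)).clm_apply contDiff_const

theorem HasCompactSupport.pdx (hg : HasCompactSupport g) (i : Fin n) :
    HasCompactSupport (pdx i g) :=
  hg.fderiv_apply ℝ _

theorem HasCompactSupport.pdt (hg : HasCompactSupport g) : HasCompactSupport (pdt g) :=
  hg.fderiv_apply ℝ _

theorem fderiv_fderiv_comm {X : Type*} [NormedAddCommGroup X] [NormedSpace ℝ X] {f : X → ℝ}
    (hf : ContDiff ℝ ∞ f) (a b z : X) :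
    fderiv ℝ (fun z => fderiv ℝ f z a) z b = fderiv ℝ (fun z => fderiv ℝ f z b) z a := by
  have hd : DifferentiableAt ℝ (fderiv ℝ f) z :=
    (hf.fderiv_right (m := ∞) (by simp)).differentiable (by simp) z
  have h : IsSymmSndFDerivAt ℝ f z :=
    hf.contDiffAt.isSymmSndFDerivAt (by simpa using ENat.LEInfty.out)
  rw [fderiv_clm_apply hd (by fun_prop), fderiv_clm_apply hd (by fun_prop)]
  simpa using h b a

theorem pdx_pdx_comm (hg : ContDiff ℝ ∞ g) (i j : Fin n) : pdx j (pdx i g) = pdx i (pdx j g) :=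
  funext fun z => fderiv_fderiv_comm hg _ _ z

theorem pdx_pdt_comm (hg : ContDiff ℝ ∞ g) (i : Fin n) : pdx i (pdt g) = pdt (pdx i g) :=
  funext fun z => fderiv_fderiv_comm hg _ _ z

/-- The heat operator `∂ₜ - Δ`. -/
noncomputable def heatOp (g : EuclideanSpace ℝ (Fin n) × ℝ → ℝ) :
    EuclideanSpace ℝ (Fin n) × ℝ → ℝ :=
  fun z => pdt g z - lapP g z

theorem ContDiff.heatOp (hg : ContDiff ℝ ∞ g) : ContDiff ℝ ∞ (heatOp g) :=
  hg.pdt.sub (ContDiff.sum fun i _ => (hg.pdx i).pdx i)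

theorem HasCompactSupport.lapP (hg : HasCompactSupport g) :
    HasCompactSupport (_root_.lapP g) := by
  have : _root_.lapP g = ∑ i, _root_.pdx i (_root_.pdx i g) := by
    ext z; simp [_root_.lapP, hessEntryP]
  rw [this]
  refine HasCompactSupport.intro hg fun z hz => ?_
  rw [Finset.sum_apply]
  refine Finset.sum_eq_zero fun i _ => image_eq_zero_of_notMem_tsupport fun hz' => hz ?_
  exact tsupport_fderiv_apply_subset ℝ _ (tsupport_fderiv_apply_subset ℝ _ hz')

theorem HasCompactSupport.heatOp (hg : HasCompactSupport g) : HasCompactSupport (heatOp g) :=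
  hg.pdt.sub hg.lapP

theorem pdx_heatOp (hg : ContDiff ℝ ∞ g) (i : Fin n) : pdx i (heatOp g) = heatOp (pdx i g) := by
  ext z
  have h1 : DifferentiableAt ℝ (pdt g) z := hg.pdt.differentiable (by simp) z
  have h2 : ∀ k, DifferentiableAt ℝ (pdx k (pdx k g)) z := fun k =>
    ((hg.pdx k).pdx k).differentiable (by simp) z
  have h3 : heatOp g = pdt g - ∑ k, pdx k (pdx k g) := by
    ext z; simp [heatOp, lapP, hessEntryP]
  have h4 : pdx i (heatOp g) z = pdx i (pdt g) z - ∑ k, pdx i (pdx k (pdx k g)) z := by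
    rw [h3, pdx, fderiv_sub h1 (DifferentiableAt.sum fun k _ => h2 k),
      fderiv_sum fun k _ => h2 k]
    simp [pdx]
  rw [h4, pdx_pdt_comm hg, heatOp, lapP]
  simp only [hessEntryP]
  congr 1
  refine Finset.sum_congr rfl fun k _ => ?_
  rw [pdx_pdx_comm (hg.pdx k), pdx_pdx_comm hg]

theorem hasLineDerivAt_slice (hg : ContDiff ℝ ∞ g) (k : Fin n) (x : EuclideanSpace ℝ (Fin n))
    (t : ℝ) (y : EuclideanSpace ℝ (Fin n)) :
    HasLineDerivAt ℝ (fun y => g (x - y, t)) (-pdx k g (x - y, t)) y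
      (EuclideanSpace.single k 1) := by
  have h1 : HasDerivAt (fun θ : ℝ => (x - (y + θ • EuclideanSpace.single k (1:ℝ)), t))
      (-EuclideanSpace.single k (1:ℝ), (0:ℝ)) 0 := by
    refine HasDerivAt.prodMk ?_ (hasDerivAt_const _ _)
    simpa using (((hasDerivAt_id (0:ℝ)).smul_const (EuclideanSpace.single k (1:ℝ))).const_add
      y).const_sub x
  have h2 : HasFDerivAt g (fderiv ℝ g (x - y, t))
      (x - (y + (0:ℝ) • EuclideanSpace.single k (1:ℝ)), t) := by
    simpa using (hg.differentiable (by simp) (x - y, t)).hasFDerivAt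
  refine (h2.comp_hasDerivAt (0:ℝ) h1).congr_deriv ?_
  rw [pdx, ← map_neg]
  simp

theorem integrable_mul_slice {a : EuclideanSpace ℝ (Fin n) → ℝ} (ha : Integrable a)
    (hg : Continuous g) (hgc : HasCompactSupport g) (x : EuclideanSpace ℝ (Fin n)) (t : ℝ) :
    Integrable fun y => a y * g (x - y, t) := by
  obtain ⟨M, hM⟩ := hgc.exists_bound_of_continuous hg
  exact ha.mul_bdd (c := M) (by fun_prop) (ae_of_all _ fun y => hM _)

theorem integral_mul_slice_eq {a a' : EuclideanSpace ℝ (Fin n) → ℝ} {k : Fin n}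
    (ha : Integrable a) (ha' : Integrable a')
    (h : ∀ y, HasLineDerivAt ℝ a (a' y) y (EuclideanSpace.single k 1))
    (hg : ContDiff ℝ ∞ g) (hgc : HasCompactSupport g) (x : EuclideanSpace ℝ (Fin n)) (t : ℝ) :
    ∫ y, a' y * g (x - y, t) = ∫ y, a y * pdx k g (x - y, t) := by
  have h1 := integrable_mul_slice ha hg.continuous hgc x t
  have h2 := integrable_mul_slice ha' hg.continuous hgc x t
  have h3 := integrable_mul_slice ha (hg.pdx k).continuous (hgc.pdx k) x t
  have := integral_bilinear_hasLineDerivAt_right_eq_neg_left_of_integrable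
    (μ := volume) (B := ContinuousLinearMap.mul ℝ ℝ) (f := a) (f' := a')
    (g := fun y => g (x - y, t)) (g' := fun y => -pdx k g (x - y, t))
    (v := EuclideanSpace.single k (1:ℝ)) (by simpa using h2) (by simpa using h3.neg)
    (by simpa using h1) (fun y _ => h y) (fun y _ => hasLineDerivAt_slice hg k x t y)
  simp only [ContinuousLinearMap.mul_apply', mul_neg, integral_neg, neg_inj] at this
  exact this.symm

end partial_derivatives

section representation

open scoped ContDiff
open Filter Topology

variable {n : ℕ} {g : EuclideanSpace ℝ (Fin n) × ℝ → ℝ}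

theorem integral_heatHess_mul_slice (i j : Fin n) {s : ℝ} (hs : 0 < s) (hg : ContDiff ℝ ∞ g)
    (hgc : HasCompactSupport g) (x : EuclideanSpace ℝ (Fin n)) (t : ℝ) :
    ∫ y, heatHess i j y s * g (x - y, t) = ∫ y, heatKernel y s * pdx i (pdx j g) (x - y, t) := by
  rw [integral_mul_slice_eq (integrable_heatGrad i hs) (integrable_heatHess i j hs)
      (fun y => hasLineDerivAt_heatGrad i j y hs) hg hgc,
    integral_mul_slice_eq (integrable_heatKernel hs) (integrable_heatGrad i hs)
      (fun y => hasLineDerivAt_heatKernel i y hs) (hg.pdx j) (hgc.pdx j)]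

theorem integral_heatKernel_mul_lapP_slice {s : ℝ} (hs : 0 < s) (hg : ContDiff ℝ ∞ g)
    (hgc : HasCompactSupport g) (x : EuclideanSpace ℝ (Fin n)) (t : ℝ) :
    ∫ y, heatKernel y s * lapP g (x - y, t) =
      ∫ y, (∑ k, heatHess k k y s) * g (x - y, t) := by
  simp only [lapP, hessEntryP, Finset.mul_sum, Finset.sum_mul]
  rw [integral_finsetSum, integral_finsetSum]
  · exact Finset.sum_congr rfl fun k _ => (integral_heatHess_mul_slice k k hs hg hgc x t).symm
  · exact fun k _ => integrable_mul_slice (integrable_heatHess k k hs) hg.continuous hgc x t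
  · exact fun k _ => integrable_mul_slice (integrable_heatKernel hs)
      ((hg.pdx k).pdx k).continuous ((hgc.pdx k).pdx k) x t

/-- The heat kernel solves the heat equation. -/
theorem hasDerivAt_heatKernel_time (x : EuclideanSpace ℝ (Fin n)) {s : ℝ} (hs : 0 < s) :
    HasDerivAt (fun s => heatKernel x s) (∑ k, heatHess k k x s) s := by
  have h := hasDerivAt_heatKernel x 0 (s := 0) (r := 1) (θ := s) (by simpa)
  simp only [smul_zero, add_zero, mul_one, zero_add] at h
  refine h.congr_deriv ?_
  simp only [heatHess, heatLogDeriv, heatHessFactor, if_true]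
  rw [← Finset.sum_mul, Finset.sum_sub_distrib, ← Finset.sum_div, EuclideanSpace.real_norm_sq_eq]
  simp [sq]
  left
  field_simp

theorem hasDerivAt_slice_time (hg : ContDiff ℝ ∞ g) (x : EuclideanSpace ℝ (Fin n)) (t s : ℝ) :
    HasDerivAt (fun s => g (x, t - s)) (-pdt g (x, t - s)) s := by
  have h1 : HasDerivAt (fun s : ℝ => (x, t - s)) ((0 : EuclideanSpace ℝ (Fin n)), (-1:ℝ)) s :=
    (hasDerivAt_const _ _).prodMk (by simpa using (hasDerivAt_id s).const_sub t)
  have h2 := (hg.differentiable (by simp) (x, t - s)).hasFDerivAt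
  refine (h2.comp_hasDerivAt s h1).congr_deriv ?_
  rw [pdt, ← map_neg]
  simp

theorem integral_truncHess_mul_eq {a : EuclideanSpace ℝ (Fin n) × ℝ → ℝ}
    (i j : Fin n) {ε : ℝ} (hε : 0 < ε) (N : ℝ)
    (hg : Continuous g) (hgc : HasCompactSupport g) (x : EuclideanSpace ℝ (Fin n)) (t : ℝ)
    (h : ∀ s, 0 < s → ∫ y, heatHess i j y s * g (x - y, t - s) = ∫ y, a (y, s)) :
    ∫ w, truncHess i j ε N w * g ((x, t) - w) = ∫ s in Set.Ioc ε N, ∫ y, a (y, s) := by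
  obtain ⟨M, hM⟩ := hgc.exists_bound_of_continuous hg
  have hInt : Integrable fun w => truncHess i j ε N w * g ((x, t) - w) :=
    (integrable_truncHess i j hε N).mul_bdd (c := M) (by fun_prop) (ae_of_all _ fun y => hM _)
  rw [Measure.volume_eq_prod, integral_prod_symm _ hInt, ← integral_indicator measurableSet_Ioc]
  congr 1
  ext s
  by_cases hs : s ∈ Set.Ioc ε N
  · simp only [Set.indicator_of_mem hs, truncHess_of_mem hs, Prod.mk_sub_mk]
    exact h s (hε.trans hs.1)
  · simp [Set.indicator_of_notMem hs, truncHess_of_notMem hs]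

theorem integrable_heatKernel_mul (hg : Continuous g) (hgc : HasCompactSupport g) {ε : ℝ}
    (hε : 0 < ε) (N : ℝ) (z : EuclideanSpace ℝ (Fin n) × ℝ) :
    Integrable (fun w : EuclideanSpace ℝ (Fin n) × ℝ => heatKernel w.1 w.2 * g (z - w))
      ((volume : Measure (EuclideanSpace ℝ (Fin n))).prod (volume.restrict (Set.Ioc ε N))) := by
  have hgi : Integrable fun w => g (z - w) :=
    (hg.integrable_of_hasCompactSupport hgc).comp_sub_left z
  rw [← Measure.restrict_univ (μ := (volume : Measure (EuclideanSpace ℝ (Fin n)))),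
    Measure.prod_restrict]
  refine (hgi.restrict (s := Set.univ ×ˢ Set.Ioc ε N)).bdd_mul (c := ε ^ (-(n / 2 : ℝ)))
    measurable_heatKernel.aestronglyMeasurable ?_
  refine (ae_restrict_iff' (MeasurableSet.univ.prod measurableSet_Ioc)).2 (ae_of_all _ ?_)
  rintro ⟨y, s⟩ ⟨-, hs⟩
  have hs0 : 0 < s := hε.trans hs.1
  rw [Real.norm_of_nonneg (heatKernel_nonneg _ hs0.le)]
  refine (heatKernel_le_gaussian _ hs0.le).trans ?_
  refine (mul_le_of_le_one_right (by positivity) (Real.exp_le_one_iff.2 ?_)).trans ?_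
  · rw [neg_nonpos]; positivity
  · exact Real.rpow_le_rpow_of_nonpos hε hs.1.le (by simp; positivity)

theorem integrable_heatHess_mul (i j : Fin n) (hg : Continuous g) (hgc : HasCompactSupport g)
    {ε : ℝ} (hε : 0 < ε) (N : ℝ) (z : EuclideanSpace ℝ (Fin n) × ℝ) :
    Integrable (fun w : EuclideanSpace ℝ (Fin n) × ℝ => heatHess i j w.1 w.2 * g (z - w))
      ((volume : Measure (EuclideanSpace ℝ (Fin n))).prod (volume.restrict (Set.Ioc ε N))) := by
  obtain ⟨M, hM⟩ := hgc.exists_bound_of_continuous hg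
  have hInt : Integrable fun w => truncHess i j ε N w * g (z - w) :=
    (integrable_truncHess i j hε N).mul_bdd (c := M) (by fun_prop) (ae_of_all _ fun y => hM _)
  rw [← Measure.restrict_univ (μ := (volume : Measure (EuclideanSpace ℝ (Fin n)))),
    Measure.prod_restrict]
  refine (hInt.restrict (s := Set.univ ×ˢ Set.Ioc ε N)).congr ?_
  refine (ae_restrict_iff' (MeasurableSet.univ.prod measurableSet_Ioc)).2 (ae_of_all _ ?_)
  rintro ⟨y, s⟩ ⟨-, hs⟩
  simp only [truncHess_of_mem hs]

theorem truncHess_conv_heatOp_eq (i j : Fin n) {ε N : ℝ} (hε : 0 < ε) (hN : ε ≤ N)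
    (hg : ContDiff ℝ ∞ g) (hgc : HasCompactSupport g) (x : EuclideanSpace ℝ (Fin n)) (t : ℝ) :
    ∫ w, truncHess i j ε N w * heatOp g ((x, t) - w) =
      (∫ y, heatKernel y ε * hessEntryP g i j (x - y, t - ε)) -
        ∫ y, heatKernel y N * hessEntryP g i j (x - y, t - N) := by
  set w := hessEntryP g i j with hw
  have hws : ContDiff ℝ ∞ w := (hg.pdx i).pdx j
  have hwc : HasCompactSupport w := (hgc.pdx i).pdx j
  have hN0 : 0 < N := hε.trans_le hN
  have hInt : Integrable (fun q : EuclideanSpace ℝ (Fin n) × ℝ =>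
      heatKernel q.1 q.2 * pdt w ((x, t) - q) -
        (∑ k, heatHess k k q.1 q.2) * w ((x, t) - q))
      ((volume : Measure (EuclideanSpace ℝ (Fin n))).prod (volume.restrict (Set.Ioc ε N))) := by
    refine (integrable_heatKernel_mul hws.pdt.continuous hwc.pdt hε N _).sub ?_
    simp only [Finset.sum_mul]
    exact integrable_finsetSum _ fun k _ =>
      integrable_heatHess_mul k k hws.continuous hwc hε N _
  have hslice : ∀ s, 0 < s → ∫ y, heatHess i j y s * heatOp g (x - y, t - s) =
      ∫ y, (heatKernel y s * pdt w (x - y, t - s) -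
        (∑ k, heatHess k k y s) * w (x - y, t - s)) := fun s hs => by
    have h1 : pdx i (pdx j (heatOp g)) = heatOp w := by
      rw [pdx_heatOp hg, pdx_heatOp (hg.pdx j), hw]
      congr 1
      exact pdx_pdx_comm hg j i
    have h2 := integrable_mul_slice (integrable_heatKernel hs) hws.pdt.continuous hwc.pdt x (t - s)
    have hlap : Continuous (lapP w) :=
      (ContDiff.sum fun i _ => (hws.pdx i).pdx i : ContDiff ℝ ∞ (lapP w)).continuous
    have h3 := integrable_mul_slice (integrable_heatKernel hs) hlap hwc.lapP x (t - s)
    have h4 : Integrable fun y => (∑ k, heatHess k k y s) * w (x - y, t - s) :=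
      integrable_mul_slice (integrable_finsetSum _ fun k _ => integrable_heatHess k k hs)
        hws.continuous hwc x (t - s)
    rw [integral_heatHess_mul_slice i j hs hg.heatOp hgc.heatOp, h1, integral_sub h2 h4,
      ← integral_heatKernel_mul_lapP_slice hs hws hwc, ← integral_sub h2 h3]
    simp only [heatOp, mul_sub]
  rw [integral_truncHess_mul_eq (a := fun q => heatKernel q.1 q.2 * pdt w ((x, t) - q) -
        (∑ k, heatHess k k q.1 q.2) * w ((x, t) - q)) i j hε N hg.heatOp.continuous hgc.heatOp x t
        hslice, integral_integral_swap (f := fun s y => heatKernel y s * pdt w ((x, t) - (y, s)) -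
        (∑ k, heatHess k k y s) * w ((x, t) - (y, s))) hInt.swap,
    ← integral_sub
      (integrable_mul_slice (integrable_heatKernel hε) hws.continuous hwc x (t - ε))
      (integrable_mul_slice (integrable_heatKernel hN0) hws.continuous hwc x (t - N))]
  congr 1
  ext y
  have hd : ∀ s, 0 < s → HasDerivAt (fun s => -(heatKernel y s * w (x - y, t - s)))
      (heatKernel y s * pdt w (x - y, t - s) - (∑ k, heatHess k k y s) * w (x - y, t - s)) s :=
    fun s hs => by
      refine ((hasDerivAt_heatKernel_time y hs).mul
        (hasDerivAt_slice_time hws (x - y) t s)).fun_neg.congr_deriv ?_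
      ring
  have hpos : ∀ s ∈ Set.uIcc ε N, 0 < s := fun s hs => by
    rw [Set.uIcc_of_le hN] at hs
    exact hε.trans_le hs.1
  have hcK : ∀ s, 0 < s → ContinuousAt (fun s => heatKernel y s) s := fun s hs =>
    (hasDerivAt_heatKernel_time y hs).continuousAt
  have hcont : ContinuousOn (fun s => heatKernel y s * pdt w (x - y, t - s) -
      (∑ k, heatHess k k y s) * w (x - y, t - s)) (Set.uIcc ε N) := by
    intro s hs
    have hs0 := hpos s hs
    have hH : ∀ k, ContinuousAt (fun s => heatHess k k y s) s := fun k => by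
      have := (hasDerivAt_heatHess k k y 0 (s := 0) (r := 1) (θ := s) (by simpa)).continuousAt
      simpa using this
    have h1 : ContinuousAt (fun s => pdt w (x - y, t - s)) s :=
      (hws.pdt.continuous.comp (by fun_prop : Continuous fun s => (x - y, t - s))).continuousAt
    have h2 : ContinuousAt (fun s => w (x - y, t - s)) s :=
      (hws.continuous.comp (by fun_prop : Continuous fun s => (x - y, t - s))).continuousAt
    have h3 : ContinuousAt (fun s => ∑ k, heatHess k k y s) s :=
      tendsto_finsetSum _ fun k _ => hH k
    exact (((hcK s hs0).mul h1).sub (h3.mul h2)).continuousWithinAt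
  have := intervalIntegral.integral_eq_sub_of_hasDerivAt (fun s hs => hd s (hpos s hs))
    hcont.intervalIntegrable
  rw [intervalIntegral.integral_of_le hN] at this
  simp only [Prod.mk_sub_mk]
  rw [this]
  ring

end representation

section approximate_identity

open scoped ContDiff NNReal
open Filter Topology

variable {n : ℕ} {g : EuclideanSpace ℝ (Fin n) × ℝ → ℝ}

theorem norm_mul_heatKernel_le (y : EuclideanSpace ℝ (Fin n)) {s : ℝ} (hs : 0 < s) :
    ‖y‖ * heatKernel y s ≤ Real.sqrt s * 256 * gaussian (1 / 8) y s := by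
  have hg := gaussian_nonneg (1 / 4) y hs.le
  have h1 : ‖y‖ ≤ Real.sqrt s * (1 + ‖y‖ ^ 2 / s) ^ 2 := by
    have hr : 0 < Real.sqrt s := Real.sqrt_pos.2 hs
    obtain ⟨q, hq⟩ : ∃ q, q = ‖y‖ / Real.sqrt s := ⟨_, rfl⟩
    have hy : ‖y‖ = Real.sqrt s * q := by rw [hq]; field_simp
    have hq2 : ‖y‖ ^ 2 / s = q ^ 2 := by rw [hq, div_pow, Real.sq_sqrt hs.le]
    rw [hq2]
    rw [hy]
    gcongr
    nlinarith [sq_nonneg (q - 1), sq_nonneg q, sq_nonneg (q ^ 2)]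
  calc ‖y‖ * heatKernel y s ≤ Real.sqrt s * (1 + ‖y‖ ^ 2 / s) ^ 2 * gaussian (1 / 4) y s :=
        mul_le_mul h1 (heatKernel_le_gaussian y hs.le) (heatKernel_nonneg y hs.le) (by positivity)
    _ = Real.sqrt s * ((1 + ‖y‖ ^ 2 / s) ^ 2 * gaussian (1 / 4) y s) := by ring
    _ ≤ Real.sqrt s * (256 * gaussian (1 / 8) y s) :=
        mul_le_mul_of_nonneg_left (mul_gaussian_le y hs) (Real.sqrt_nonneg s)
    _ = _ := by ring

theorem abs_integral_heatKernel_mul_sub_le {L : ℝ≥0} (hg : LipschitzWith L g)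
    (hgc : HasCompactSupport g) (x : EuclideanSpace ℝ (Fin n)) (t : ℝ) {s : ℝ} (hs : 0 < s) :
    |(∫ y, heatKernel y s * g (x - y, t - s)) - g (x, t)| ≤
      L * (Real.sqrt s * 256 * (∫ y : EuclideanSpace ℝ (Fin n), gaussian (1 / 8) y s) + s) := by
  have hK := integrable_heatKernel (n := n) hs
  have h1 := integrable_mul_slice hK hg.continuous hgc x (t - s)
  have h2 : Integrable fun y : EuclideanSpace ℝ (Fin n) => heatKernel y s * g (x, t) :=
    hK.mul_const _
  have hG := integrable_gaussian (n := n) (a := 1 / 8) (by norm_num) hs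
  have h3 : g (x, t) = ∫ y : EuclideanSpace ℝ (Fin n), heatKernel y s * g (x, t) := by
    rw [integral_mul_const, integral_heatKernel hs, one_mul]
  rw [h3, ← integral_sub h1 h2]
  calc |∫ y, (heatKernel y s * g (x - y, t - s) - heatKernel y s * g (x, t))|
      ≤ ∫ y, |heatKernel y s * g (x - y, t - s) - heatKernel y s * g (x, t)| :=
        abs_integral_le_integral_abs
    _ ≤ ∫ y, L * (Real.sqrt s * 256 * gaussian (1 / 8) y s + heatKernel y s * s) := by
        refine integral_mono (h1.sub h2).abs
          (((hG.const_mul _).add (hK.mul_const _)).const_mul _) fun y => ?_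
        have hl := hg.dist_le_mul (x - y, t - s) (x, t)
        rw [Real.dist_eq, dist_eq_norm] at hl
        have hn : ‖(x - y, t - s) - (x, t)‖ ≤ ‖y‖ + s := by
          have : (x - y, t - s) - (x, t) = (-y, -s) := by simp
          rw [this]
          refine (norm_prod_le_iff).2 ⟨?_, ?_⟩
          · simpa using hs.le
          · simp [abs_of_pos hs]
        have hKy := heatKernel_nonneg y hs.le
        simp only
        rw [← mul_sub, abs_mul, abs_of_nonneg hKy]
        calc heatKernel y s * |g (x - y, t - s) - g (x, t)|
            ≤ heatKernel y s * (L * (‖y‖ + s)) := by gcongr; exact hl.trans (by gcongr)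
          _ = L * (‖y‖ * heatKernel y s + heatKernel y s * s) := by ring
          _ ≤ _ :=
            mul_le_mul_of_nonneg_left (add_le_add_left (norm_mul_heatKernel_le y hs) _) L.2
    _ = _ := by
        rw [integral_const_mul, integral_add (hG.const_mul _) (hK.mul_const _),
          integral_const_mul, integral_mul_const, integral_heatKernel hs, one_mul]

theorem tendsto_integral_heatKernel_mul (hg : ContDiff ℝ ∞ g) (hgc : HasCompactSupport g)
    (x : EuclideanSpace ℝ (Fin n)) (t : ℝ) :
    Tendsto (fun s => ∫ y, heatKernel y s * g (x - y, t - s)) (𝓝[>] 0) (𝓝 (g (x, t))) := by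
  obtain ⟨L, hL⟩ := ContDiff.lipschitzWith_of_hasCompactSupport hgc hg (by simp)
  obtain ⟨A, hA⟩ : ∃ A : ℝ, ∀ s : ℝ, 0 < s →
      ∫ y : EuclideanSpace ℝ (Fin n), gaussian (1 / 8) y s = A :=
    ⟨_, fun s hs => integral_heat_gaussian (by norm_num) hs⟩
  rw [tendsto_iff_dist_tendsto_zero]
  refine squeeze_zero' (Eventually.of_forall fun _ => dist_nonneg)
    (g := fun s => L * (Real.sqrt s * 256 * A + s)) ?_ ?_
  · filter_upwards [self_mem_nhdsWithin] with s hs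
    rw [Real.dist_eq, ← hA s hs]
    exact abs_integral_heatKernel_mul_sub_le hL hgc x t hs
  · have : Tendsto (fun s => L * (Real.sqrt s * 256 * A + s)) (𝓝 0)
        (𝓝 (L * (Real.sqrt 0 * 256 * A + 0))) :=
      Continuous.tendsto (by fun_prop) 0
    simp only [Real.sqrt_zero, zero_mul, add_zero, mul_zero] at this
    exact this.mono_left nhdsWithin_le_nhds

theorem tendsto_truncHess_conv_heatOp (i j : Fin n) (hg : ContDiff ℝ ∞ g)
    (hgc : HasCompactSupport g) (z : EuclideanSpace ℝ (Fin n) × ℝ) :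
    Tendsto (fun m : ℕ => ∫ w, truncHess i j (1 / ((m : ℝ) + 1)) (m + 1) (z - w) * heatOp g w)
      atTop (𝓝 (hessEntryP g i j z)) := by
  obtain ⟨x, t⟩ := z
  set w := hessEntryP g i j with hw
  have hws : ContDiff ℝ ∞ w := (hg.pdx i).pdx j
  have hwc : HasCompactSupport w := (hgc.pdx i).pdx j
  obtain ⟨R, hR⟩ := hwc.isBounded.subset_closedBall 0
  have h0 : ∀ N, |t| + R < N → ∀ y, w (x - y, t - N) = 0 := fun N hN y =>
    image_eq_zero_of_notMem_tsupport fun hmem => by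
      have h1 := mem_closedBall_zero_iff.1 (hR hmem)
      have h2 := (norm_prod_le_iff.1 h1).2
      rw [Real.norm_eq_abs] at h2
      have h3 := (abs_le.1 h2).1
      have h4 := le_abs_self t
      simp only at h3
      linarith
  have hN : Tendsto (fun m : ℕ => (m : ℝ) + 1) atTop atTop :=
    tendsto_atTop_add_const_right _ _ tendsto_natCast_atTop_atTop
  have hε : Tendsto (fun m : ℕ => 1 / ((m : ℝ) + 1)) atTop (𝓝[>] 0) :=
    tendsto_nhdsWithin_iff.2 ⟨tendsto_one_div_add_atTop_nhds_zero_nat,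
      Eventually.of_forall fun m => by
        simp only [Set.mem_Ioi]; positivity⟩
  refine ((tendsto_integral_heatKernel_mul hws hwc x t).comp hε).congr' ?_
  filter_upwards [hN.eventually_gt_atTop (|t| + R)] with m hm
  rw [integral_sub_mul_eq, truncHess_conv_heatOp_eq i j (by positivity) ?_ hg hgc]
  · simp only [← hw, h0 _ hm, mul_zero, integral_zero, sub_zero, Function.comp_apply]
  · rw [div_le_iff₀ (by positivity)]
    nlinarith [Nat.cast_nonneg (α := ℝ) m]

end approximate_identity

section far_field

open scoped ContDiff Nat

variable {n : ℕ} {g : EuclideanSpace ℝ (Fin n) × ℝ → ℝ}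

theorem integrable_heatHessDeriv (i j k : Fin n) {s : ℝ} (hs : 0 < s) :
    Integrable fun y => heatHessDeriv i j y s (EuclideanSpace.single k 1) 0 := by
  obtain ⟨σ, hσ, rfl⟩ : ∃ σ : ℝ, 0 < σ ∧ σ ^ 2 = s := ⟨_, Real.sqrt_pos.2 hs, Real.sq_sqrt hs.le⟩
  refine ((integrable_gaussian (n := n) (a := 1 / 8) (by norm_num) hs).const_mul _).mono'
    (Measurable.aestronglyMeasurable ?_)
    (ae_of_all _ fun y => abs_heatHessDeriv_le i j y _ hσ 0)
  have hK : Measurable fun y : EuclideanSpace ℝ (Fin n) => heatKernel y (σ ^ 2) :=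
    measurable_heatKernel.comp measurable_prodMk_right
  unfold heatHessDeriv heatHessFactorDeriv heatHessFactor heatLogDeriv
  fun_prop

theorem hasLineDerivAt_heatHess (i j k : Fin n) (y : EuclideanSpace ℝ (Fin n)) {s : ℝ}
    (hs : 0 < s) :
    HasLineDerivAt ℝ (fun y => heatHess i j y s)
      (heatHessDeriv i j y s (EuclideanSpace.single k 1) 0) y (EuclideanSpace.single k 1) := by
  have := hasDerivAt_heatHess i j y (EuclideanSpace.single k 1) (s := s) (r := 0) (θ := 0)
    (by simpa)
  simpa [HasLineDerivAt] using this

theorem pow_mul_exp_neg_le (m : ℕ) {τ a : ℝ} (ha : τ ^ 2 / 128 ≤ a) :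
    τ ^ m * Real.exp (-a) ≤ 1 + 128 ^ m * m ! := by
  have h1 : (τ ^ 2) ^ m ≤ 128 ^ m * m ! * Real.exp a := by
    have := (Real.pow_div_factorial_le_exp (τ ^ 2 / 128) (by positivity) m).trans
      (Real.exp_le_exp.2 ha)
    rw [div_pow, div_div, div_le_iff₀ (by positivity)] at this
    linarith
  have h2 : τ ^ m ≤ 1 + (τ ^ 2) ^ m := by
    rw [← pow_mul, mul_comm, pow_mul]
    nlinarith [sq_nonneg (τ ^ m - 1)]
  have h3 : Real.exp (-a) ≤ 1 := Real.exp_le_one_iff.2 (by linarith [sq_nonneg τ])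
  calc τ ^ m * Real.exp (-a) ≤ (1 + 128 ^ m * m ! * Real.exp a) * Real.exp (-a) := by
        gcongr
        exact h2.trans (by gcongr)
    _ = Real.exp (-a) + 128 ^ m * m ! * (Real.exp a * Real.exp (-a)) := by ring
    _ ≤ _ := by
        rw [← Real.exp_add, add_neg_cancel, Real.exp_zero, mul_one]
        gcongr

theorem abs_heatHessDeriv_far_le (i j k : Fin n) {y : EuclideanSpace ℝ (Fin n)} {s : ℝ}
    (hs : 0 < s) (hy : 1 / 4 ≤ ‖y‖) :
    |heatHessDeriv i j y s (EuclideanSpace.single k 1) 0| ≤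
      256 * (n + 1) * (1 + 128 ^ (n + 3) * (n + 3)!) := by
  obtain ⟨σ, hσ, rfl⟩ : ∃ σ : ℝ, 0 < σ ∧ σ ^ 2 = s := ⟨_, Real.sqrt_pos.2 hs, Real.sq_sqrt hs.le⟩
  refine (abs_heatHessDeriv_le i j y _ hσ 0).trans ?_
  rw [mul_assoc]
  refine mul_le_mul_of_nonneg_left ?_ (by positivity)
  have h1 : (σ⁻¹) ^ 2 / 128 ≤ 1 / 8 * ‖y‖ ^ 2 / σ ^ 2 := by
    have : (1 / 4 : ℝ) ^ 2 ≤ ‖y‖ ^ 2 := by gcongr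
    rw [inv_pow, inv_eq_one_div, div_div, mul_comm (σ ^ 2), ← div_div]
    gcongr
    linarith
  refine le_trans (le_of_eq ?_) (pow_mul_exp_neg_le (n + 3) h1)
  have h2 : (σ ^ 2) ^ (-(n / 2 : ℝ)) = σ⁻¹ ^ n := by
    rw [← Real.rpow_natCast σ 2, ← Real.rpow_mul hσ.le, inv_pow, ← Real.rpow_natCast,
      ← Real.rpow_neg hσ.le]
    congr 1
    push_cast
    ring
  rw [gaussian, h2, pow_add]
  simp
  ring

theorem enorm_truncHess_conv_pdx_le (i j k : Fin n) {ε : ℝ} (hε : 0 < ε) (N : ℝ)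
    (hg : ContDiff ℝ ∞ g) (hgc : HasCompactSupport g) {z : EuclideanSpace ℝ (Fin n) × ℝ}
    (hz : ∀ w, g w ≠ 0 → 1 / 4 ≤ ‖z.1 - w.1‖) :
    ‖∫ w, truncHess i j ε N (z - w) * pdx k g w‖ₑ ≤
      ENNReal.ofReal (256 * (n + 1) * (1 + 128 ^ (n + 3) * (n + 3)!)) * ∫⁻ w, ‖g w‖ₑ := by
  set C := 256 * (n + 1) * (1 + 128 ^ (n + 3) * ((n + 3)! : ℝ)) with hC
  obtain ⟨x, t⟩ := z
  rw [integral_sub_mul_eq, integral_truncHess_mul_eq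
    (a := fun q => heatHessDeriv i j q.1 q.2 (EuclideanSpace.single k 1) 0 * g ((x, t) - q))
    i j hε N (hg.pdx k).continuous (hgc.pdx k) x t fun s hs =>
      (integral_mul_slice_eq (integrable_heatHess i j hs) (integrable_heatHessDeriv i j k hs)
        (fun y => hasLineDerivAt_heatHess i j k y hs) hg hgc x (t - s)).symm]
  calc _ ≤ ∫⁻ s in Set.Ioc ε N, ∫⁻ y,
          ‖heatHessDeriv i j y s (EuclideanSpace.single k 1) 0 * g ((x, t) - (y, s))‖ₑ :=
        (enorm_integral_le_lintegral_enorm _).trans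
          (lintegral_mono fun s => enorm_integral_le_lintegral_enorm _)
    _ ≤ ∫⁻ s in Set.Ioc ε N, ∫⁻ y, ENNReal.ofReal C * ‖g ((x, t) - (y, s))‖ₑ := by
        refine setLIntegral_mono' measurableSet_Ioc fun s hs => lintegral_mono fun y => ?_
        rw [enorm_mul]
        by_cases h0 : g ((x, t) - (y, s)) = 0
        · simp only [h0, enorm_zero, mul_zero, le_refl]
        · gcongr
          rw [Real.enorm_eq_ofReal_abs]
          refine ENNReal.ofReal_le_ofReal (abs_heatHessDeriv_far_le i j k (hε.trans hs.1) ?_)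
          simpa using hz _ h0
    _ ≤ ∫⁻ s, ∫⁻ y, ENNReal.ofReal C * ‖g ((x, t) - (y, s))‖ₑ := setLIntegral_le_lintegral _ _
    _ = ∫⁻ q : EuclideanSpace ℝ (Fin n) × ℝ, ENNReal.ofReal C * ‖g ((x, t) - q)‖ₑ := by
        have hgc := hg.continuous
        rw [Measure.volume_eq_prod, lintegral_prod_symm _ (by fun_prop)]
    _ = _ := by
        rw [lintegral_const_mul' _ _ ENNReal.ofReal_ne_top,
          lintegral_sub_left_eq_self (fun w => ‖g w‖ₑ) (x, t)]

end far_field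

section divergence_form

open scoped ContDiff Nat
open Filter Topology

variable {n : ℕ}

theorem enorm_truncHess_conv_add_le (i j : Fin n) {ε : ℝ} (hε : 0 < ε) (N : ℝ)
    {F : EuclideanSpace ℝ (Fin n) × ℝ → ℝ} {h : Fin n → EuclideanSpace ℝ (Fin n) × ℝ → ℝ}
    (hF : ContDiff ℝ ∞ F) (hFc : HasCompactSupport F) (hh : ∀ k, ContDiff ℝ ∞ (h k))
    (hhc : ∀ k, HasCompactSupport (h k)) {z : EuclideanSpace ℝ (Fin n) × ℝ}
    (hz : ∀ k w, h k w ≠ 0 → 1 / 4 ≤ ‖z.1 - w.1‖) :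
    ‖∫ w, truncHess i j ε N (z - w) * (F w + ∑ k, pdx k (h k) w)‖ₑ ≤
      ‖∫ w, truncHess i j ε N (z - w) * F w‖ₑ +
        ENNReal.ofReal (256 * (n + 1) * (1 + 128 ^ (n + 3) * (n + 3)!)) *
          ∑ k, ∫⁻ w, ‖h k w‖ₑ := by
  have hInt : ∀ G : EuclideanSpace ℝ (Fin n) × ℝ → ℝ, Continuous G → HasCompactSupport G →
      Integrable fun w => truncHess i j ε N (z - w) * G w := fun G hG hGc => by
    obtain ⟨M, hM⟩ := hGc.exists_bound_of_continuous hG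
    exact ((integrable_truncHess i j hε N).comp_sub_left z).mul_bdd (c := M) (by fun_prop)
      (ae_of_all _ fun y => hM _)
  have h1 : ∀ k, Integrable fun w => truncHess i j ε N (z - w) * pdx k (h k) w := fun k =>
    hInt _ ((hh k).pdx k).continuous ((hhc k).pdx k)
  have h2 : ∀ w, truncHess i j ε N (z - w) * (F w + ∑ k, pdx k (h k) w) =
      truncHess i j ε N (z - w) * F w + ∑ k, truncHess i j ε N (z - w) * pdx k (h k) w :=
    fun w => by
    rw [mul_add, Finset.mul_sum]
  simp only [h2]
  rw [Finset.mul_sum, integral_add (hInt F hF.continuous hFc)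
    (integrable_finsetSum _ fun k _ => h1 k),
    integral_finsetSum _ fun k _ => h1 k]
  refine (enorm_add_le _ _).trans (add_le_add_right ?_ _)
  exact (enorm_sum_le _ _).trans (Finset.sum_le_sum fun k _ =>
    enorm_truncHess_conv_pdx_le i j k hε N (hh k) (hhc k) (hz k))

theorem exists_lintegral_hessEntryP_rpow_le (n : ℕ) {p : ℝ} (hp : 1 < p) :
    ∃ C : ℝ≥0∞, C ≠ ⊤ ∧ ∀ (i j : Fin n) (v F : EuclideanSpace ℝ (Fin n) × ℝ → ℝ)
      (h : Fin n → EuclideanSpace ℝ (Fin n) × ℝ → ℝ),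
      ContDiff ℝ ∞ v → HasCompactSupport v → ContDiff ℝ ∞ F → HasCompactSupport F →
      (∀ k, ContDiff ℝ ∞ (h k)) → (∀ k, HasCompactSupport (h k)) →
      (∀ k w, h k w ≠ 0 → 3 / 4 ≤ ‖w.1‖) →
      (∀ z, heatOp v z = F z + ∑ k, pdx k (h k) z) →
      ∫⁻ z in pCube (1 / 2) 0, ‖hessEntryP v i j z‖ₑ ^ p ≤
        C * ((∫⁻ z, ‖F z‖ₑ ^ p) + (∑ k, ∫⁻ z, ‖h k z‖ₑ) ^ p) := by
  obtain ⟨A, hA, hbound⟩ := exists_lintegral_truncHess_conv_rpow_le n hp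
  have hp0 : 0 < p := by linarith
  obtain ⟨D, hD⟩ : ∃ D, D = ENNReal.ofReal (256 * (n + 1) * (1 + 128 ^ (n + 3) * (n + 3)!)) :=
    ⟨_, rfl⟩
  have hDt : D ≠ ⊤ := hD ▸ ENNReal.ofReal_ne_top
  set Q : Set (EuclideanSpace ℝ (Fin n) × ℝ) := pCube (1 / 2) 0 with hQ
  have hQt : volume Q ≠ ⊤ := by
    rw [hQ, pCube, Measure.volume_eq_prod, Measure.prod_prod]
    exact ENNReal.mul_ne_top measure_ball_lt_top.ne measure_Ioc_lt_top.ne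
  have hQm : MeasurableSet Q := measurableSet_ball.prod measurableSet_Ioc
  refine ⟨2 ^ (p - 1) * (A + D ^ p * volume Q), by finiteness,
    fun i j v F h hv hvc hF hFc hh hhc hfar heq => ?_⟩
  set S := ∑ k, ∫⁻ z, ‖h k z‖ₑ with hS
  set T : ℕ → (EuclideanSpace ℝ (Fin n) × ℝ → ℝ) → EuclideanSpace ℝ (Fin n) × ℝ → ℝ :=
    fun m G z => ∫ w, truncHess i j (1 / ((m : ℝ) + 1)) (m + 1) (z - w) * G w with hT
  have hTm : ∀ m G, Measurable G → Measurable (T m G) := fun m G hG =>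
    measurable_integral_sub_mul (measurable_truncHess _ _ _ _) hG
  have hε : ∀ m : ℕ, 0 < 1 / ((m : ℝ) + 1) := fun m => by positivity
  have hm : ∀ m, ∫⁻ z in Q, ‖T m (heatOp v) z‖ₑ ^ p ≤
      2 ^ (p - 1) * (A + D ^ p * volume Q) * ((∫⁻ z, ‖F z‖ₑ ^ p) + S ^ p) := fun m => by
    calc ∫⁻ z in Q, ‖T m (heatOp v) z‖ₑ ^ p
        ≤ ∫⁻ z in Q, 2 ^ (p - 1) * (‖T m F z‖ₑ ^ p + (D * S) ^ p) := by
          refine setLIntegral_mono' hQm fun z hz => ?_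
          refine le_trans ?_ (ENNReal.rpow_add_le_mul_rpow_add_rpow _ _ hp.le)
          refine ENNReal.rpow_le_rpow ?_ hp0.le
          simp only [hT, heq, hD]
          refine enorm_truncHess_conv_add_le i j (hε m) _ hF hFc hh hhc fun k w hw => ?_
          have h1 := hfar k w hw
          have h2 : ‖z.1‖ < 1 / 2 := mem_ball_zero_iff.1 hz.1
          have h3 := norm_sub_norm_le w.1 z.1
          rw [norm_sub_rev] at h3
          linarith
      _ = 2 ^ (p - 1) * ((∫⁻ z in Q, ‖T m F z‖ₑ ^ p) + (D * S) ^ p * volume Q) := by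
          rw [lintegral_const_mul' _ _ (by finiteness),
            lintegral_add_right _ measurable_const, setLIntegral_const]
      _ ≤ 2 ^ (p - 1) * (A * (∫⁻ z, ‖F z‖ₑ ^ p) + (D * S) ^ p * volume Q) := by
          gcongr
          exact (setLIntegral_le_lintegral _ _).trans (hbound i j _ _ (hε m) F hF.continuous hFc)
      _ = 2 ^ (p - 1) * (A * (∫⁻ z, ‖F z‖ₑ ^ p) + D ^ p * volume Q * S ^ p) := by
          rw [ENNReal.mul_rpow_of_nonneg _ _ hp0.le, mul_right_comm]
      _ ≤ 2 ^ (p - 1) * ((A + D ^ p * volume Q) * ((∫⁻ z, ‖F z‖ₑ ^ p) + S ^ p)) := by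
          rw [add_mul]
          gcongr
          · exact le_self_add
          · exact le_add_self
      _ = _ := (mul_assoc _ _ _).symm
  calc ∫⁻ z in Q, ‖hessEntryP v i j z‖ₑ ^ p
      = ∫⁻ z in Q, liminf (fun m => ‖T m (heatOp v) z‖ₑ ^ p) atTop := by
        refine lintegral_congr fun z => ?_
        exact (((ENNReal.continuous_rpow_const.comp continuous_enorm).tendsto _).comp
          (tendsto_truncHess_conv_heatOp i j hv hvc z)).liminf_eq.symm
    _ ≤ liminf (fun m => ∫⁻ z in Q, ‖T m (heatOp v) z‖ₑ ^ p) atTop :=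
        lintegral_liminf_le fun m =>
          ((hTm m _ hv.heatOp.continuous.measurable).enorm.pow_const p)
    _ ≤ _ := liminf_le_of_frequently_le' (Frequently.of_forall hm)

end divergence_form

section localization

open scoped ContDiff
open Filter Topology

variable {n : ℕ}

theorem exists_cutoff (n : ℕ) : ∃ η : EuclideanSpace ℝ (Fin n) × ℝ → ℝ, ContDiff ℝ ∞ η ∧
    HasCompactSupport η ∧ tsupport η ⊆ ball 0 1 ×ˢ Set.Ioo (-(1 / 2)) (1 / 2) ∧
    (∀ z ∈ ball 0 (3 / 4) ×ˢ Set.Ioo (-(1 / 4)) (1 / 4), η z = 1) ∧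
    ∀ k z, pdx k η z ≠ 0 → 3 / 4 ≤ ‖z.1‖ := by
  let a : ContDiffBump (0 : EuclideanSpace ℝ (Fin n)) := ⟨3 / 4, 7 / 8, by norm_num, by norm_num⟩
  let b : ContDiffBump (0 : ℝ) := ⟨1 / 4, 3 / 8, by norm_num, by norm_num⟩
  have ha : ContDiff ℝ ∞ a := a.contDiff
  have hb : ContDiff ℝ ∞ b := b.contDiff
  have hb2 : ContDiff ℝ ∞ fun z : EuclideanSpace ℝ (Fin n) × ℝ => b z.2 := hb.comp contDiff_snd
  have hsupp : Function.support (fun z : EuclideanSpace ℝ (Fin n) × ℝ => a z.1 * b z.2) ⊆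
      closedBall 0 (7 / 8) ×ˢ closedBall 0 (3 / 8) := fun z hz => by
    rw [Function.mem_support, mul_ne_zero_iff] at hz
    have h1 : z.1 ∈ Function.support a := hz.1
    have h2 : z.2 ∈ Function.support b := hz.2
    rw [a.support_eq] at h1
    rw [b.support_eq] at h2
    exact ⟨ball_subset_closedBall h1, ball_subset_closedBall h2⟩
  have htsupp := closure_minimal hsupp (isClosed_closedBall.prod isClosed_closedBall)
  refine ⟨fun z => a z.1 * b z.2, (ha.comp contDiff_fst).mul hb2, ?_, ?_, ?_, ?_⟩
  · exact ((isCompact_closedBall _ _).prod (isCompact_closedBall _ _)).of_isClosed_subset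
      (isClosed_tsupport _) htsupp
  · refine htsupp.trans (Set.prod_mono (closedBall_subset_ball (by norm_num)) fun t ht => ?_)
    rw [mem_closedBall_zero_iff, Real.norm_eq_abs, abs_le] at ht
    constructor <;> linarith [ht.1, ht.2]
  · rintro z ⟨h1, h2⟩
    have h3 : z.2 ∈ closedBall (0:ℝ) (1 / 4) := by
      rw [mem_closedBall_zero_iff, Real.norm_eq_abs]
      exact (abs_lt.2 h2).le
    have h4 : a z.1 = 1 := a.one_of_mem_closedBall (ball_subset_closedBall h1)
    have h5 : b z.2 = 1 := b.one_of_mem_closedBall h3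
    simp only [h4, h5, mul_one]
  · intro k z hz
    by_contra! hlt
    refine hz ?_
    have hev : (fun z : EuclideanSpace ℝ (Fin n) × ℝ => a z.1 * b z.2) =ᶠ[𝓝 z]
        b ∘ Prod.snd := by
      have : ∀ᶠ w : EuclideanSpace ℝ (Fin n) × ℝ in 𝓝 z, ‖w.1‖ < 3 / 4 :=
        (continuous_fst.norm.continuousAt).eventually_lt_const hlt
      filter_upwards [this] with w hw
      have : a w.1 = 1 := a.one_of_mem_closedBall (mem_closedBall_zero_iff.2 hw.le)
      rw [this, one_mul, Function.comp_apply]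
    rw [pdx, hev.fderiv_eq, fderiv_comp _ (hb.differentiable (by simp) _) differentiableAt_snd]
    simp [fderiv_snd]

theorem pdx_mul {a b : EuclideanSpace ℝ (Fin n) × ℝ → ℝ} {z : EuclideanSpace ℝ (Fin n) × ℝ}
    (ha : DifferentiableAt ℝ a z) (hb : DifferentiableAt ℝ b z) (k : Fin n) :
    pdx k (fun z => a z * b z) z = a z * pdx k b z + pdx k a z * b z := by
  simp [pdx, fderiv_fun_mul ha hb, mul_comm]

theorem pdx_eq_zero {a : EuclideanSpace ℝ (Fin n) × ℝ → ℝ} {z : EuclideanSpace ℝ (Fin n) × ℝ}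
    (h : a =ᶠ[𝓝 z] 0) (k : Fin n) : pdx k a z = 0 := by
  rw [pdx, h.fderiv_eq]; simp

theorem pdt_eq_zero {a : EuclideanSpace ℝ (Fin n) × ℝ → ℝ} {z : EuclideanSpace ℝ (Fin n) × ℝ}
    (h : a =ᶠ[𝓝 z] 0) : pdt a z = 0 := by
  rw [pdt, h.fderiv_eq]; simp

theorem pdx_eventuallyEq_zero {a : EuclideanSpace ℝ (Fin n) × ℝ → ℝ}
    {z : EuclideanSpace ℝ (Fin n) × ℝ} (h : a =ᶠ[𝓝 z] 0) (k : Fin n) : pdx k a =ᶠ[𝓝 z] 0 := by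
  filter_upwards [h.eventuallyEq_nhds] with w hw using pdx_eq_zero hw k

theorem pdt_mul {a b : EuclideanSpace ℝ (Fin n) × ℝ → ℝ} {z : EuclideanSpace ℝ (Fin n) × ℝ}
    (ha : DifferentiableAt ℝ a z) (hb : DifferentiableAt ℝ b z) :
    pdt (fun z => a z * b z) z = a z * pdt b z + pdt a z * b z := by
  simp [pdt, fderiv_fun_mul ha hb, mul_comm]

theorem ContDiffOn.pdx {u : EuclideanSpace ℝ (Fin n) × ℝ → ℝ}
    {U : Set (EuclideanSpace ℝ (Fin n) × ℝ)} (hu : ContDiffOn ℝ ∞ u U) (hU : IsOpen U)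
    (k : Fin n) : ContDiffOn ℝ ∞ (pdx k u) U :=
  (hu.fderiv_of_isOpen hU (m := ∞) (by simp)).clm_apply contDiffOn_const

theorem heatOp_mul {a u : EuclideanSpace ℝ (Fin n) × ℝ → ℝ}
    {U : Set (EuclideanSpace ℝ (Fin n) × ℝ)} (hU : IsOpen U) (ha : ContDiff ℝ ∞ a)
    (hu : ContDiffOn ℝ ∞ u U) {z : EuclideanSpace ℝ (Fin n) × ℝ} (hz : z ∈ U) :
    heatOp (fun z => a z * u z) z = a z * heatOp u z + (pdt a z + lapP a z) * u z +
      ∑ k, pdx k (fun z => -2 * pdx k a z * u z) z := by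
  have hda : ∀ w, DifferentiableAt ℝ a w := ha.differentiable (by simp)
  have hdak : ∀ k w, DifferentiableAt ℝ (pdx k a) w := fun k =>
    (ha.pdx k).differentiable (by simp)
  have hdu : ∀ w ∈ U, DifferentiableAt ℝ u w := fun w hw =>
    (hu.contDiffAt (hU.mem_nhds hw)).differentiableAt (by simp)
  have hduk : ∀ k, DifferentiableAt ℝ (pdx k u) z := fun k =>
    ((hu.pdx hU k).contDiffAt (hU.mem_nhds hz)).differentiableAt (by simp)
  have h1 : ∀ k, pdx k (pdx k fun z => a z * u z) z =
      a z * pdx k (pdx k u) z + 2 * (pdx k a z * pdx k u z) + pdx k (pdx k a) z * u z := fun k => by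
    have hev : (pdx k fun z => a z * u z) =ᶠ[𝓝 z]
        fun w => a w * pdx k u w + pdx k a w * u w := by
      filter_upwards [hU.mem_nhds hz] with w hw using pdx_mul (hda w) (hdu w hw) k
    have : pdx k (fun w => a w * pdx k u w + pdx k a w * u w) z =
        pdx k (fun w => a w * pdx k u w) z + pdx k (fun w => pdx k a w * u w) z := by
      rw [pdx, fderiv_fun_add ((hda z).fun_mul (hduk k)) ((hdak k z).fun_mul (hdu z hz))]
      rfl
    rw [pdx, hev.fderiv_eq]
    change pdx k (fun w => a w * pdx k u w + pdx k a w * u w) z = _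
    rw [this, pdx_mul (hda z) (hduk k), pdx_mul (hdak k z) (hdu z hz)]
    ring
  have h2 : ∀ k, pdx k (fun z => -2 * pdx k a z * u z) z =
      -2 * (pdx k a z * pdx k u z) - 2 * (pdx k (pdx k a) z * u z) := fun k => by
    rw [pdx_mul ((hdak k z).const_mul (-2)) (hdu z hz)]
    have : pdx k (fun z => -2 * pdx k a z) z = -2 * pdx k (pdx k a) z := by
      rw [pdx, fderiv_const_mul (hdak k z)]
      rfl
    rw [this]
    ring
  simp only [heatOp, lapP, hessEntryP, h1, h2, pdt_mul (hda z) (hdu z hz)]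
  simp only [Finset.sum_add_distrib, Finset.sum_sub_distrib, ← Finset.mul_sum, ← Finset.sum_mul]
  ring

theorem contDiff_mul_of_tsupport_subset {a u : EuclideanSpace ℝ (Fin n) × ℝ → ℝ}
    {U : Set (EuclideanSpace ℝ (Fin n) × ℝ)} (hU : IsOpen U) (ha : ContDiff ℝ ∞ a)
    (hu : ContDiffOn ℝ ∞ u U) (haU : tsupport a ⊆ U) : ContDiff ℝ ∞ fun z => a z * u z :=
  contDiff_iff_contDiffAt.2 fun z => by
    by_cases hz : z ∈ U
    · exact ha.contDiffAt.mul (hu.contDiffAt (hU.mem_nhds hz))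
    · have h0 : a =ᶠ[𝓝 z] 0 := notMem_tsupport_iff_eventuallyEq.1 fun h => hz (haU h)
      refine contDiffAt_const (c := (0:ℝ)).congr_of_eventuallyEq ?_
      filter_upwards [h0] with w hw
      simp [hw]

/-- A localised solution of the heat equation has a right-hand side in divergence form. -/
theorem heatOp_cutoff_mul {η u f : EuclideanSpace ℝ (Fin n) × ℝ → ℝ}
    {U : Set (EuclideanSpace ℝ (Fin n) × ℝ)} (hU : IsOpen U) (hη : ContDiff ℝ ∞ η)
    (hηU : tsupport η ⊆ U) (hu : ContDiffOn ℝ ∞ u U) (hf : ∀ z ∈ U, heatOp u z = f z)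
    (z : EuclideanSpace ℝ (Fin n) × ℝ) :
    heatOp (fun z => η z * u z) z = η z * f z + (pdt η z + lapP η z) * u z +
      ∑ k, pdx k (fun z => -2 * pdx k η z * u z) z := by
  by_cases hz : z ∈ U
  · rw [heatOp_mul hU hη hu hz, hf z hz]
  · have hz' : z ∉ tsupport η := fun h => hz (hηU h)
    have h0 : η =ᶠ[𝓝 z] 0 := notMem_tsupport_iff_eventuallyEq.1 hz'
    have h1 : ∀ k, pdx k η =ᶠ[𝓝 z] 0 := pdx_eventuallyEq_zero h0
    have h2 : (fun z => η z * u z) =ᶠ[𝓝 z] 0 := by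
      filter_upwards [h0] with w hw
      simp [hw]
    have h3 : ∀ k, (fun z => -2 * pdx k η z * u z) =ᶠ[𝓝 z] 0 := fun k => by
      filter_upwards [h1 k] with w hw
      simp [hw]
    rw [Finset.sum_congr rfl fun k _ => pdx_eq_zero (h3 k) k]
    simp [heatOp, lapP, hessEntryP, pdx_eq_zero (h1 _), pdt_eq_zero h0,
      pdt_eq_zero h2, pdx_eq_zero (pdx_eventuallyEq_zero h2 _), h0.eq_of_nhds]

end localization

theorem lintegral_rpow_le_measure_univ_mul {α : Type*} [MeasurableSpace α] {μ : Measure α} {p : ℝ}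
    (hp : 1 < p) {g : α → ℝ≥0∞} (hg : AEMeasurable g μ) :
    (∫⁻ a, g a ∂μ) ^ p ≤ μ Set.univ ^ (p - 1) * ∫⁻ a, g a ^ p ∂μ := by
  have hp0 : 0 < p := by linarith
  have hpq := Real.HolderConjugate.conjExponent hp
  have h := ENNReal.lintegral_mul_le_Lp_mul_Lq μ hpq hg (aemeasurable_const (b := 1))
  simp only [Pi.mul_apply, mul_one, one_rpow, lintegral_const, one_mul] at h
  calc (∫⁻ a, g a ∂μ) ^ p
      ≤ ((∫⁻ a, g a ^ p ∂μ) ^ (1 / p) * μ Set.univ ^ (1 / p.conjExponent)) ^ p := by gcongr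
    _ = _ := by
      rw [ENNReal.mul_rpow_of_nonneg _ _ hp0.le, ← ENNReal.rpow_mul, ← ENNReal.rpow_mul,
        one_div_mul_cancel hp0.ne', ENNReal.rpow_one, mul_comm]
      congr 2
      rw [Real.conjExponent]
      field_simp

section interior_estimate

open scoped ContDiff

variable {n : ℕ}

theorem interior_subset_pCube :
    (ball (0 : EuclideanSpace ℝ (Fin n)) 1 ×ˢ Set.Ioo (-(1 / 2) : ℝ) (1 / 2)) ⊆ pCube 1 (0, 0) :=
  Set.prod_mono_right fun t ht => by
    constructor <;> norm_num <;> linarith [ht.1, ht.2]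

theorem measurableSet_pCube (r : ℝ) (c : EuclideanSpace ℝ (Fin n) × ℝ) :
    MeasurableSet (pCube r c) :=
  measurableSet_ball.prod measurableSet_Ioc

theorem volume_pCube_ne_top (r : ℝ) (c : EuclideanSpace ℝ (Fin n) × ℝ) :
    volume (pCube r c) ≠ ⊤ := by
  rw [pCube, Measure.volume_eq_prod, Measure.prod_prod]
  exact ENNReal.mul_ne_top measure_ball_lt_top.ne measure_Ioc_lt_top.ne

theorem lintegral_enorm_mul_add_mul_rpow_le {p M : ℝ} (hp : 1 < p)
    {a b u f : EuclideanSpace ℝ (Fin n) × ℝ → ℝ} {Q : Set (EuclideanSpace ℝ (Fin n) × ℝ)}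
    (hQ : MeasurableSet Q) (ha : ∀ z, ‖a z‖ ≤ M) (hb : ∀ z, ‖b z‖ ≤ M)
    (haQ : ∀ z ∉ Q, a z = 0) (hbQ : ∀ z ∉ Q, b z = 0) (hu : AEMeasurable u (volume.restrict Q)) :
    ∫⁻ z, ‖a z * f z + b z * u z‖ₑ ^ p ≤ 2 ^ (p - 1) * ENNReal.ofReal M ^ p *
      ((∫⁻ z in Q, ‖u z‖ₑ ^ p) + ∫⁻ z in Q, ‖f z‖ₑ ^ p) := by
  have hp0 : 0 < p := by linarith
  have hM : ∀ c : EuclideanSpace ℝ (Fin n) × ℝ → ℝ, (∀ z, ‖c z‖ ≤ M) →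
      ∀ z, ‖c z‖ₑ ≤ ENNReal.ofReal M := fun c hc z => by
    rw [← ofReal_norm]
    exact ENNReal.ofReal_le_ofReal (hc z)
  calc ∫⁻ z, ‖a z * f z + b z * u z‖ₑ ^ p
      = ∫⁻ z in Q, ‖a z * f z + b z * u z‖ₑ ^ p := by
        rw [← lintegral_indicator hQ]
        congr 1
        ext z
        by_cases hz : z ∈ Q
        · rw [Set.indicator_of_mem hz]
        · simp [Set.indicator_of_notMem hz, haQ z hz, hbQ z hz, hp0]
    _ ≤ ∫⁻ z in Q, 2 ^ (p - 1) * ENNReal.ofReal M ^ p * (‖u z‖ₑ ^ p + ‖f z‖ₑ ^ p) := by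
        refine lintegral_mono fun z => ?_
        calc ‖a z * f z + b z * u z‖ₑ ^ p
            ≤ (ENNReal.ofReal M * ‖f z‖ₑ + ENNReal.ofReal M * ‖u z‖ₑ) ^ p := by
              refine ENNReal.rpow_le_rpow ((enorm_add_le _ _).trans ?_) hp0.le
              rw [enorm_mul, enorm_mul]
              gcongr
              · exact hM a ha z
              · exact hM b hb z
          _ = ENNReal.ofReal M ^ p * (‖u z‖ₑ + ‖f z‖ₑ) ^ p := by
              rw [← mul_add, ENNReal.mul_rpow_of_nonneg _ _ hp0.le, add_comm ‖f z‖ₑ]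
          _ ≤ ENNReal.ofReal M ^ p * (2 ^ (p - 1) * (‖u z‖ₑ ^ p + ‖f z‖ₑ ^ p)) := by
              gcongr
              exact ENNReal.rpow_add_le_mul_rpow_add_rpow _ _ hp.le
          _ = _ := by ring
    _ = _ := by
        rw [lintegral_const_mul' _ _ (by finiteness),
          lintegral_add_left' (hu.enorm.pow_const p)]

/-- Interior estimate for each entry of the Hessian. -/
theorem exists_lintegral_hessEntryP_interior_le (n : ℕ) {p : ℝ} (hp : 1 < p) :
    ∃ C : ℝ≥0∞, C ≠ ⊤ ∧ ∀ u f : EuclideanSpace ℝ (Fin n) × ℝ → ℝ,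
      ContDiffOn ℝ ∞ u (pCube 1 (0, 0)) → ContDiffOn ℝ ∞ f (pCube 1 (0, 0)) →
      (∀ z ∈ pCube 1 (0, 0), pdt u z - lapP u z = f z) → ∀ i j : Fin n,
      ∃ w : EuclideanSpace ℝ (Fin n) × ℝ → ℝ, Continuous w ∧
        (∀ z ∈ pCube (1 / 2) (0, 0), hessEntryP u i j z = w z) ∧
        ∫⁻ z in pCube (1 / 2) (0, 0), ‖w z‖ₑ ^ p ≤
          C * ((∫⁻ z in pCube 1 (0, 0), ‖u z‖ₑ ^ p) + ∫⁻ z in pCube 1 (0, 0), ‖f z‖ₑ ^ p) := by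
  have hp0 : 0 < p := by linarith
  obtain ⟨A, hA, hbound⟩ := exists_lintegral_hessEntryP_rpow_le n hp
  obtain ⟨η, hη, hηc, hηU, hη1, hηfar⟩ := exists_cutoff n
  set U := ball (0 : EuclideanSpace ℝ (Fin n)) 1 ×ˢ Set.Ioo (-(1 / 2) : ℝ) (1 / 2) with hU_def
  have hU : IsOpen U := isOpen_ball.prod isOpen_Ioo
  set b : EuclideanSpace ℝ (Fin n) × ℝ → ℝ := fun z => pdt η z + lapP η z with hb
  have hlap : ContDiff ℝ ∞ (lapP η) := ContDiff.sum fun i _ => (hη.pdx i).pdx i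
  have hbs : ContDiff ℝ ∞ b := hη.pdt.add hlap
  have hbc : HasCompactSupport b := hηc.pdt.add hηc.lapP
  have hbt : tsupport b ⊆ tsupport η := by
    refine closure_minimal (fun z hz => ?_) (isClosed_tsupport η)
    by_contra h
    have h0 := notMem_tsupport_iff_eventuallyEq.1 h
    exact hz (by simp [hb, lapP, hessEntryP, pdt_eq_zero h0,
      pdx_eq_zero (pdx_eventuallyEq_zero h0 _)])
  set c : Fin n → EuclideanSpace ℝ (Fin n) × ℝ → ℝ := fun k z => -2 * pdx k η z with hc
  have hcs : ∀ k, ContDiff ℝ ∞ (c k) := fun k => contDiff_const.mul (hη.pdx k)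
  have hcc : ∀ k, HasCompactSupport (c k) := fun k => (hηc.pdx k).mul_left
  have hct : ∀ k, tsupport (c k) ⊆ tsupport η := fun k =>
    (tsupport_mul_subset_right).trans (tsupport_fderiv_apply_subset ℝ _)
  obtain ⟨M₀, hM₀⟩ := hηc.exists_bound_of_continuous hη.continuous
  obtain ⟨M₁, hM₁⟩ := hbc.exists_bound_of_continuous hbs.continuous
  choose m hm using fun k => (hcc k).exists_bound_of_continuous (hcs k).continuous
  set Q : Set (EuclideanSpace ℝ (Fin n) × ℝ) := pCube 1 (0, 0) with hQ
  have hQm : MeasurableSet Q := measurableSet_pCube _ _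
  have hQt : volume Q ≠ ⊤ := volume_pCube_ne_top _ _
  have hUQ : U ⊆ Q := interior_subset_pCube
  set S := ∑ k, ENNReal.ofReal (m k) with hS
  have hSt : S ≠ ⊤ := ENNReal.sum_ne_top.2 fun k _ => ENNReal.ofReal_ne_top
  have hp1 : 0 ≤ p - 1 := by linarith
  refine ⟨A * (2 ^ (p - 1) * ENNReal.ofReal (max M₀ M₁) ^ p + S ^ p * volume Q ^ (p - 1)),
    by finiteness, fun u f hu hf heq i j => ?_⟩
  have huU : ContDiffOn ℝ ∞ u U := hu.mono hUQ
  have hfU : ContDiffOn ℝ ∞ f U := hf.mono hUQ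
  have hum : AEMeasurable u (volume.restrict Q) := hu.continuousOn.aemeasurable hQm
  set v := fun z => η z * u z with hv
  set F := fun z => η z * f z + b z * u z with hF
  set h : Fin n → EuclideanSpace ℝ (Fin n) × ℝ → ℝ := fun k z => c k z * u z with hh
  have hvs : ContDiff ℝ ∞ v := contDiff_mul_of_tsupport_subset hU hη huU hηU
  have hvc : HasCompactSupport v := hηc.mul_right
  have hFs : ContDiff ℝ ∞ F := (contDiff_mul_of_tsupport_subset hU hη hfU hηU).add
    (contDiff_mul_of_tsupport_subset hU hbs huU (hbt.trans hηU))
  have hFc : HasCompactSupport F := (hηc.mul_right).add hbc.mul_right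
  have hhs : ∀ k, ContDiff ℝ ∞ (h k) := fun k =>
    contDiff_mul_of_tsupport_subset hU (hcs k) huU ((hct k).trans hηU)
  have hhc : ∀ k, HasCompactSupport (h k) := fun k => (hcc k).mul_right
  have hout : ∀ a : EuclideanSpace ℝ (Fin n) × ℝ → ℝ, tsupport a ⊆ tsupport η →
      ∀ z ∉ Q, a z = 0 := fun a ha z hz =>
    image_eq_zero_of_notMem_tsupport fun hza => hz (hUQ (hηU (ha hza)))
  have hheat : ∀ z, heatOp v z = F z + ∑ k, pdx k (h k) z :=
    heatOp_cutoff_mul hU hη hηU huU fun z hz => heq z (hUQ hz)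
  refine ⟨hessEntryP v i j, ((hvs.pdx i).pdx j).continuous, fun z hz => ?_, ?_⟩
  · have hz' : z ∈ ball (0 : EuclideanSpace ℝ (Fin n)) (3 / 4) ×ˢ
        Set.Ioo (-(1 / 4) : ℝ) (1 / 4) := by
      have h1 := hz.2
      norm_num at h1
      exact ⟨ball_subset_ball (by norm_num) hz.1, by linarith [h1.1], by linarith [h1.2]⟩
    have hev : u =ᶠ[nhds z] v := by
      filter_upwards [(isOpen_ball.prod isOpen_Ioo).mem_nhds hz'] with w hw
      simp [hv, hη1 w hw]
    have hev' : pdx i u =ᶠ[nhds z] pdx i v := by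
      filter_upwards [hev.eventuallyEq_nhds] with w hw
      rw [pdx, pdx, hw.fderiv_eq]
    rw [hessEntryP, hessEntryP, pdx, hev'.fderiv_eq, ← pdx]
  · have hFint : ∫⁻ z, ‖F z‖ₑ ^ p ≤ 2 ^ (p - 1) * ENNReal.ofReal (max M₀ M₁) ^ p *
        ((∫⁻ z in Q, ‖u z‖ₑ ^ p) + ∫⁻ z in Q, ‖f z‖ₑ ^ p) :=
      lintegral_enorm_mul_add_mul_rpow_le hp hQm (fun z => (hM₀ z).trans (le_max_left _ _))
        (fun z => (hM₁ z).trans (le_max_right _ _)) (hout η le_rfl) (hout b hbt) hum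
    have hhk : ∀ k, ∫⁻ z, ‖h k z‖ₑ ≤ ENNReal.ofReal (m k) * ∫⁻ z in Q, ‖u z‖ₑ := fun k => by
      rw [← lintegral_const_mul' _ _ ENNReal.ofReal_ne_top, ← lintegral_indicator hQm]
      refine lintegral_mono fun z => ?_
      by_cases hz : z ∈ Q
      · rw [Set.indicator_of_mem hz, hh, enorm_mul, ← ofReal_norm (c k z)]
        gcongr
        exact hm k z
      · simp [Set.indicator_of_notMem hz, hh, hout (c k) (hct k) z hz]
    have hhInt : (∑ k, ∫⁻ z, ‖h k z‖ₑ) ^ p ≤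
        S ^ p * volume Q ^ (p - 1) * ∫⁻ z in Q, ‖u z‖ₑ ^ p := by
      calc (∑ k, ∫⁻ z, ‖h k z‖ₑ) ^ p ≤ (S * ∫⁻ z in Q, ‖u z‖ₑ) ^ p := by
            refine ENNReal.rpow_le_rpow ?_ hp0.le
            rw [hS, Finset.sum_mul]
            exact Finset.sum_le_sum fun k _ => hhk k
        _ ≤ S ^ p * (volume Q ^ (p - 1) * ∫⁻ z in Q, ‖u z‖ₑ ^ p) := by
            rw [ENNReal.mul_rpow_of_nonneg _ _ hp0.le]
            gcongr
            simpa using lintegral_rpow_le_measure_univ_mul hp hum.enorm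
        _ = _ := (mul_assoc _ _ _).symm
    refine (hbound i j v F h hvs hvc hFs hFc hhs hhc (fun k w hw => hηfar k w fun h0 => ?_)
      hheat).trans ?_
    · exact hw (by simp [hh, hc, h0])
    · rw [mul_assoc A, add_mul (2 ^ (p - 1) * _)]
      refine mul_le_mul_right (add_le_add hFint (hhInt.trans ?_)) A
      gcongr
      exact le_self_add

end interior_estimate

section conclusion

open scoped ContDiff

variable {n : ℕ}

theorem sqrt_hessFrobSqP_le (u : EuclideanSpace ℝ (Fin n) × ℝ → ℝ)
    (z : EuclideanSpace ℝ (Fin n) × ℝ) :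
    Real.sqrt (hessFrobSqP u z) ≤ ∑ i, ∑ j, |hessEntryP u i j z| := by
  refine Real.sqrt_le_iff.2 ⟨by positivity, ?_⟩
  rw [hessFrobSqP, ← Finset.univ.sum_product' Finset.univ fun i j => hessEntryP u i j z ^ 2,
    ← Finset.univ.sum_product' Finset.univ fun i j => |hessEntryP u i j z|]
  calc _ = ∑ x ∈ Finset.univ ×ˢ Finset.univ, |hessEntryP u x.1 x.2 z| ^ 2 := by simp only [sq_abs]
    _ ≤ _ := Finset.sum_sq_le_sq_sum_of_nonneg fun x _ => abs_nonneg _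

theorem abs_lapP_le (u : EuclideanSpace ℝ (Fin n) × ℝ → ℝ)
    (z : EuclideanSpace ℝ (Fin n) × ℝ) :
    |lapP u z| ≤ ∑ i, ∑ j, |hessEntryP u i j z| :=
  (Finset.abs_sum_le_sum_abs _ _).trans <| Finset.sum_le_sum fun i _ =>
    Finset.single_le_sum (f := fun j => |hessEntryP u i j z|) (fun _ _ => abs_nonneg _)
      (Finset.mem_univ i)

theorem ofReal_abs_rpow {p : ℝ} (hp : 0 ≤ p) (a : ℝ) :
    ENNReal.ofReal (|a| ^ p) = ‖a‖ₑ ^ p := by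
  rw [← ENNReal.ofReal_rpow_of_nonneg (abs_nonneg a) hp, Real.enorm_eq_ofReal_abs]

theorem ofReal_hess_add_ofReal_pdt_le {p : ℝ} (hp : 1 ≤ p)
    {u : EuclideanSpace ℝ (Fin n) × ℝ → ℝ} {z : EuclideanSpace ℝ (Fin n) × ℝ} {a : ℝ}
    (h : pdt u z - lapP u z = a) :
    ENNReal.ofReal (Real.sqrt (hessFrobSqP u z) ^ p) + ENNReal.ofReal (|pdt u z| ^ p) ≤
      2 * (2 ^ (p - 1) * (‖a‖ₑ ^ p + ((n * n : ℕ) : ℝ≥0∞) ^ (p - 1) *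
        ∑ x : Fin n × Fin n, ‖hessEntryP u x.1 x.2 z‖ₑ ^ p)) := by
  have hp0 : 0 ≤ p := by linarith
  have key : ∀ b : ℝ, |b| ≤ |a| + ∑ i, ∑ j, |hessEntryP u i j z| →
      ENNReal.ofReal (|b| ^ p) ≤ 2 ^ (p - 1) * (‖a‖ₑ ^ p + ((n * n : ℕ) : ℝ≥0∞) ^ (p - 1) *
        ∑ x : Fin n × Fin n, ‖hessEntryP u x.1 x.2 z‖ₑ ^ p) := fun b hb => by
    have hb' : ‖b‖ₑ ≤ ‖a‖ₑ + ∑ x : Fin n × Fin n, ‖hessEntryP u x.1 x.2 z‖ₑ := by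
      simp only [Real.enorm_eq_ofReal_abs]
      rw [← ENNReal.ofReal_sum_of_nonneg fun x _ => abs_nonneg _,
        ← ENNReal.ofReal_add (abs_nonneg _) (by positivity), Fintype.sum_prod_type]
      exact ENNReal.ofReal_le_ofReal hb
    rw [ofReal_abs_rpow hp0]
    calc ‖b‖ₑ ^ p ≤ (‖a‖ₑ + ∑ x : Fin n × Fin n, ‖hessEntryP u x.1 x.2 z‖ₑ) ^ p := by gcongr
      _ ≤ _ := ENNReal.rpow_add_le_mul_rpow_add_rpow _ _ hp
      _ ≤ _ := by
        gcongr
        simpa using ENNReal.rpow_sum_le_const_mul_sum_rpow (Finset.univ : Finset (Fin n × Fin n))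
          (fun x => ‖hessEntryP u x.1 x.2 z‖ₑ) hp
  rw [two_mul]
  refine add_le_add ?_ (key _ ?_)
  · rw [← abs_of_nonneg (Real.sqrt_nonneg (hessFrobSqP u z))]
    refine key _ ?_
    rw [abs_of_nonneg (Real.sqrt_nonneg _)]
    exact (sqrt_hessFrobSqP_le u z).trans (le_add_of_nonneg_left (abs_nonneg a))
  · rw [show pdt u z = a + lapP u z by linarith]
    exact (abs_add_le _ _).trans (add_le_add_right (abs_lapP_le u z) _)

theorem pCube_half_subset :
    pCube (1 / 2) ((0 : EuclideanSpace ℝ (Fin n)), (0 : ℝ)) ⊆ pCube 1 (0, 0) := by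
  refine Set.prod_mono (ball_subset_ball (by norm_num)) (Set.Ioc_subset_Ioc ?_ ?_) <;> norm_num

end conclusion
/-- Interior parabolic Calderón–Zygmund `L^p` estimate for the heat operator. -/
theorem calderon_zygmund_parabolic (n : ℕ) (hn : 1 ≤ n) (p : ℝ) (hp : 1 < p) :
    ∃ C : ℝ, 0 < C ∧
      ∀ u f : EuclideanSpace ℝ (Fin n) × ℝ → ℝ,
        ContDiffOn ℝ (⊤ : ℕ∞) u (pCube 1 (0, 0)) →
        ContDiffOn ℝ (⊤ : ℕ∞) f (pCube 1 (0, 0)) →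
        (∀ z ∈ pCube 1 ((0 : EuclideanSpace ℝ (Fin n)), (0 : ℝ)),
          pdt u z - lapP u z = f z) →
        ∫⁻ z in pCube (1/2) ((0 : EuclideanSpace ℝ (Fin n)), (0 : ℝ)),
            (ENNReal.ofReal (Real.sqrt (hessFrobSqP u z) ^ p) +
             ENNReal.ofReal (|pdt u z| ^ p)) ≤
          ENNReal.ofReal C *
            ((∫⁻ z in pCube 1 ((0 : EuclideanSpace ℝ (Fin n)), (0 : ℝ)),
                ENNReal.ofReal (|u z| ^ p)) +
             (∫⁻ z in pCube 1 ((0 : EuclideanSpace ℝ (Fin n)), (0 : ℝ)),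
                ENNReal.ofReal (|f z| ^ p))) := by
  have hp0 : 0 ≤ p := by linarith
  have hp1 : 0 ≤ p - 1 := by linarith
  obtain ⟨A, hA, hest⟩ := exists_lintegral_hessEntryP_interior_le n hp
  set N : ℝ≥0∞ := ((n * n : ℕ) : ℝ≥0∞) with hN
  have hNt : N ≠ ⊤ := ENNReal.natCast_ne_top _
  set K : ℝ≥0∞ := 2 * (2 ^ (p - 1) * (1 + N ^ (p - 1) * (N * A))) with hK
  have hKt : K ≠ ⊤ := by finiteness
  refine ⟨K.toReal + 1, by positivity, fun u f hu hf heq => ?_⟩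
  simp only [ofReal_abs_rpow hp0 (u _), ofReal_abs_rpow hp0 (f _)]
  choose w hw hHw hInt using hest u f hu hf heq
  set I := (∫⁻ z in pCube 1 ((0 : EuclideanSpace ℝ (Fin n)), (0 : ℝ)), ‖u z‖ₑ ^ p) +
    ∫⁻ z in pCube 1 ((0 : EuclideanSpace ℝ (Fin n)), (0 : ℝ)), ‖f z‖ₑ ^ p with hI
  have hwm : ∀ x : Fin n × Fin n, Measurable fun z => ‖w x.1 x.2 z‖ₑ ^ p := fun x =>
    (hw x.1 x.2).measurable.enorm.pow_const p
  calc _ ≤ ∫⁻ z in pCube (1 / 2) ((0 : EuclideanSpace ℝ (Fin n)), (0 : ℝ)),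
        2 * (2 ^ (p - 1) * (‖f z‖ₑ ^ p + N ^ (p - 1) *
          ∑ x : Fin n × Fin n, ‖w x.1 x.2 z‖ₑ ^ p)) := by
        refine setLIntegral_mono' (measurableSet_pCube _ _) fun z hz => ?_
        refine (ofReal_hess_add_ofReal_pdt_le hp.le (heq z (pCube_half_subset hz))).trans_eq ?_
        simp only [hHw _ _ z hz, hN]
    _ = 2 * (2 ^ (p - 1) * ((∫⁻ z in pCube (1 / 2) ((0 : EuclideanSpace ℝ (Fin n)), (0 : ℝ)),
          ‖f z‖ₑ ^ p) + N ^ (p - 1) * ∑ x : Fin n × Fin n,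
          ∫⁻ z in pCube (1 / 2) ((0 : EuclideanSpace ℝ (Fin n)), (0 : ℝ)),
            ‖w x.1 x.2 z‖ₑ ^ p)) := by
        rw [lintegral_const_mul' _ _ (by finiteness), lintegral_const_mul' _ _ (by finiteness),
          lintegral_add_right _ ((Finset.measurable_fun_sum _ fun x _ => hwm x).const_mul _),
          lintegral_const_mul' _ _ (by finiteness), lintegral_finsetSum _ fun x _ => hwm x]
    _ ≤ 2 * (2 ^ (p - 1) * (I + N ^ (p - 1) * ∑ _x : Fin n × Fin n, A * I)) := by
        gcongr with x
        · exact (lintegral_mono_set pCube_half_subset).trans le_add_self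
        · exact hInt x.1 x.2
    _ = K * I := by
        rw [Finset.sum_const, Finset.card_univ, Fintype.card_prod, Fintype.card_fin, nsmul_eq_mul,
          ← hN]
        ring
    _ ≤ _ := by
        gcongr
        exact (ENNReal.ofReal_toReal hKt).symm.le.trans (ENNReal.ofReal_le_ofReal (by linarith))
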